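/- arXiv:math/0506316 — 2 statements merged into one kernel-verified Lean document; each statement's English description precedes it below -/
import Mathlib

section
/- The number of combinatorial isomorphism classes of orientable triangulated surfaces with exactly 10 vertices and Euler characteristic −4 (vertex-minimal triangulations of the orientable surface of genus 3) is 20. -/
open scoped Classical

/-- A triangulated surface on the vertex set `Fin n`: a finite 2-dimensional simplicial
complex given by its set of triangles, which is connected, in which every vertex lies in
some triangle, every edge lies in exactly two triangles, and the link of every vertex is
a single cycle (encoded as: the link graph of every vertex is connected; together with the
condition that every edge lies in exactly two triangles this makes every vertex link a
single circle). -/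
structure TriSurface (n : ℕ) where
  faces : Finset (Finset (Fin n))
  card_eq : ∀ f ∈ faces, f.card = 3
  vertex_mem : ∀ v : Fin n, ∃ f ∈ faces, v ∈ f
  edge_two : ∀ u v : Fin n, u ≠ v → (∃ f ∈ faces, u ∈ f ∧ v ∈ f) →
      (faces.filter (fun f => u ∈ f ∧ v ∈ f)).card = 2
  conn : ∀ u v : Fin n,
      Relation.ReflTransGen (fun a b : Fin n => ∃ f ∈ faces, a ∈ f ∧ b ∈ f) u v
  link_cycle : ∀ v a b : Fin n,
      (∃ f ∈ faces, v ∈ f ∧ a ∈ f ∧ a ≠ v) →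
      (∃ f ∈ faces, v ∈ f ∧ b ∈ f ∧ b ≠ v) →
      Relation.ReflTransGen
        (fun x y : Fin n => x ≠ y ∧ x ≠ v ∧ y ≠ v ∧ ({v, x, y} : Finset (Fin n)) ∈ faces)
        a b

/-- The edges of a triangulated surface: all 2-element vertex sets contained in a triangle. -/
noncomputable def TriSurface.edges {n : ℕ} (S : TriSurface n) : Finset (Finset (Fin n)) :=
  Finset.univ.filter (fun e => e.card = 2 ∧ ∃ f ∈ S.faces, e ⊆ f)

/-- The Euler characteristic χ = f₀ - f₁ + f₂ of a triangulated surface. -/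
noncomputable def TriSurface.eulerChar {n : ℕ} (S : TriSurface n) : ℤ :=
  (n : ℤ) - (S.edges.card : ℤ) + (S.faces.card : ℤ)

/-- Combinatorial isomorphism: a bijection of the vertices mapping triangles to triangles. -/
def TriSurface.Iso {n : ℕ} (S T : TriSurface n) : Prop :=
  ∃ σ : Equiv.Perm (Fin n), ∀ f : Finset (Fin n), f ∈ S.faces ↔ f.image σ ∈ T.faces

/-- Orientability: each triangle can be given a cyclic orientation (recorded as the set of
its three induced directed edges) such that the two orientations induced on each edge by
the two triangles containing it are opposite (no directed edge is induced twice). -/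
def TriSurface.Orientable {n : ℕ} (S : TriSurface n) : Prop :=
  ∃ ω : Finset (Fin n) → Finset (Fin n × Fin n),
    (∀ f ∈ S.faces, ∃ a b c : Fin n, a ≠ b ∧ a ≠ c ∧ b ≠ c ∧
        f = {a, b, c} ∧ ω f = {(a, b), (b, c), (c, a)}) ∧
    (∀ f ∈ S.faces, ∀ g ∈ S.faces, f ≠ g → ∀ p ∈ ω f, p ∉ ω g)

/-- The edge `uv` is contractible: the only common neighbours of `u` and `v` are the two
vertices `w`, `z` with `uvw`, `uvz` triangles, and the edge `wz` is not contained in both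
the link of `u` and the link of `v`. -/
def TriSurface.Contractible {n : ℕ} (S : TriSurface n) (u v : Fin n) : Prop :=
  ({u, v} : Finset (Fin n)) ∈ S.edges ∧
  (∀ w : Fin n, w ≠ u → w ≠ v →
      ({u, w} : Finset (Fin n)) ∈ S.edges → ({v, w} : Finset (Fin n)) ∈ S.edges →
      ({u, v, w} : Finset (Fin n)) ∈ S.faces) ∧
  ¬ ∃ w z : Fin n, ({u, v, w} : Finset (Fin n)) ∈ S.faces ∧
      ({u, v, z} : Finset (Fin n)) ∈ S.faces ∧ w ≠ z ∧
      ({u, w, z} : Finset (Fin n)) ∈ S.faces ∧ ({v, w, z} : Finset (Fin n)) ∈ S.faces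

/-- A triangulated surface is irreducible if it has no contractible edge. -/
def TriSurface.Irreducible {n : ℕ} (S : TriSurface n) : Prop :=
  ¬ ∃ u v : Fin n, S.Contractible u v

/-- The simplices of the complex: the nonempty subsets of triangles. -/
def TriSurface.IsSimplex {n : ℕ} (S : TriSurface n) (σ : Finset (Fin n)) : Prop :=
  σ.Nonempty ∧ ∃ f ∈ S.faces, σ ⊆ f

/-- A geometric realization in ℝ³: each triangle is mapped to affinely independent points,
and the convex hulls of the point sets of any two simplices of the complex intersect
exactly in the convex hull of the points of their common vertices. -/
def TriSurface.IsRealization {n : ℕ} (S : TriSurface n) (p : Fin n → (Fin 3 → ℝ)) : Prop :=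
  (∀ f ∈ S.faces, AffineIndependent ℝ (fun x : {x // x ∈ f} => p x.1)) ∧
  ∀ σ τ : Finset (Fin n), S.IsSimplex σ → S.IsSimplex τ →
    convexHull ℝ (p '' ↑σ) ∩ convexHull ℝ (p '' ↑τ) = convexHull ℝ (p '' ↑(σ ∩ τ))

/-- Neighborly: every pair of distinct vertices forms an edge. -/
def TriSurface.Neighborly {n : ℕ} (S : TriSurface n) : Prop :=
  ∀ u v : Fin n, u ≠ v → ({u, v} : Finset (Fin n)) ∈ S.edges

noncomputable section

/-! ### Arithmetic primitives evaluated by the kernel -/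

/-- `f n`, arranged so that the kernel evaluates `n` to a literal first. -/
abbrev force {β : Type} (n : ℕ) (f : ℕ → β) : β :=
  Nat.rec (f 0) (fun m _ => f (Nat.succ m)) n

/-- `if b then t else f`, as a bare recursor. -/
abbrev ifb {β : Type} (b : Bool) (t f : β) : β := Bool.rec f t b

/-- The `w`-th binary digit of `m`; bit masks encode sets of vertices. -/
abbrev bit (m w : ℕ) : Bool := Nat.beq (Nat.land (Nat.shiftRight m w) 1) 1

/-- A natural number encodes a table of oriented triangles: its digit in base `11` at position
`10 * a + b` is `c + 1` if `(a, b, c)` is in the table, and `0` if no triangle `(a, b, _)` is. -/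
def get (W a b : ℕ) : ℕ :=
  Nat.mod (Nat.div W (Nat.pow 11 (Nat.add (Nat.mul 10 a) b))) 11

/-- Writes the entry `c + 1` at an empty position of the table. -/
def put (W a b c : ℕ) : ℕ :=
  Nat.add W (Nat.mul (Nat.succ c) (Nat.pow 11 (Nat.add (Nat.mul 10 a) b)))

/-- Adds an oriented triangle to the table, with its rotations. -/
def addTri (W a b c : ℕ) : ℕ := put (put (put W a b c) b c a) c a b

theorem force_eq {β : Type} (n : ℕ) (f : ℕ → β) : force n f = f n := by cases n <;> rfl

theorem ifb_eq {β : Type} (b : Bool) (t f : β) : ifb b t f = if b = true then t else f := by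
  cases b <;> rfl

theorem bit_eq (m w : ℕ) : bit m w = m.testBit w := by
  have h : bit m w = Nat.beq ((m >>> w) &&& 1) 1 := rfl
  rw [h, Nat.testBit_eq_decide_div_mod_eq, Nat.and_one_is_mod, Nat.shiftRight_eq_div_pow]
  rcases Nat.mod_two_eq_zero_or_one (m / 2 ^ w) with e | e <;> rw [e] <;> rfl

theorem get_eq (W a b : ℕ) : get W a b = W / 11 ^ (10 * a + b) % 11 := rfl

theorem get_le (W a b : ℕ) : get W a b ≤ 10 := by
  rw [get_eq]; omega

theorem digit_add (W i j d : ℕ) (hd : d ≤ 10) (h : W / 11 ^ i % 11 = 0) :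
    (W + d * 11 ^ i) / 11 ^ j % 11 = if i = j then d else W / 11 ^ j % 11 := by
  rcases lt_trichotomy i j with hij | rfl | hij
  · rw [if_neg hij.ne]
    obtain ⟨t, rfl⟩ := Nat.exists_eq_add_of_lt hij
    have e : 11 ^ (i + t + 1) = 11 ^ i * 11 * 11 ^ t := by ring
    rw [e, ← Nat.div_div_eq_div_mul, ← Nat.div_div_eq_div_mul, ← Nat.div_div_eq_div_mul,
      ← Nat.div_div_eq_div_mul, Nat.add_mul_div_right _ _ (by positivity)]
    congr 2
    omega
  · rw [if_pos rfl, Nat.add_mul_div_right _ _ (by positivity)]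
    omega
  · rw [if_neg hij.ne']
    obtain ⟨t, rfl⟩ := Nat.exists_eq_add_of_lt hij
    have e : d * 11 ^ (j + t + 1) = d * 11 ^ t * 11 * 11 ^ j := by ring
    rw [e, Nat.add_mul_div_right _ _ (by positivity)]
    omega

theorem get_put {W a b c : ℕ} (hc : c < 10) (h : get W a b = 0) {x y : ℕ} (hb : b < 10)
    (hy : y < 10) : get (put W a b c) x y = if a = x ∧ b = y then c + 1 else get W x y := by
  have := digit_add W (10 * a + b) (10 * x + y) (c + 1) (by omega) h
  rw [get_eq, get_eq]
  change (W + (c + 1) * 11 ^ (10 * a + b)) / 11 ^ (10 * x + y) % 11 = _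
  rw [this]
  congr 1
  rw [eq_iff_iff]
  omega

theorem get_addTri {W a b c : ℕ} (ha : a < 10) (hb : b < 10) (hc : c < 10) (hab : a ≠ b)
    (hac : a ≠ c) (hbc : b ≠ c) (h₁ : get W a b = 0) (h₂ : get W b c = 0) (h₃ : get W c a = 0)
    {x y : ℕ} (hy : y < 10) :
    get (addTri W a b c) x y = if a = x ∧ b = y then c + 1 else if b = x ∧ c = y then a + 1
      else if c = x ∧ a = y then b + 1 else get W x y := by
  have e₁ : ∀ {x y : ℕ}, y < 10 → get (put W a b c) x y = _ := fun h => get_put hc h₁ hb h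
  have e₂ : ∀ {x y : ℕ}, y < 10 → get (put (put W a b c) b c a) x y = _ := fun h =>
    get_put ha (by rw [e₁ hc]; simp [hab, h₂]) hc h
  rw [addTri, get_put hb (by rw [e₂ ha, e₁ ha]; simp [hbc, hac, h₃]) ha hy, e₂ hy, e₁ hy]
  split_ifs <;> omega

/-! ### The search -/

/-- Follows the known triangles around `x` from `z` to `y`, collecting the vertices passed in the
mask `m`; the result is `0` if the walk does not reach `y`. -/
def walk (W x y n : ℕ) : ℕ → ℕ → ℕ :=
  Nat.rec (fun _ _ => 0) (fun _ ih z m =>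
    ifb (Nat.beq z y) m
      (Nat.rec 0 (fun w _ => force (Nat.lor m (Nat.shiftLeft 1 w)) fun m => ih w m)
        (get W x z))) n

/-- Given that the link of `x` has vertex set `m`, adds to `k` the number of vertices `w < n`
outside it which are not in `C`, and checks that no known triangle contradicts the link. -/
def countMissing {β : Type} (W C x m n : ℕ) : ℕ → β → (ℕ → β) → β :=
  Nat.rec (fun k _ cont => cont k) (fun w ih k fail cont =>
    ifb (bit m w) (ih k fail cont)
    (ifb (Nat.beq x w) (ih k fail cont)
      (Nat.rec (ifb (bit C w) (ih k fail cont) (force (Nat.succ k) fun k => ih k fail cont))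
        (fun _ _ => fail) (get W x w)))) n

/-- If the link of `x` was completed by the triangle `(x, y, z)`, adds `x` to the set `C` of
vertices with complete links and updates the number `k` of missing edges at `C`. -/
def close {β : Type} (W x y z C k : ℕ) (fail : β) (cont : ℕ → ℕ → β) : β :=
  Nat.rec (cont C k)
    (fun m _ => countMissing W C x (Nat.succ m) 10 k fail (fun k =>
      ifb (Nat.ble k 3) (force (Nat.lor C (Nat.shiftLeft 1 x)) fun C => cont C k) fail))
    (walk W x y 10 z (Nat.shiftLeft 1 z))

/-- Finds `b` in `l` such that a triangle `(b, a, _)` is known but no triangle `(a, b, _)` is. -/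
def pickSnd {β : Type} (W a : ℕ) (fail : β) (cont : ℕ → β) (l : List ℕ) : β :=
  List.rec fail (fun b _ ih =>
    Nat.rec (Nat.rec ih (fun _ _ => cont b) (get W b a)) (fun _ _ => ih) (get W a b)) l

/-- The order in which vertices are tried. -/
def order : List ℕ := [4, 2, 9, 7, 5, 8, 6, 3, 1]

/-- Finds a directed edge `(a, b)` which has a triangle on one side only. -/
def pick {β : Type} (W C : ℕ) (fail : β) (cont : ℕ → ℕ → β) (l : List ℕ) : β :=
  List.rec fail (fun a _ ih =>
    ifb (bit C a) ih (pickSnd W a ih (fun b => cont a b) order)) l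

/-- Tries all triangles `(a, b, c)` with `c` in `l`. -/
def branch (ok : ℕ → ℕ → ℕ → Bool) (a b W C k : ℕ) (next : ℕ → ℕ → ℕ → List ℕ) (l : List ℕ) :
    List ℕ :=
  List.rec [] (fun c _ ih =>
    ifb (bit C c) ih
    (ifb (Nat.beq a c) ih
    (ifb (Nat.beq b c) ih
    (Nat.rec
      (Nat.rec
        (ifb (ok a b c)
          (force (addTri W a b c) fun W =>
          close W a b c C k ih fun C k =>
          close W b c a C k ih fun C k =>
          close W c a b C k ih fun C k => List.append (next W C k) ih) ih)
        (fun _ _ => ih) (get W c a))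
      (fun _ _ => ih) (get W b c))))) l

/-- Depth-first search for all completions of a partial table in which only triangles allowed by
`ok` are added. -/
def search (ok : ℕ → ℕ → ℕ → Bool) (n : ℕ) : ℕ → ℕ → ℕ → List ℕ :=
  Nat.rec (fun W _ _ => [W]) (fun _ ih W C k =>
    pick W C [W] (fun a b => branch ok a b W C k ih [0, 1, 2, 3, 4, 5, 6, 7, 8, 9])
      order) n

/-- The table of the triangles `(0, i, i + 1)` and `(0, 9, 1)`. -/
def wheel : ℕ := (List.range 9).foldl (fun W i => addTri W 0 (i + 1) ((i + 1) % 9 + 1)) 0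

/-! ### Soundness of the search -/

/-- The properties of the set of oriented triangles of a surface on which the search relies. -/
structure SearchHyp (T : ℕ → ℕ → ℕ → Prop) : Prop where
  lt : ∀ {a b c}, T a b c → a < 10
  rot : ∀ {a b c}, T a b c → T b c a
  ne : ∀ {a b c}, T a b c → a ≠ b
  unique : ∀ {a b c d}, T a b c → T a b d → c = d
  opp : ∀ {a b c}, T a b c → ∃ d, T b a d
  link : ∀ {v y z} (C : ℕ → Prop), T v y z → C y → (∀ x y, C x → T v x y → C y) →
    ∀ {x y}, T v x y → C x
  card_le : ∀ U : Finset (Sym2 ℕ), (∀ e ∈ U, ∃ x < 10, ∃ w < 10, x ≠ w ∧ e = s(x, w) ∧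
    ∀ c, ¬ T x w c) → U.card ≤ 3

/-- A search state `(W, C, k)` is compatible with the surface `T`. -/
structure Compatible (T : ℕ → ℕ → ℕ → Prop) (W C k : ℕ) : Prop where
  sound : ∀ {a b c}, a < 10 → b < 10 → get W a b = c + 1 → T a b c
  rot : ∀ {a b c}, a < 10 → b < 10 → get W a b = c + 1 → get W b c = a + 1
  complete : ∀ {x y z}, C.testBit x = true → T x y z → get W x y ≠ 0
  missing : ∃ U : Finset (Sym2 ℕ), U.card = k ∧ ∀ e ∈ U, ∃ x < 10, ∃ w < 10, x ≠ w ∧ e = s(x, w) ∧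
    (∀ c, ¬ T x w c) ∧ C.testBit x = true

/-- Membership in a mask with one bit added. -/
theorem testBit_lor_one (m u v : ℕ) : (Nat.lor m (Nat.shiftLeft 1 u)).testBit v = true ↔
    m.testBit v = true ∨ v = u := by
  change (m ||| 1 <<< u).testBit v = true ↔ _
  rw [Nat.testBit_or, Bool.or_eq_true, Nat.one_shiftLeft, Nat.testBit_two_pow, decide_eq_true_eq,
    @eq_comm _ u]

theorem testBit_one_shiftLeft (u v : ℕ) : (Nat.shiftLeft 1 u).testBit v = true ↔ v = u := by
  change (1 <<< u).testBit v = true ↔ _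
  rw [Nat.one_shiftLeft, Nat.testBit_two_pow, decide_eq_true_eq, eq_comm]

section Soundness

variable {T : ℕ → ℕ → ℕ → Prop} {W C k : ℕ}

theorem SearchHyp.lt₂ (hT : SearchHyp T) {a b c : ℕ} (h : T a b c) : b < 10 := hT.lt (hT.rot h)

theorem SearchHyp.lt₃ (hT : SearchHyp T) {a b c : ℕ} (h : T a b c) : c < 10 := hT.lt₂ (hT.rot h)

theorem Compatible.get_eq_of (hT : SearchHyp T) (h : Compatible T W C k) {a b c : ℕ}
    (hc : T a b c) (h₀ : get W a b ≠ 0) : get W a b = c + 1 := by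
  obtain ⟨d, hd⟩ := Nat.exists_eq_succ_of_ne_zero h₀
  rw [hT.unique hc (h.sound (hT.lt hc) (hT.lt₂ hc) hd), hd]

theorem Compatible.get_rot_eq_zero (hT : SearchHyp T) (h : Compatible T W C k) {a b c : ℕ}
    (hc : T a b c) (h₀ : get W a b = 0) : get W b c = 0 ∧ get W c a = 0 := by
  have hbc : get W b c = 0 → get W c a = 0 := fun h₁ => by
    by_contra h₂
    have := h.rot (hT.lt₃ hc) (hT.lt hc) (h.get_eq_of hT (hT.rot (hT.rot hc)) h₂)
    omega
  by_cases h₁ : get W b c = 0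
  · exact ⟨h₁, hbc h₁⟩
  · have h₂ := h.rot (hT.lt₂ hc) (hT.lt₃ hc) (h.get_eq_of hT (hT.rot hc) h₁)
    have := h.rot (hT.lt₃ hc) (hT.lt hc) h₂
    omega

theorem Compatible.addTri (hT : SearchHyp T) (h : Compatible T W C k) {a b c : ℕ}
    (hc : T a b c) (h₀ : get W a b = 0) : Compatible T (addTri W a b c) C k := by
  obtain ⟨h₁, h₂⟩ := h.get_rot_eq_zero hT hc h₀
  have key : ∀ {x y : ℕ}, y < 10 → get (_root_.addTri W a b c) x y = _ := fun hy =>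
    get_addTri (hT.lt hc) (hT.lt₂ hc) (hT.lt₃ hc) (hT.ne hc) (hT.ne (hT.rot (hT.rot hc))).symm
      (hT.ne (hT.rot hc)) h₀ h₁ h₂ hy
  refine ⟨fun {x y z} hx hy hz => ?_, fun {x y z} hx hy hz => ?_, fun hx hxy => ?_, h.missing⟩
  · rw [key hy] at hz
    split_ifs at hz with e e e
    · obtain ⟨rfl, rfl⟩ := e
      obtain rfl : c = z := by omega
      exact hc
    · obtain ⟨rfl, rfl⟩ := e
      obtain rfl : a = z := by omega
      exact hT.rot hc
    · obtain ⟨rfl, rfl⟩ := e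
      obtain rfl : b = z := by omega
      exact hT.rot (hT.rot hc)
    · exact h.sound hx hy hz
  · have hz' : z < 10 := by have := get_le (_root_.addTri W a b c) x y; omega
    have hab := hT.ne hc
    have hbc := hT.ne (hT.rot hc)
    have hca := hT.ne (hT.rot (hT.rot hc))
    rw [key hy] at hz
    rw [key hz']
    split_ifs at hz with e e e
    · rw [if_neg (by omega), if_pos (by omega)]; omega
    · rw [if_neg (by omega), if_neg (by omega), if_pos (by omega)]; omega
    · rw [if_pos (by omega)]; omega
    · have := h.rot hx hy hz
      have ne : ∀ u v w : ℕ, u = y → v = z → get W u v = 0 → False := by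
        rintro _ _ _ rfl rfl h0; omega
      rw [if_neg (fun e => ne a b c e.1 e.2 h₀), if_neg (fun e => ne b c a e.1 e.2 h₁),
        if_neg (fun e => ne c a b e.1 e.2 h₂), this]
  · rw [key (hT.lt₂ hxy)]
    split_ifs <;> first | omega | exact h.complete hx hxy

/-- Following the link of `x` along known triangles either fails or yields the whole link. -/
theorem walk_spec (hs : ∀ {a b c}, a < 10 → b < 10 → get W a b = c + 1 → T a b c)
    (hT : SearchHyp T) {x y : ℕ} {z₀ : ℕ} (hy : T x y z₀) (n : ℕ) (z m : ℕ) (hz : z < 10)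
    (hm : ∀ w, m.testBit w = true → w = z ∨ get W x w ≠ 0 ∧ ∀ v, T x w v → m.testBit v = true)
    (hz₀ : m.testBit z₀ = true) (hzm : m.testBit z = true) (h₀ : get W x y ≠ 0)
    (hw : walk W x y n z m ≠ 0) (w : ℕ) :
    ((∃ v, T x w v) → (walk W x y n z m).testBit w = true) ∧
      ((walk W x y n z m).testBit w = true → get W x w ≠ 0) := by
  induction n generalizing z m with
  | zero => exact absurd rfl hw
  | succ n ih =>
    have e : walk W x y (n + 1) z m = ifb (Nat.beq z y) m
      (Nat.rec 0 (fun w _ => force (Nat.lor m (Nat.shiftLeft 1 w)) fun m => walk W x y n w m)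
        (get W x z)) := rfl
    rw [ifb_eq] at e
    by_cases hzy : z = y
    · subst hzy
      rw [if_pos (Nat.beq_refl z)] at e
      rw [e]
      refine ⟨fun ⟨v, hv⟩ => ?_, fun hw => ?_⟩
      · refine hT.link (fun u => m.testBit u = true) hy hzm (fun u v hu huv => ?_) hv
        rcases hm u hu with rfl | hu'
        · rwa [hT.unique huv hy]
        · exact hu'.2 v huv
      · rcases hm w hw with rfl | hu
        · exact h₀
        · exact hu.1
    · rw [if_neg (by simpa using hzy)] at e
      cases hg : get W x z with
      | zero => rw [hg] at e; exact absurd e hw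
      | succ u =>
        rw [hg] at e
        change _ = force _ _ at e
        rw [force_eq] at e
        have hu : T x z u := hs (hT.lt hy) hz hg
        have hor := fun v => testBit_lor_one m u v
        rw [e] at hw ⊢
        refine ih u _ (hT.lt₃ hu) (fun w hw => ?_) ((hor _).2 (Or.inl hz₀))
          ((hor _).2 (Or.inr rfl)) hw
        rcases (hor w).1 hw with hw | rfl
        · right
          rcases hm w hw with rfl | hw'
          · refine ⟨by rw [hg]; exact Nat.succ_ne_zero u, fun v hv =>
              (hor v).2 (Or.inr (hT.unique hv hu))⟩
          · exact ⟨hw'.1, fun v hv => (hor v).2 (Or.inl (hw'.2 v hv))⟩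
        · exact Or.inl rfl

theorem countMissing_eq {β : Type} {x m : ℕ}
    (h : ∀ w < 10, m.testBit w = false → w ≠ x → get W x w = 0) (n k : ℕ) (hn : n ≤ 10)
    (fail : β) (cont : ℕ → β) :
    countMissing W C x m n k fail cont = cont (k + ((Finset.range n).filter fun w =>
      m.testBit w = false ∧ w ≠ x ∧ C.testBit w = false).card) := by
  induction n generalizing k with
  | zero => rfl
  | succ n ih =>
    have e : countMissing W C x m (n + 1) k fail cont =
      ifb (bit m n) (countMissing W C x m n k fail cont)
      (ifb (Nat.beq x n) (countMissing W C x m n k fail cont)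
      (Nat.rec (ifb (bit C n) (countMissing W C x m n k fail cont)
        (force (Nat.succ k) fun k => countMissing W C x m n k fail cont))
        (fun _ _ => fail) (get W x n))) := rfl
    rw [Finset.range_add_one, Finset.filter_insert, e, ifb_eq, bit_eq, ih _ (by omega)]
    by_cases hm : m.testBit n = true
    · rw [if_pos hm, if_neg (by simp [hm])]
    rw [if_neg hm, ifb_eq]
    by_cases hx : x = n
    · rw [if_pos (by simp [hx]), if_neg (by simp [hx])]
    rw [if_neg (by simpa using hx), h n (by omega) (by simpa using hm) (Ne.symm hx)]
    change ifb _ _ _ = _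
    rw [ifb_eq, bit_eq, force_eq]
    by_cases hC : C.testBit n = true
    · rw [if_pos hC, if_neg (by simp [hC])]
    · rw [if_neg hC, if_pos ⟨by simpa using hm, Ne.symm hx, by simpa using hC⟩,
        Finset.card_insert_of_notMem (by simp), ih _ (by omega)]
      congr 1
      omega

theorem Compatible.close (hT : SearchHyp T) (h : Compatible T W C k) {x y z : ℕ}
    (hg : get W x y = z + 1) (hx : x < 10) (hy : y < 10) (hxC : C.testBit x = false) :
    ∃ C' k', Compatible T W C' k' ∧
      (∀ w, C'.testBit w = true → C.testBit w = true ∨ w = x) ∧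
      ∀ {β : Type} (fail : β) (cont : ℕ → ℕ → β), close W x y z C k fail cont = cont C' k' := by
  have hxyz := h.sound hx hy hg
  have hone := testBit_one_shiftLeft z
  have hw := @walk_spec T W h.sound hT x y z hxyz 10 z (Nat.shiftLeft 1 z) (hT.lt₃ hxyz)
    (fun w hw => Or.inl ((hone w).1 hw)) ((hone z).2 rfl) ((hone z).2 rfl) (by omega)
  have e : ∀ {β : Type} (fail : β) (cont : ℕ → ℕ → β), _root_.close W x y z C k fail cont =
    Nat.rec (cont C k)
    (fun m _ => countMissing W C x (Nat.succ m) 10 k fail (fun k =>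
      ifb (Nat.ble k 3) (force (Nat.lor C (Nat.shiftLeft 1 x)) fun C => cont C k) fail))
    (walk W x y 10 z (Nat.shiftLeft 1 z)) := fun _ _ => rfl
  generalize walk W x y 10 z (Nat.shiftLeft 1 z) = m at e hw
  cases m with
  | zero => exact ⟨C, k, h, fun w => Or.inl, e⟩
  | succ m =>
    replace hw := hw (by omega)
    have hzero : ∀ w < 10, (Nat.succ m).testBit w = false → w ≠ x → get W x w = 0 := by
      intro w hw10 hwm hwx
      by_contra h₀
      obtain ⟨c, hc⟩ := Nat.exists_eq_succ_of_ne_zero h₀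
      have := (hw w).1 ⟨c, h.sound hx hw10 hc⟩
      simp [hwm] at this
    obtain ⟨U, hUk, hU⟩ := h.missing
    set V : Finset ℕ := (Finset.range 10).filter fun w =>
      (Nat.succ m).testBit w = false ∧ w ≠ x ∧ C.testBit w = false with hV
    have hinj : Set.InjOn (fun w => s(x, w)) V := fun w _ w' _ hww' => by
      rcases Sym2.eq_iff.1 hww' with h | h <;> omega
    have hdisj : Disjoint U (V.image fun w => s(x, w)) := by
      rw [Finset.disjoint_left]
      intro p hp hp'
      obtain ⟨w, hwV, rfl⟩ := Finset.mem_image.1 hp'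
      obtain ⟨u, -, v, -, -, huv, -, hu⟩ := hU _ hp
      have hw' := (Finset.mem_filter.1 hwV).2.2.2
      rcases Sym2.eq_iff.1 huv with ⟨rfl, rfl⟩ | ⟨rfl, rfl⟩ <;> simp_all
    have hor := testBit_lor_one C x
    have hcomp : Compatible T W (Nat.lor C (Nat.shiftLeft 1 x)) (k + V.card) := by
      refine ⟨h.sound, h.rot, fun {u v w} hu huv => ?_, U ∪ V.image fun w => s(x, w), ?_, ?_⟩
      · rcases (hor u).1 hu with hu | rfl
        · exact h.complete hu huv
        · exact (hw v).2 ((hw v).1 ⟨w, huv⟩)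
      · rw [Finset.card_union_of_disjoint hdisj, Finset.card_image_of_injOn hinj, hUk]
      · intro p hp
        rcases Finset.mem_union.1 hp with hp | hp
        · obtain ⟨u, hu, v, hv, huv, hp, hc, hu'⟩ := hU p hp
          exact ⟨u, hu, v, hv, huv, hp, hc, (hor u).2 (Or.inl hu')⟩
        · obtain ⟨w, hwV, rfl⟩ := Finset.mem_image.1 hp
          obtain ⟨hw10, hwm, hwx, -⟩ := Finset.mem_filter.1 hwV
          refine ⟨x, hx, w, Finset.mem_range.1 hw10, hwx.symm, rfl, fun c hc => ?_,
            (hor x).2 (Or.inr rfl)⟩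
          have := (hw w).1 ⟨c, hc⟩
          simp [hwm] at this
    have hk : k + V.card ≤ 3 := by
      obtain ⟨U', hU'k, hU'⟩ := hcomp.missing
      rw [← hU'k]
      refine hT.card_le U' fun p hp => ?_
      obtain ⟨u, hu, v, hv, huv, hp, hc, -⟩ := hU' p hp
      exact ⟨u, hu, v, hv, huv, hp, hc⟩
    refine ⟨_, _, hcomp, fun w => (hor w).1, fun fail cont => ?_⟩
    rw [e]
    change countMissing W C x (Nat.succ m) 10 k fail _ = _
    rw [countMissing_eq hzero 10 k le_rfl, ← hV, ifb_eq, if_pos (by simpa using hk), force_eq]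

theorem mem_countMissing {x m n k : ℕ} {fail : List ℕ} {cont : ℕ → List ℕ} {L : ℕ}
    (hf : L ∈ fail) (hc : ∀ k, L ∈ cont k) : L ∈ countMissing W C x m n k fail cont := by
  induction n generalizing k with
  | zero => exact hc k
  | succ n ih =>
    change L ∈ ifb (bit m n) (countMissing W C x m n k fail cont)
      (ifb (Nat.beq x n) (countMissing W C x m n k fail cont)
      (Nat.rec (ifb (bit C n) (countMissing W C x m n k fail cont)
        (force (Nat.succ k) fun k => countMissing W C x m n k fail cont))
        (fun _ _ => fail) (get W x n)))
    rw [ifb_eq, ifb_eq]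
    split_ifs
    · exact ih
    · exact ih
    · cases get W x n with
      | zero =>
        change L ∈ ifb _ _ _
        rw [ifb_eq, force_eq]
        split_ifs <;> exact ih
      | succ => exact hf

theorem mem_close {x y z k : ℕ} {fail : List ℕ} {cont : ℕ → ℕ → List ℕ} {L : ℕ}
    (hf : L ∈ fail) (hc : ∀ C k, L ∈ cont C k) : L ∈ close W x y z C k fail cont := by
  change L ∈ (Nat.rec (cont C k)
    (fun m _ => countMissing W C x (Nat.succ m) 10 k fail (fun k =>
      ifb (Nat.ble k 3) (force (Nat.lor C (Nat.shiftLeft 1 x)) fun C => cont C k) fail))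
    (walk W x y 10 z (Nat.shiftLeft 1 z)) : List ℕ)
  cases walk W x y 10 z (Nat.shiftLeft 1 z) with
  | zero => exact hc C k
  | succ m =>
    refine mem_countMissing hf fun k => ?_
    rw [ifb_eq, force_eq]
    split_ifs
    · exact hc _ k
    · exact hf

theorem branch_cons (ok : ℕ → ℕ → ℕ → Bool) (a b W C k : ℕ) (next : ℕ → ℕ → ℕ → List ℕ)
    (c : ℕ) (l : List ℕ) :
    branch ok a b W C k next (c :: l) =
      if C.testBit c = true ∨ a = c ∨ b = c ∨ get W b c ≠ 0 ∨ get W c a ≠ 0 ∨ ok a b c = false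
      then branch ok a b W C k next l
      else
        close (addTri W a b c) a b c C k (branch ok a b W C k next l) fun C₁ k₁ =>
        close (addTri W a b c) b c a C₁ k₁ (branch ok a b W C k next l) fun C₂ k₂ =>
        close (addTri W a b c) c a b C₂ k₂ (branch ok a b W C k next l) fun C₃ k₃ =>
          next (addTri W a b c) C₃ k₃ ++ branch ok a b W C k next l := by
  change ifb (bit C c) (branch ok a b W C k next l) (ifb (Nat.beq a c) (branch ok a b W C k next l)
    (ifb (Nat.beq b c) (branch ok a b W C k next l) (Nat.rec (Nat.rec
        (ifb (ok a b c)
          (force (addTri W a b c) fun W' =>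
          close W' a b c C k (branch ok a b W C k next l) fun C₁ k₁ =>
          close W' b c a C₁ k₁ (branch ok a b W C k next l) fun C₂ k₂ =>
          close W' c a b C₂ k₂ (branch ok a b W C k next l) fun C₃ k₃ =>
            List.append (next W' C₃ k₃) (branch ok a b W C k next l)) (branch ok a b W C k next l))
        (fun _ _ => branch ok a b W C k next l) (get W c a))
      (fun _ _ => branch ok a b W C k next l) (get W b c)))) = _
  rw [ifb_eq, ifb_eq, ifb_eq, ifb_eq, force_eq, bit_eq]
  cases get W b c <;> cases get W c a <;> cases ok a b c <;> simp <;> split_ifs <;>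
    first | rfl | omega | tauto

/-- The branch of the true triangle on the directed edge `(a, b)` is explored. -/
theorem exists_subset_branch {ok : ℕ → ℕ → ℕ → Bool} (hT : SearchHyp T)
    (hok : ∀ {a b c}, T a b c → ok a b c = true) (h : Compatible T W C k)
    {a b c : ℕ} (ha : C.testBit a = false) (hab : get W a b = 0) (hc : T a b c)
    (next : ℕ → ℕ → ℕ → List ℕ) :
    ∃ W' C' k', Compatible T W' C' k' ∧ ∀ l : List ℕ, c ∈ l → ∀ L ∈ next W' C' k',
      L ∈ branch ok a b W C k next l := by
  obtain ⟨hbc, hca⟩ := h.get_rot_eq_zero hT hc hab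
  have notMem : ∀ {u v w}, T u v w → get W u v = 0 → C.testBit u = false := fun huv h₀ => by
    by_contra hu
    exact h.complete (by simpa using hu) huv h₀
  have hb := notMem (hT.rot hc) hbc
  have hcC := notMem (hT.rot (hT.rot hc)) hca
  have key : ∀ {x y : ℕ}, y < 10 → get (addTri W a b c) x y = _ := fun hy =>
    get_addTri (hT.lt hc) (hT.lt₂ hc) (hT.lt₃ hc) (hT.ne hc) (hT.ne (hT.rot (hT.rot hc))).symm
      (hT.ne (hT.rot hc)) hab hbc hca hy
  have nab := hT.ne hc
  have nbc := hT.ne (hT.rot hc)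
  have nca := hT.ne (hT.rot (hT.rot hc))
  have h₀ := h.addTri hT hc hab
  obtain ⟨C₁, k₁, h₁, hC₁, e₁⟩ := h₀.close hT (z := c) (by simp [key (hT.lt₂ hc)]) (hT.lt hc)
    (hT.lt₂ hc) ha
  obtain ⟨C₂, k₂, h₂, hC₂, e₂⟩ := h₁.close hT (x := b) (y := c) (z := a)
    (by simp [key (hT.lt₃ hc), nab]) (hT.lt₂ hc) (hT.lt₃ hc) (by
      by_contra hb'
      rcases hC₁ b (by simpa using hb') with h | h
      · simp [hb] at h
      · exact nab h.symm)
  obtain ⟨C₃, k₃, h₃, -, e₃⟩ := h₂.close hT (x := c) (y := a) (z := b)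
    (by simp [key (hT.lt hc), nca.symm, nbc]) (hT.lt₃ hc) (hT.lt hc) (by
      by_contra hc'
      rcases hC₂ c (by simpa using hc') with h | h
      · rcases hC₁ c h with h | h
        · simp [hcC] at h
        · exact nca h
      · exact nbc h.symm)
  refine ⟨_, C₃, k₃, h₃, fun l hl L hL => ?_⟩
  induction l with
  | nil => simp at hl
  | cons d l ih =>
    rw [branch_cons]
    by_cases hcd : c = d
    · subst hcd
      rw [if_neg (by simp [hcC, nca.symm, nbc, hbc, hca, hok hc]), e₁, e₂, e₃]
      exact List.mem_append_left _ hL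
    · have := ih ((List.mem_cons.1 hl).resolve_left hcd)
      split_ifs
      · exact this
      · exact mem_close this fun _ _ => mem_close this fun _ _ => mem_close this fun _ _ =>
          List.mem_append_right _ this

theorem pickSnd_eq {β : Type} (W a : ℕ) (fail : β) (cont : ℕ → β) (l : List ℕ) :
    pickSnd W a fail cont l = fail ∨
      ∃ b ∈ l, get W a b = 0 ∧ get W b a ≠ 0 ∧ pickSnd W a fail cont l = cont b := by
  induction l with
  | nil => exact Or.inl rfl
  | cons b l ih =>
    have e : pickSnd W a fail cont (b :: l) =
      Nat.rec (Nat.rec (pickSnd W a fail cont l) (fun _ _ => cont b) (get W b a))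
        (fun _ _ => pickSnd W a fail cont l) (get W a b) := rfl
    have ih' : pickSnd W a fail cont l = fail ∨
      ∃ b' ∈ b :: l, get W a b' = 0 ∧ get W b' a ≠ 0 ∧ pickSnd W a fail cont l = cont b' :=
      ih.imp_right fun ⟨b', hb', h⟩ => ⟨b', List.mem_cons_of_mem _ hb', h⟩
    rw [e]
    cases h₁ : get W a b with
    | zero =>
      cases h₂ : get W b a with
      | zero => exact ih'
      | succ => exact Or.inr ⟨b, List.mem_cons_self, h₁, by omega, rfl⟩
    | succ => exact ih'

theorem pick_eq {β : Type} (W C : ℕ) (fail : β) (cont : ℕ → ℕ → β) (l : List ℕ) :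
    pick W C fail cont l = fail ∨ ∃ a ∈ l, ∃ b ∈ order, C.testBit a = false ∧ get W a b = 0 ∧
      get W b a ≠ 0 ∧ pick W C fail cont l = cont a b := by
  induction l with
  | nil => exact Or.inl rfl
  | cons a l ih =>
    have e : pick W C fail cont (a :: l) = ifb (bit C a) (pick W C fail cont l)
      (pickSnd W a (pick W C fail cont l) (fun b => cont a b) order) := rfl
    rw [ifb_eq, bit_eq] at e
    have ih' : pick W C fail cont l = fail ∨ ∃ a' ∈ a :: l, ∃ b ∈ order, C.testBit a' = false ∧
        get W a' b = 0 ∧ get W b a' ≠ 0 ∧ pick W C fail cont l = cont a' b :=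
      ih.imp_right fun ⟨a', ha', h⟩ => ⟨a', List.mem_cons_of_mem a ha', h⟩
    split_ifs at e with hC
    · rw [e]; exact ih'
    · rcases pickSnd_eq W a (pick W C fail cont l) (fun b => cont a b) order with h | ⟨b, hb, h⟩
      · rw [e, h]; exact ih'
      · rw [e]
        exact Or.inr ⟨a, List.mem_cons_self, b, hb, by simpa using hC, h⟩

/-- Some leaf of the search is compatible with the surface `T`. -/
theorem exists_mem_search {ok : ℕ → ℕ → ℕ → Bool} (hT : SearchHyp T)
    (hok : ∀ {a b c}, T a b c → ok a b c = true) (n : ℕ) {W C k : ℕ} (h : Compatible T W C k) :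
    ∃ L ∈ search ok n W C k, ∀ {a b c}, a < 10 → b < 10 → get L a b = c + 1 → T a b c := by
  have hW : ∃ L ∈ [W], ∀ {a b c}, a < 10 → b < 10 → get L a b = c + 1 → T a b c :=
    ⟨W, List.mem_singleton_self W, h.sound⟩
  induction n generalizing W C k with
  | zero => exact hW
  | succ n ih =>
    have e : search ok (n + 1) W C k = pick W C [W] (fun a b => branch ok a b W C k (search ok n)
      [0, 1, 2, 3, 4, 5, 6, 7, 8, 9]) order := rfl
    rw [e]
    rcases pick_eq W C [W] (fun a b => branch ok a b W C k (search ok n)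
      [0, 1, 2, 3, 4, 5, 6, 7, 8, 9]) order with h' | ⟨a, ha, b, hb, hC, hab, hba, h'⟩
    · rw [h']; exact hW
    · rw [h']
      have lt : ∀ x ∈ order, x < 10 := by decide
      obtain ⟨c', hc'⟩ := Nat.exists_eq_succ_of_ne_zero hba
      obtain ⟨c, hc⟩ := hT.opp (h.sound (lt b hb) (lt a ha) hc')
      obtain ⟨W', C', k', hW', hsub⟩ :=
        exists_subset_branch hT hok h hC hab hc (search ok n)
      obtain ⟨L, hL, hLT⟩ := ih hW' ⟨W', List.mem_singleton_self W', hW'.sound⟩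
      refine ⟨L, hsub _ ?_ L hL, hLT⟩
      have := hT.lt₃ hc
      interval_cases c <;> simp

end Soundness

/-! ### Oriented triangles -/

theorem rotate_triple {α : Type*} [DecidableEq α] (a b c : α) :
    ({a, b, c} : Finset α) = {b, c, a} := by
  ext; simp; tauto

/-- `T a b c` is the relation that `(a, b, c)` is a positively oriented triangle of an oriented
triangulated surface. -/
structure IsOriented {n : ℕ} (T : Fin n → Fin n → Fin n → Prop) : Prop where
  rot : ∀ {a b c}, T a b c → T b c a
  ne : ∀ {a b c}, T a b c → a ≠ b
  unique : ∀ {a b c d}, T a b c → T a b d → c = d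
  opp : ∀ {a b c}, T a b c → ∃ d, T b a d
  simple : ∀ {a b c}, T a b c → ¬ T b a c
  link : ∀ {v y z} (C : Fin n → Prop), T v y z → C y → (∀ x y, C x → T v x y → C y) →
    ∀ {x y}, T v x y → C x

/-- The triangles underlying a set of oriented triangles. -/
def trianglesOf {n : ℕ} (T : Fin n → Fin n → Fin n → Prop) : Finset (Finset (Fin n)) :=
  Finset.univ.filter fun f => ∃ a b c, T a b c ∧ f = {a, b, c}

/-- The directed edges of a set of oriented triangles. -/
def arcsOf {n : ℕ} (T : Fin n → Fin n → Fin n → Prop) : Finset (Fin n × Fin n) :=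
  Finset.univ.filter fun p => ∃ c, T p.1 p.2 c

section Oriented

variable {n : ℕ} {T : Fin n → Fin n → Fin n → Prop}

theorem mem_trianglesOf {f : Finset (Fin n)} :
    f ∈ trianglesOf T ↔ ∃ a b c, T a b c ∧ f = {a, b, c} := by
  simp [trianglesOf]

theorem mem_arcsOf {p : Fin n × Fin n} : p ∈ arcsOf T ↔ ∃ c, T p.1 p.2 c := by
  simp [arcsOf]

theorem IsOriented.ne₂ (h : IsOriented T) {a b c : Fin n} (hT : T a b c) : b ≠ c :=
  h.ne (h.rot hT)

theorem IsOriented.ne₃ (h : IsOriented T) {a b c : Fin n} (hT : T a b c) : c ≠ a :=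
  h.ne (h.rot (h.rot hT))

theorem IsOriented.cases_of_eq (h : IsOriented T) {a b c x y z : Fin n} (habc : T a b c)
    (hxyz : T x y z) (e : ({x, y, z} : Finset (Fin n)) = {a, b, c}) :
    x = a ∧ y = b ∧ z = c ∨ x = b ∧ y = c ∧ z = a ∨ x = c ∧ y = a ∧ z = b := by
  have hx : x ∈ ({a, b, c} : Finset (Fin n)) := e ▸ by simp
  have hy : y ∈ ({a, b, c} : Finset (Fin n)) := e ▸ by simp
  have hz : z ∈ ({a, b, c} : Finset (Fin n)) := e ▸ by simp
  simp only [Finset.mem_insert, Finset.mem_singleton] at hx hy hz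
  have h₁ := h.ne hxyz
  have h₂ := h.ne₂ hxyz
  have h₃ := h.ne₃ hxyz
  have h₄ := h.simple habc
  have h₅ := h.simple (h.rot habc)
  have h₆ := h.simple (h.rot (h.rot habc))
  rcases hx with rfl | rfl | rfl <;> rcases hy with rfl | rfl | rfl <;>
    rcases hz with rfl | rfl | rfl <;> simp_all

theorem IsOriented.mem_trianglesOf_iff (h : IsOriented T) {a b c : Fin n} :
    {a, b, c} ∈ trianglesOf T ↔ T a b c ∨ T b a c := by
  rw [mem_trianglesOf]
  constructor
  · rintro ⟨x, y, z, hT, e⟩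
    have hx : x ∈ ({a, b, c} : Finset (Fin n)) := e ▸ by simp
    have hy : y ∈ ({a, b, c} : Finset (Fin n)) := e ▸ by simp
    have hz : z ∈ ({a, b, c} : Finset (Fin n)) := e ▸ by simp
    simp only [Finset.mem_insert, Finset.mem_singleton] at hx hy hz
    have h₁ := h.ne hT
    have h₂ := h.ne₂ hT
    have h₃ := h.ne₃ hT
    have h₅ := h.rot hT
    have h₆ := h.rot h₅
    clear e
    rcases hx with rfl | rfl | rfl <;> rcases hy with rfl | rfl | rfl <;>
      rcases hz with rfl | rfl | rfl <;> simp_all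
  · rintro (hT | hT)
    · exact ⟨a, b, c, hT, rfl⟩
    · exact ⟨b, a, c, hT, Finset.insert_comm _ _ _⟩

theorem IsOriented.card_of_mem (h : IsOriented T) {f : Finset (Fin n)} (hf : f ∈ trianglesOf T) :
    f.card = 3 := by
  obtain ⟨a, b, c, hT, rfl⟩ := mem_trianglesOf.1 hf
  exact Finset.card_eq_three.2 ⟨a, b, c, h.ne hT, (h.ne₃ hT).symm, h.ne₂ hT, rfl⟩

/-- Two vertices of a common triangle are joined by arcs in both directions. -/
theorem IsOriented.exists_of_mem (h : IsOriented T) {f : Finset (Fin n)}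
    (hf : f ∈ trianglesOf T) {u v : Fin n} (hu : u ∈ f) (hv : v ∈ f) (huv : u ≠ v) :
    ∃ c, T u v c := by
  obtain ⟨a, b, c, hT, rfl⟩ := mem_trianglesOf.1 hf
  simp only [Finset.mem_insert, Finset.mem_singleton] at hu hv
  have h₂ := h.rot hT
  have h₃ := h.rot h₂
  rcases hu with rfl | rfl | rfl <;> rcases hv with rfl | rfl | rfl <;>
    first
    | exact absurd rfl huv
    | exact ⟨_, hT⟩
    | exact ⟨_, h₂⟩
    | exact ⟨_, h₃⟩
    | exact h.opp hT
    | exact h.opp h₂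
    | exact h.opp h₃

theorem IsOriented.three_mul_card (h : IsOriented T) :
    3 * (trianglesOf T).card = (arcsOf T).card := by
  have hex : ∀ p : Fin n × Fin n, ∃ c, p ∈ arcsOf T → T p.1 p.2 c := fun p => by
    by_cases hp : p ∈ arcsOf T
    · exact (mem_arcsOf.1 hp).imp fun _ hc _ => hc
    · exact ⟨p.1, fun h => absurd h hp⟩
  choose t ht using hex
  rw [Finset.card_eq_sum_card_fiberwise (f := fun p => {p.1, p.2, t p}) (t := trianglesOf T)
    (fun p hp => mem_trianglesOf.2 ⟨_, _, _, ht p hp, rfl⟩), mul_comm]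
  refine (Finset.sum_const_nat fun f hf => ?_).symm
  obtain ⟨a, b, c, hT, rfl⟩ := mem_trianglesOf.1 hf
  refine Finset.card_eq_three.2 ⟨(a, b), (b, c), (c, a), ?_, ?_, ?_, ?_⟩
  · simpa using fun e => absurd e (h.ne hT)
  · simpa using fun e => absurd e.symm (h.ne₃ hT)
  · simpa using fun e => absurd e (h.ne₂ hT)
  · have hmem : ∀ {x y z}, T x y z → (x, y) ∈ arcsOf T ∧ t (x, y) = z := fun hxyz =>
      have hm := mem_arcsOf.2 ⟨_, hxyz⟩
      ⟨hm, h.unique (ht _ hm) hxyz⟩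
    ext ⟨x, y⟩
    simp only [Finset.mem_filter, Finset.mem_insert, Finset.mem_singleton, Prod.mk.injEq]
    constructor
    · rintro ⟨hp, e⟩
      rcases h.cases_of_eq hT (ht _ hp) e with h | h | h
      · exact Or.inl ⟨h.1, h.2.1⟩
      · exact Or.inr (Or.inl ⟨h.1, h.2.1⟩)
      · exact Or.inr (Or.inr ⟨h.1, h.2.1⟩)
    · rintro (⟨rfl, rfl⟩ | ⟨rfl, rfl⟩ | ⟨rfl, rfl⟩)
      · obtain ⟨h₁, h₂⟩ := hmem hT
        exact ⟨h₁, by rw [h₂]⟩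
      · obtain ⟨h₁, h₂⟩ := hmem (h.rot hT)
        refine ⟨h₁, by rw [h₂]; ext; simp; tauto⟩
      · obtain ⟨h₁, h₂⟩ := hmem (h.rot (h.rot hT))
        refine ⟨h₁, by rw [h₂]; ext; simp; tauto⟩

theorem IsOriented.two_mul_card (h : IsOriented T) {S : TriSurface n}
    (hS : S.faces = trianglesOf T) : 2 * S.edges.card = (arcsOf T).card := by
  have hmaps : ∀ p ∈ arcsOf T, ({p.1, p.2} : Finset (Fin n)) ∈ S.edges := fun p hp => by
    obtain ⟨c, hc⟩ := mem_arcsOf.1 hp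
    refine Finset.mem_filter.2 ⟨Finset.mem_univ _, Finset.card_pair (h.ne hc), {p.1, p.2, c}, ?_, ?_⟩
    · rw [hS]; exact mem_trianglesOf.2 ⟨_, _, _, hc, rfl⟩
    · intro x; simp; tauto
  rw [Finset.card_eq_sum_card_fiberwise
    (f := fun p : Fin n × Fin n => ({p.1, p.2} : Finset (Fin n))) (t := S.edges) hmaps, mul_comm]
  refine (Finset.sum_const_nat fun e he => ?_).symm
  obtain ⟨-, hcard, f, hf, hef⟩ := Finset.mem_filter.1 he
  obtain ⟨u, v, huv, rfl⟩ := Finset.card_eq_two.1 hcard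
  rw [hS] at hf
  have hu : u ∈ f := hef (by simp)
  have hv : v ∈ f := hef (by simp)
  refine Finset.card_eq_two.2 ⟨(u, v), (v, u), by simpa using fun e => absurd e huv, ?_⟩
  ext ⟨x, y⟩
  simp only [Finset.mem_filter, Finset.mem_insert, Finset.mem_singleton, Prod.mk.injEq]
  constructor
  · rintro ⟨hp, e⟩
    obtain ⟨c, hc⟩ := mem_arcsOf.1 hp
    have hne := h.ne hc
    have hx : x ∈ ({u, v} : Finset (Fin n)) := e ▸ by simp
    have hy : y ∈ ({u, v} : Finset (Fin n)) := e ▸ by simp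
    simp only [Finset.mem_insert, Finset.mem_singleton] at hx hy
    rcases hx with rfl | rfl <;> rcases hy with rfl | rfl <;> simp_all
  · rintro (⟨rfl, rfl⟩ | ⟨rfl, rfl⟩)
    · exact ⟨mem_arcsOf.2 (h.exists_of_mem hf hu hv huv), rfl⟩
    · exact ⟨mem_arcsOf.2 (h.exists_of_mem hf hv hu huv.symm), Finset.pair_comm _ _⟩

theorem IsOriented.eulerChar_eq (h : IsOriented T) {S : TriSurface n}
    (hS : S.faces = trianglesOf T) : 6 * S.eulerChar = 6 * n - (arcsOf T).card := by
  have h₂ := h.two_mul_card hS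
  have h₃ := h.three_mul_card
  rw [TriSurface.eulerChar, hS]
  omega

/-- The triangulated surface of a set of oriented triangles. -/
theorem IsOriented.exists_triSurface (h : IsOriented T) {v₀ : Fin n}
    (hv₀ : ∀ u, u ≠ v₀ → ∃ c, T v₀ u c) (hex : ∃ u, u ≠ v₀) :
    ∃ S : TriSurface n, S.faces = trianglesOf T ∧ S.Orientable := by
  have hface : ∀ u, u ≠ v₀ → ∃ f ∈ trianglesOf T, u ∈ f ∧ v₀ ∈ f := fun u hu => by
    obtain ⟨c, hc⟩ := hv₀ u hu
    exact ⟨_, mem_trianglesOf.2 ⟨_, _, _, hc, rfl⟩, by simp, by simp⟩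
  refine ⟨⟨trianglesOf T, fun f => h.card_of_mem, fun v => ?_, fun u v huv => ?_, fun u v => ?_,
    fun v a b => ?_⟩, rfl, ?_⟩
  · by_cases hv : v = v₀
    · obtain ⟨u, hu⟩ := hex
      obtain ⟨f, hf, -, h'⟩ := hface u hu
      exact ⟨f, hf, hv ▸ h'⟩
    · obtain ⟨f, hf, h', -⟩ := hface v hv
      exact ⟨f, hf, h'⟩
  · rintro ⟨f, hf, hu, hv⟩
    obtain ⟨c, hc⟩ := h.exists_of_mem hf hu hv huv
    obtain ⟨d, hd⟩ := h.opp hc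
    refine Finset.card_eq_two.2 ⟨{u, v, c}, {v, u, d}, fun e => ?_, ?_⟩
    · rcases h.cases_of_eq hd hc e with e | e | e
      · exact huv e.1
      · exact h.ne₂ hc e.2.2.symm
      · exact h.ne₃ hc e.2.2
    · ext g
      simp only [Finset.mem_filter, Finset.mem_insert, Finset.mem_singleton]
      constructor
      · rintro ⟨hg, hug, hvg⟩
        obtain ⟨x, y, z, hT, rfl⟩ := mem_trianglesOf.1 hg
        simp only [Finset.mem_insert, Finset.mem_singleton] at hug hvg
        have rotate : ∀ a b c : Fin n, ({a, b, c} : Finset (Fin n)) = {b, c, a} := fun a b c => by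
          ext; simp; tauto
        have main : ∀ {x y z}, T x y z → (u = x ∧ v = y ∨ u = y ∧ v = x) →
            ({x, y, z} : Finset (Fin n)) = {u, v, c} ∨ ({x, y, z} : Finset (Fin n)) = {v, u, d} := by
          rintro x y z hT (⟨rfl, rfl⟩ | ⟨rfl, rfl⟩)
          · rw [h.unique hT hc]; exact Or.inl rfl
          · rw [h.unique hT hd]; exact Or.inr rfl
        have h₂ := h.rot hT
        have h₃ := h.rot h₂
        have m₁ := main hT
        have m₂ := main h₂
        have m₃ := main h₃
        rw [← rotate x y z] at m₂
        rw [rotate z x y] at m₃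
        rcases hug with e | e | e <;> rcases hvg with e' | e' | e' <;>
          first
          | exact absurd (e.trans e'.symm) huv
          | exact m₁ (Or.inl ⟨e, e'⟩)
          | exact m₁ (Or.inr ⟨e, e'⟩)
          | exact m₂ (Or.inl ⟨e, e'⟩)
          | exact m₂ (Or.inr ⟨e, e'⟩)
          | exact m₃ (Or.inl ⟨e, e'⟩)
          | exact m₃ (Or.inr ⟨e, e'⟩)
      · rintro (rfl | rfl)
        · exact ⟨mem_trianglesOf.2 ⟨_, _, _, hc, rfl⟩, by simp, by simp⟩
        · exact ⟨mem_trianglesOf.2 ⟨_, _, _, hd, rfl⟩, by simp, by simp⟩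
  · have path : ∀ u, Relation.ReflTransGen
        (fun a b : Fin n => ∃ f ∈ trianglesOf T, a ∈ f ∧ b ∈ f) u v₀ := fun u => by
      by_cases hu : u = v₀
      · rw [hu]
      · exact .single (hface u hu)
    refine (path u).trans ?_
    have : Std.Symm (fun a b : Fin n => ∃ f ∈ trianglesOf T, a ∈ f ∧ b ∈ f) :=
      ⟨fun a b ⟨f, hf, ha, hb⟩ => ⟨f, hf, hb, ha⟩⟩
    exact Relation.ReflTransGen.stdSymm.symm _ _ (path v)
  · rintro ⟨f, hf, hvf, haf, hav⟩ ⟨g, hg, hvg, hbg, hbv⟩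
    obtain ⟨c, hc⟩ := h.exists_of_mem hf hvf haf hav.symm
    obtain ⟨d, hd⟩ := h.exists_of_mem hg hvg hbg hbv.symm
    refine h.link _ hc Relation.ReflTransGen.refl (fun x y hx hxy => hx.tail ?_) hd
    exact ⟨h.ne₂ hxy, (h.ne hxy).symm, h.ne₃ hxy, mem_trianglesOf.2 ⟨_, _, _, hxy, rfl⟩⟩
  · have hex : ∀ f : Finset (Fin n), ∃ w : Finset (Fin n × Fin n), f ∈ trianglesOf T →
        ∃ a b c, T a b c ∧ f = {a, b, c} ∧ w = {(a, b), (b, c), (c, a)} := fun f => by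
      by_cases hf : f ∈ trianglesOf T
      · obtain ⟨a, b, c, hT, e⟩ := mem_trianglesOf.1 hf
        exact ⟨_, fun _ => ⟨a, b, c, hT, e, rfl⟩⟩
      · exact ⟨∅, fun h => absurd h hf⟩
    choose ω hω using hex
    refine ⟨ω, fun f hf => ?_, fun f hf g hg hfg p hpf hpg => hfg ?_⟩
    · obtain ⟨a, b, c, hT, e, e'⟩ := hω f hf
      exact ⟨a, b, c, h.ne hT, (h.ne₃ hT).symm, h.ne₂ hT, e, e'⟩
    · have main : ∀ f ∈ trianglesOf T, p ∈ ω f → ∃ z, T p.1 p.2 z ∧ f = {p.1, p.2, z} := by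
        intro f hf hp
        obtain ⟨a, b, c, hT, rfl, e⟩ := hω f hf
        rw [e] at hp
        simp only [Finset.mem_insert, Finset.mem_singleton] at hp
        rcases hp with rfl | rfl | rfl
        · exact ⟨c, hT, rfl⟩
        · exact ⟨a, h.rot hT, by ext; simp; tauto⟩
        · exact ⟨b, h.rot (h.rot hT), by ext; simp; tauto⟩
      obtain ⟨z, hz, rfl⟩ := main f hf hpf
      obtain ⟨z', hz', rfl⟩ := main g hg hpg
      rw [h.unique hz hz']

end Oriented

/-! ### Orienting a triangulated surface -/

/-- A set of link vertices closed under taking successors is closed under taking predecessors. -/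
theorem mem_of_succ_mem {n : ℕ} {T : Fin n → Fin n → Fin n → Prop}
    (rot : ∀ {a b c}, T a b c → T b c a) (unique : ∀ {a b c d}, T a b c → T a b d → c = d)
    {v : Fin n} {C : Fin n → Prop} (hC : ∀ x y, C x → T v x y → C y)
    (hex : ∀ x, C x → ∃ y, T v x y) {x y : Fin n} (hy : C y) (hxy : T v x y) : C x := by
  choose f hf using fun x : {x // C x} => hex x.1 x.2
  let g : {x // C x} → {x // C x} := fun x => ⟨f x, hC _ _ x.2 (hf x)⟩
  have hg : Function.Injective g := fun a b hab => by
    have e : f a = f b := congrArg Subtype.val hab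
    have ha := hf a
    rw [e] at ha
    exact Subtype.ext (unique (rot (rot ha)) (rot (rot (hf b))) )
  obtain ⟨a, ha⟩ := (Finite.injective_iff_surjective.1 hg) ⟨y, hy⟩
  have e : f a = y := congrArg Subtype.val ha
  have := hf a
  rw [e] at this
  exact unique (rot (rot hxy)) (rot (rot this)) ▸ a.2

theorem TriSurface.link_of_succ {n : ℕ} (S : TriSurface n) {T : Fin n → Fin n → Fin n → Prop}
    (rot : ∀ {a b c}, T a b c → T b c a) (ne : ∀ {a b c}, T a b c → a ≠ b)
    (unique : ∀ {a b c d}, T a b c → T a b d → c = d) (opp : ∀ {a b c}, T a b c → ∃ d, T b a d)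
    (mem : ∀ {a b c}, T a b c → ({a, b, c} : Finset (Fin n)) ∈ S.faces)
    (of_mem : ∀ {a b c : Fin n}, a ≠ b → a ≠ c → b ≠ c → ({a, b, c} : Finset (Fin n)) ∈ S.faces →
      T a b c ∨ T b a c) {v y z : Fin n} (C : Fin n → Prop) (hyz : T v y z) (hy : C y)
    (hC : ∀ x y, C x → T v x y → C y) {x w : Fin n} (hx : T v x w) : C x := by
  have hpath := S.link_cycle v y x ⟨_, mem hyz, by simp, by simp, (ne hyz).symm⟩
    ⟨_, mem hx, by simp, by simp, (ne hx).symm⟩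
  have key : C x ∧ ∃ w, T v x w := by
    clear hx
    induction hpath with
    | refl => exact ⟨hy, z, hyz⟩
    | tail _ hpq ih =>
      obtain ⟨hne, hpv, hqv, hf⟩ := hpq
      rcases of_mem hpv.symm hqv.symm hne hf with h | h
      · exact ⟨hC _ _ ih.1 h, opp (rot (rot h))⟩
      · exact ⟨(mem_of_succ_mem (T := T) (v := v) (C := fun x => C x ∧ ∃ w, T v x w) rot unique
          (fun a b hab h => ⟨hC _ _ hab.1 h, opp (rot (rot h))⟩) (fun a ha => ha.2) ih
          (rot h)).1, _, rot h⟩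
  exact key.1

theorem TriSurface.Orientable.exists_isOriented {n : ℕ} {S : TriSurface n} (hS : S.Orientable) :
    ∃ T : Fin n → Fin n → Fin n → Prop, IsOriented T ∧ S.faces = trianglesOf T := by
  obtain ⟨ω, hω, hdisj⟩ := hS
  let T : Fin n → Fin n → Fin n → Prop := fun a b c =>
    ({a, b, c} : Finset (Fin n)) ∈ S.faces ∧ a ≠ b ∧ a ≠ c ∧ b ≠ c ∧
      ω {a, b, c} = {(a, b), (b, c), (c, a)}
  have rot : ∀ {a b c}, T a b c → T b c a := by
    rintro a b c ⟨h₁, h₂, h₃, h₄, h₅⟩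
    refine ⟨rotate_triple a b c ▸ h₁, h₄, h₂.symm, h₃.symm, ?_⟩
    rw [← rotate_triple a b c, h₅, Finset.insert_comm, Finset.pair_comm (a, b)]
  have mem : ∀ {a b c}, T a b c → (a, b) ∈ ω {a, b, c} := fun h => by
    rw [h.2.2.2.2]; simp
  have face_eq : ∀ {a b f g}, f ∈ S.faces → g ∈ S.faces → (a, b) ∈ ω f → (a, b) ∈ ω g → f = g :=
    fun hf hg haf hag => by
      by_contra hne
      exact hdisj _ hf _ hg hne _ haf hag
  have unique : ∀ {a b c d}, T a b c → T a b d → c = d := fun {a b c d} h h' => by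
    have e := face_eq h.1 h'.1 (mem h) (mem h')
    have hc : c ∈ ({a, b, d} : Finset (Fin n)) := e ▸ by simp
    simp only [Finset.mem_insert, Finset.mem_singleton] at hc
    rcases hc with rfl | rfl | rfl
    · exact absurd rfl h.2.2.1
    · exact absurd rfl h.2.2.2.1
    · rfl
  have simple : ∀ {a b c}, T a b c → ¬ T b a c := fun {a b c} h h' => by
    have hm := mem h'
    rw [Finset.insert_comm, h.2.2.2.2] at hm
    simp only [Finset.mem_insert, Finset.mem_singleton, Prod.mk.injEq] at hm
    rcases hm with hm | hm | hm
    · exact h.2.1 hm.2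
    · exact h.2.2.1 hm.2
    · exact h.2.2.2.1 hm.1
  have surj : ∀ f ∈ S.faces, ∃ a b c, T a b c ∧ f = {a, b, c} := fun f hf => by
    obtain ⟨a, b, c, hab, hac, hbc, rfl, e⟩ := hω f hf
    exact ⟨a, b, c, ⟨hf, hab, hac, hbc, e⟩, rfl⟩
  have swap : ∀ {f a b}, f ∈ S.faces → a ∈ f → b ∈ f → a ≠ b →
      ∃ c, f = {a, b, c} ∧ (T a b c ∨ T b a c) := fun {f a b} hf ha hb hab => by
    obtain ⟨x, y, z, hT, rfl⟩ := surj f hf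
    have h₂ := rot hT
    have h₃ := rot h₂
    simp only [Finset.mem_insert, Finset.mem_singleton] at ha hb
    rcases ha with rfl | rfl | rfl <;> rcases hb with rfl | rfl | rfl
    · exact absurd rfl hab
    · exact ⟨z, rfl, Or.inl hT⟩
    · exact ⟨y, by rw [Finset.pair_comm], Or.inr h₃⟩
    · exact ⟨z, Finset.insert_comm _ _ _, Or.inr hT⟩
    · exact absurd rfl hab
    · exact ⟨x, rotate_triple _ _ _, Or.inl h₂⟩
    · exact ⟨y, (rotate_triple _ _ _).symm, Or.inl h₃⟩
    · exact ⟨x, by rw [rotate_triple, Finset.insert_comm], Or.inr h₂⟩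
    · exact absurd rfl hab
  have opp : ∀ {a b c}, T a b c → ∃ d, T b a d := fun {a b c} h => by
    have h2 := S.edge_two a b h.2.1 ⟨_, h.1, by simp, by simp⟩
    obtain ⟨g, hg, hne⟩ := Finset.exists_mem_ne (h2 ▸ Nat.one_lt_two) ({a, b, c} : Finset (Fin n))
    obtain ⟨hg, hag, hbg⟩ := Finset.mem_filter.1 hg
    obtain ⟨d, rfl, hd | hd⟩ := swap hg hag hbg h.2.1
    · rw [unique h hd] at hne
      exact absurd rfl hne
    · exact ⟨d, hd⟩
  have of_mem : ∀ {a b c : Fin n}, a ≠ b → a ≠ c → b ≠ c → ({a, b, c} : Finset (Fin n)) ∈ S.faces →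
      T a b c ∨ T b a c := fun {a b c} hab hac hbc hf => by
    obtain ⟨r, hr, h⟩ := swap hf (a := a) (b := b) (by simp) (by simp) hab
    have : c ∈ ({a, b, r} : Finset (Fin n)) := hr ▸ by simp
    simp only [Finset.mem_insert, Finset.mem_singleton] at this
    rcases this with rfl | rfl | rfl
    · exact absurd rfl hac
    · exact absurd rfl hbc
    · exact h
  have link := @TriSurface.link_of_succ n S T rot (fun h => h.2.1) unique opp (fun h => h.1) of_mem
  refine ⟨T, ⟨rot, fun h => h.2.1, unique, opp, simple, link⟩, ?_⟩
  ext f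
  rw [mem_trianglesOf]
  exact ⟨surj f, fun ⟨a, b, c, h, e⟩ => e ▸ h.1⟩

/-! ### Transport along permutations -/

theorem IsOriented.transport {n : ℕ} {T : Fin n → Fin n → Fin n → Prop} (h : IsOriented T)
    (σ : Equiv.Perm (Fin n)) : IsOriented fun a b c => T (σ a) (σ b) (σ c) where
  rot := h.rot
  ne hT e := h.ne hT (congrArg σ e)
  unique h₁ h₂ := σ.injective (h.unique h₁ h₂)
  opp hT := by
    obtain ⟨d, hd⟩ := h.opp hT
    exact ⟨σ.symm d, by simpa using hd⟩
  simple := h.simple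
  link {v y z} C hT hy hC {x w} hx := by
    have := h.link (fun i => C (σ.symm i)) hT (by simpa using hy)
      (fun a b ha hab => hC _ _ ha (by simpa using hab)) hx
    simpa using this

theorem IsOriented.reverse {n : ℕ} {T : Fin n → Fin n → Fin n → Prop} (h : IsOriented T) :
    IsOriented fun a b c => T b a c where
  rot hT := h.rot (h.rot hT)
  ne hT := (h.ne hT).symm
  unique := h.unique
  opp := h.opp
  simple := h.simple
  link {v y z} C hT hy hC {x w} hx := by
    obtain ⟨z', hz'⟩ := h.opp hT
    obtain ⟨w', hw'⟩ := h.opp hx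
    have hN : ∀ a, (∃ b, T v a b) ↔ ∃ b, T a v b := fun a =>
      ⟨fun ⟨_, hb⟩ => h.opp hb, fun ⟨_, hb⟩ => h.opp hb⟩
    refine (h.link (fun x => C x ∧ ∃ w, T x v w) hz' ⟨hy, _, hT⟩ (fun a b ha hab => ?_) hw').1
    refine mem_of_succ_mem (T := fun a b c => T b a c) (v := v) (C := fun x => C x ∧ ∃ w, T x v w)
      (fun hT => h.rot (h.rot hT)) h.unique (fun p q hp hpq => ⟨hC _ _ hp.1 hpq, ?_⟩)
      (fun p hp => hp.2) ha (h.rot (h.rot hab))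
    exact (hN q).1 ⟨_, h.rot (h.rot (h.rot (h.rot (hpq))))⟩

theorem card_arcsOf_transport {n : ℕ} (T : Fin n → Fin n → Fin n → Prop) (σ : Equiv.Perm (Fin n)) :
    (arcsOf fun a b c => T (σ a) (σ b) (σ c)).card = (arcsOf T).card :=
  Finset.card_equiv (σ.prodCongr σ) fun p => by
    rw [mem_arcsOf, mem_arcsOf]
    exact σ.exists_congr_left.trans (by simp)

theorem card_arcsOf_reverse {n : ℕ} (T : Fin n → Fin n → Fin n → Prop) :
    (arcsOf fun a b c => T b a c).card = (arcsOf T).card :=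
  Finset.card_equiv (Equiv.prodComm _ _) fun p => by
    rw [mem_arcsOf, mem_arcsOf]
    rfl

/-! ### Ten vertices and 84 directed edges -/

section Ten

variable {T : Fin 10 → Fin 10 → Fin 10 → Prop}

/-- The ordered pairs of distinct vertices which do not span an edge. -/
def nonArcs (T : Fin 10 → Fin 10 → Fin 10 → Prop) : Finset (Fin 10 × Fin 10) :=
  Finset.univ.offDiag \ arcsOf T

theorem mem_nonArcs {p : Fin 10 × Fin 10} :
    p ∈ nonArcs T ↔ p.1 ≠ p.2 ∧ ∀ c, ¬ T p.1 p.2 c := by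
  simp [nonArcs, mem_arcsOf]

theorem IsOriented.card_nonArcs (h : IsOriented T) (hc : (arcsOf T).card = 84) :
    (nonArcs T).card = 6 := by
  rw [nonArcs, Finset.card_sdiff_of_subset, hc, Finset.offDiag_card]
  · simp
  · intro p hp
    obtain ⟨c, hc⟩ := mem_arcsOf.1 hp
    simpa using h.ne hc

theorem IsOriented.exists_full (h : IsOriented T) (hc : (arcsOf T).card = 84) :
    ∃ v, ∀ u, u ≠ v → ∃ c, T v u c := by
  have hcard : ((nonArcs T).image Prod.fst).card < (Finset.univ : Finset (Fin 10)).card :=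
    Finset.card_image_le.trans_lt (by rw [h.card_nonArcs hc]; simp)
  obtain ⟨v, -, hv⟩ := Finset.exists_mem_notMem_of_card_lt_card hcard
  refine ⟨v, fun u hu => ?_⟩
  by_contra hne
  refine hv (Finset.mem_image.2 ⟨(v, u), mem_nonArcs.2 ⟨hu.symm, ?_⟩, rfl⟩)
  simpa using hne

/-- The relation between natural numbers corresponding to `T`. -/
def natRel (T : Fin 10 → Fin 10 → Fin 10 → Prop) (a b c : ℕ) : Prop :=
  ∃ a' b' c' : Fin 10, (a' : ℕ) = a ∧ (b' : ℕ) = b ∧ (c' : ℕ) = c ∧ T a' b' c'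

theorem natRel_iff {a b c : Fin 10} : natRel T a b c ↔ T a b c := by
  constructor
  · rintro ⟨a', b', c', ha, hb, hc, hT⟩
    rwa [Fin.ext ha, Fin.ext hb, Fin.ext hc] at hT
  · exact fun hT => ⟨a, b, c, rfl, rfl, rfl, hT⟩

theorem IsOriented.searchHyp (h : IsOriented T) (hc : (arcsOf T).card = 84) :
    SearchHyp (natRel T) where
  lt := by
    rintro a b c ⟨a', -, -, rfl, -⟩
    exact a'.2
  rot := by
    rintro _ _ _ ⟨a, b, c, rfl, rfl, rfl, hT⟩
    exact natRel_iff.2 (h.rot hT)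
  ne := by
    rintro _ _ _ ⟨a, b, c, rfl, rfl, rfl, hT⟩ e
    exact h.ne hT (Fin.ext e)
  unique := by
    rintro _ _ _ d ⟨a, b, c, rfl, rfl, rfl, hT⟩ ⟨a', b', d, ha, hb, rfl, hT'⟩
    rw [Fin.ext ha, Fin.ext hb] at hT'
    rw [h.unique hT hT']
  opp := by
    rintro _ _ _ ⟨a, b, c, rfl, rfl, rfl, hT⟩
    obtain ⟨d, hd⟩ := h.opp hT
    exact ⟨d, natRel_iff.2 hd⟩
  link := by
    rintro _ _ _ C ⟨v, y, z, rfl, rfl, rfl, hT⟩ hy hC _ _ ⟨v', x, w, hv, rfl, rfl, hx⟩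
    rw [Fin.ext hv] at hx
    exact h.link (fun i => C i) hT hy (fun a b ha hab => hC _ _ ha (natRel_iff.2 hab)) hx
  card_le := by
    intro U hU
    have h₁ := h.card_nonArcs hc
    let f : Fin 10 × Fin 10 → Sym2 ℕ := fun p => s((p.1 : ℕ), (p.2 : ℕ))
    have h₂ := Finset.card_eq_sum_card_fiberwise (f := f) (s := (nonArcs T).filter (f · ∈ U))
      (t := U) fun p hp => (Finset.mem_filter.1 hp).2
    have h₃ : ∑ _e ∈ U, 2 ≤ ∑ e ∈ U, (((nonArcs T).filter (f · ∈ U)).filter (f · = e)).card := by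
      refine Finset.sum_le_sum fun e he => ?_
      obtain ⟨x, hx, w, hw, hxw, rfl, hne⟩ := hU e he
      have hxw' : (⟨x, hx⟩ : Fin 10) ≠ ⟨w, hw⟩ := fun e => hxw (congrArg Fin.val e)
      have hmem : ((⟨x, hx⟩, ⟨w, hw⟩) : Fin 10 × Fin 10) ∈ nonArcs T :=
        mem_nonArcs.2 ⟨hxw', fun c hc => hne c (natRel_iff.2 hc)⟩
      have hmem' : ((⟨w, hw⟩, ⟨x, hx⟩) : Fin 10 × Fin 10) ∈ nonArcs T :=
        mem_nonArcs.2 ⟨hxw'.symm, fun c hc => by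
          obtain ⟨d, hd⟩ := h.opp hc
          exact hne d (natRel_iff.2 hd)⟩
      rw [← Finset.card_pair (a := ((⟨x, hx⟩, ⟨w, hw⟩) : Fin 10 × Fin 10)) (b := (⟨w, hw⟩, ⟨x, hx⟩))
        (by simpa using fun e => absurd e hxw)]
      refine Finset.card_le_card fun p hp => ?_
      simp only [Finset.mem_insert, Finset.mem_singleton] at hp
      rcases hp with rfl | rfl
      · exact Finset.mem_filter.2 ⟨Finset.mem_filter.2 ⟨hmem, he⟩, rfl⟩
      · have e : f (⟨w, hw⟩, ⟨x, hx⟩) = s(x, w) := Sym2.eq_swap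
        exact Finset.mem_filter.2 ⟨Finset.mem_filter.2 ⟨hmem', by rw [e]; exact he⟩, e⟩
    have h₄ : ((nonArcs T).filter (f · ∈ U)).card ≤ (nonArcs T).card :=
      Finset.card_filter_le _ _
    rw [Finset.sum_const, smul_eq_mul] at h₃
    omega

/-! ### Normal form -/

/-- The cyclic permutation of the vertices other than `0`. -/
def rim : Equiv.Perm (Fin 10) where
  toFun := ![0, 2, 3, 4, 5, 6, 7, 8, 9, 1]
  invFun := ![0, 9, 1, 2, 3, 4, 5, 6, 7, 8]
  left_inv := by decide
  right_inv := by decide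

/-- The reflection of the vertices other than `0`. -/
def rimFlip : Equiv.Perm (Fin 10) where
  toFun := ![0, 9, 8, 7, 6, 5, 4, 3, 2, 1]
  invFun := ![0, 9, 8, 7, 6, 5, 4, 3, 2, 1]
  left_inv := by decide
  right_inv := by decide

theorem isCycle_rim : rim.IsCycle := by
  have h : ∀ y : Fin 10, rim y ≠ y → (rim ^ (y.val - 1)) 1 = y := by decide
  exact ⟨1, by decide, fun y hy => ⟨(y.val - 1 : ℕ), by rw [zpow_natCast]; exact h y hy⟩⟩

theorem IsOriented.exists_wheel (h : IsOriented T) (hc : (arcsOf T).card = 84) :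
    ∃ σ : Equiv.Perm (Fin 10), ∀ i, i ≠ 0 → T (σ 0) (σ i) (σ (rim i)) := by
  obtain ⟨v, hv⟩ := h.exists_full hc
  have hex : ∀ u, ∃ c, (u = v → c = v) ∧ (u ≠ v → T v u c) := fun u => by
    by_cases hu : u = v
    · exact ⟨v, fun _ => rfl, fun h => absurd hu h⟩
    · obtain ⟨c, hc⟩ := hv u hu
      exact ⟨c, fun h => absurd h hu, fun _ => hc⟩
  choose f hf hf' using hex
  have hne : ∀ u, u ≠ v → f u ≠ v := fun u hu => h.ne₃ (hf' u hu)
  have hinj : Function.Injective f := fun a b hab => by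
    by_cases ha : a = v <;> by_cases hb : b = v
    · rw [ha, hb]
    · exact absurd (hab ▸ hf a ha) (hne b hb)
    · exact absurd (hab ▸ hf b hb) (hne a ha)
    · have h₁ := hf' a ha
      rw [hab] at h₁
      exact h.unique (h.rot (h.rot h₁)) (h.rot (h.rot (hf' b hb)))
  let τ : Equiv.Perm (Fin 10) := Equiv.ofBijective f (Finite.injective_iff_bijective.1 hinj)
  have hτ : ∀ u, τ u = f u := fun _ => rfl
  have hfix : ∀ u, τ u = u ↔ u = v := fun u => by
    constructor
    · intro e
      by_contra hu
      exact h.ne₂ (hf' u hu) e.symm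
    · rintro rfl
      exact hf u rfl
  obtain ⟨u, hu⟩ := exists_ne v
  have hcyc : τ.IsCycle := by
    refine ⟨u, fun e => hu ((hfix u).1 e), fun y hy => ?_⟩
    refine h.link (fun y => τ.SameCycle u y) (hf' u hu) (Equiv.Perm.SameCycle.refl _ _)
      (fun a b ha hab => ?_) (hf' y fun e => hy ((hfix y).2 e))
    have : b = τ a := h.unique hab (hf' a (h.ne hab).symm)
    rw [this]
    exact Equiv.Perm.sameCycle_apply_right.2 ha
  have hsupp : τ.support = {v}ᶜ := by
    ext y
    simp [hfix]
  have hrim : rim.support = {0}ᶜ := by decide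
  obtain ⟨σ, hσ⟩ := isConj_iff.1 (isCycle_rim.isConj hcyc (by
    rw [hsupp, hrim, Finset.card_compl, Finset.card_compl]; rfl))
  have hσ' : ∀ i, σ (rim i) = τ (σ i) := fun i => by rw [← hσ]; simp
  have h0 : σ 0 = v := (hfix _).1 (by rw [← hσ']; rfl)
  refine ⟨σ, fun i hi => ?_⟩
  rw [hσ', h0]
  exact hf' _ fun e => hi (σ.injective (e.trans h0.symm))

end Ten

/-! ### Normal form at the edge `12` -/

/-- Whether `y` precedes `x` on the rim and `z` is two steps away from `x` or from `y`. -/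
def distTwo (x y z : ℕ) : Bool :=
  ifb (Nat.beq y 0) false (ifb (Nat.beq x (Nat.succ (Nat.mod y 9)))
    (ifb (Nat.beq z (Nat.succ (Nat.mod (Nat.add y 2) 9))) true
      (Nat.beq z (Nat.succ (Nat.mod (Nat.add y 6) 9)))) false)

/-- The triangles that do not join an edge of the rim to a vertex at distance two. -/
def avoidsDistTwo (a b c : ℕ) : Bool :=
  ifb (distTwo a b c) false (ifb (distTwo b c a) false (ifb (distTwo c a b) false true))

set_option maxRecDepth 100000 in
theorem search_avoidsDistTwo : search avoidsDistTwo 18 wheel 1 0 = [] := by decide +kernel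

theorem distTwo_fin : ∀ x y z : Fin 10, distTwo x y z = true →
    y ≠ 0 ∧ x = rim y ∧ (z = (rim ^ 3) y ∨ (rim ^ 2) z = y) := by decide +kernel

theorem get_wheel_rot : ∀ a b c : Fin 10, get wheel a b = c + 1 → get wheel b c = a + 1 := by
  decide +kernel

theorem get_wheel_cases : ∀ a b c : Fin 10, get wheel a b = c + 1 →
    (b ≠ 0 ∧ a = 0 ∧ c = rim b) ∨ (c ≠ 0 ∧ b = 0 ∧ a = rim c) ∨ (a ≠ 0 ∧ c = 0 ∧ b = rim a) := by
  decide +kernel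

theorem get_wheel_zero : ∀ y : Fin 10, y ≠ 0 → get wheel 0 y ≠ 0 := by decide +kernel

section Ten

variable {T : Fin 10 → Fin 10 → Fin 10 → Prop}

theorem IsOriented.compatible_wheel (h : IsOriented T) (hw : ∀ i, i ≠ 0 → T 0 i (rim i)) :
    Compatible (natRel T) wheel 1 0 where
  sound {a b c} ha hb hab := by
    have hc : c < 10 := by have := get_le wheel a b; omega
    refine ⟨⟨a, ha⟩, ⟨b, hb⟩, ⟨c, hc⟩, rfl, rfl, rfl, ?_⟩
    rcases get_wheel_cases ⟨a, ha⟩ ⟨b, hb⟩ ⟨c, hc⟩ hab with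
      ⟨h₀, h₁, h₂⟩ | ⟨h₀, h₁, h₂⟩ | ⟨h₀, h₁, h₂⟩
    · rw [h₁, h₂]; exact hw _ h₀
    · rw [h₁, h₂]; exact h.rot (h.rot (hw _ h₀))
    · rw [h₁, h₂]; exact h.rot (hw _ h₀)
  rot {a b c} ha hb hab := by
    have hc : c < 10 := by have := get_le wheel a b; omega
    exact get_wheel_rot ⟨a, ha⟩ ⟨b, hb⟩ ⟨c, hc⟩ hab
  complete := by
    rintro _ _ _ hx ⟨x, y, z, rfl, rfl, rfl, hT⟩
    obtain rfl : x = 0 := by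
      revert hx; clear hT; revert x; decide
    exact get_wheel_zero y (h.ne hT).symm
  missing := ⟨∅, rfl, by simp⟩

theorem IsOriented.exists_distTwo (h : IsOriented T) (hc : (arcsOf T).card = 84)
    (hw : ∀ i, i ≠ 0 → T 0 i (rim i)) : ∃ i, i ≠ 0 ∧ ∃ z, T (rim i) i z ∧
      (z = (rim ^ 3) i ∨ (rim ^ 2) z = i) := by
  by_contra! hne
  have key : ∀ {a b c}, T a b c → distTwo a b c = false := fun {a b c} hT => by
    by_contra hd
    obtain ⟨hb, rfl, hz⟩ := distTwo_fin a b c (by simpa using hd)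
    have := hne b hb c hT
    tauto
  obtain ⟨L, hL, -⟩ := exists_mem_search (ok := avoidsDistTwo) (h.searchHyp hc) (by
    rintro _ _ _ ⟨a, b, c, rfl, rfl, rfl, hT⟩
    rw [avoidsDistTwo, key hT, key (h.rot hT), key (h.rot (h.rot hT))]) 18
    (h.compatible_wheel hw)
  rw [search_avoidsDistTwo] at hL
  exact absurd hL (by simp)

theorem exists_rim_pow : ∀ i : Fin 10, i ≠ 0 → ∃ m : Fin 10, (rim ^ (m : ℕ)) 1 = i := by decide

theorem rim_pow_zero : ∀ m : ℕ, (rim ^ m) 0 = 0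
  | 0 => rfl
  | m + 1 => by rw [pow_succ, Equiv.Perm.mul_apply]; exact rim_pow_zero m

theorem IsOriented.exists_transport_dist (h : IsOriented T) (hc : (arcsOf T).card = 84)
    (hw : ∀ i, i ≠ 0 → T 0 i (rim i)) {i : Fin 10} (hi : i ≠ 0) (hT : T (rim i) i ((rim ^ 3) i)) :
    ∃ T', IsOriented T' ∧ (arcsOf T').card = 84 ∧ (∀ i, i ≠ 0 → T' 0 i (rim i)) ∧ T' 2 1 4 ∧
      ∃ σ : Equiv.Perm (Fin 10), ∀ a b c, T' a b c → T (σ a) (σ b) (σ c) := by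
  obtain ⟨m, rfl⟩ := exists_rim_pow i hi
  refine ⟨_, h.transport (rim ^ (m : ℕ)), (card_arcsOf_transport T _).trans hc, fun j hj => ?_, ?_,
    _, fun _ _ _ => id⟩
  · have e : (rim ^ (m : ℕ)) (rim j) = rim ((rim ^ (m : ℕ)) j) := by
      rw [← Equiv.Perm.mul_apply, ← Equiv.Perm.mul_apply, pow_mul_comm']
    rw [rim_pow_zero, e]
    refine hw _ fun e => hj ((rim ^ (m : ℕ)).injective ?_)
    rw [e, rim_pow_zero]
  · rw [← Equiv.Perm.mul_apply, ← Equiv.Perm.mul_apply, ← pow_succ', ← pow_add, add_comm 3,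
      pow_succ, pow_add, Equiv.Perm.mul_apply, Equiv.Perm.mul_apply] at hT
    exact hT

theorem IsOriented.exists_normalForm (h : IsOriented T) (hc : (arcsOf T).card = 84) :
    ∃ T', IsOriented T' ∧ (arcsOf T').card = 84 ∧ (∀ i, i ≠ 0 → T' 0 i (rim i)) ∧ T' 2 1 4 ∧
      ∃ σ : Equiv.Perm (Fin 10), ∀ a b c, T' a b c →
        T (σ a) (σ b) (σ c) ∨ T (σ b) (σ a) (σ c) := by
  obtain ⟨τ, hτ⟩ := h.exists_wheel hc
  have h₁ := h.transport τ
  have hc₁ := (card_arcsOf_transport T τ).trans hc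
  obtain ⟨i, hi, z, hz, rfl | hzi⟩ := h₁.exists_distTwo hc₁ hτ
  · obtain ⟨T', hT', hc', hw', h', σ, hσ⟩ := h₁.exists_transport_dist hc₁ hτ hi hz
    exact ⟨T', hT', hc', hw', h', σ.trans τ, fun a b c hT => Or.inl (hσ a b c hT)⟩
  · have hflip : ∀ i : Fin 10, i ≠ 0 → rimFlip i ≠ 0 ∧ rimFlip (rimFlip i) = i ∧
        rimFlip i = rim (rimFlip (rim i)) ∧ rimFlip (rim i) ≠ 0 := by decide
    have hflip' : ∀ z i : Fin 10, i ≠ 0 → (rim ^ 2) z = i →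
        rimFlip ((rim ^ 3) (rimFlip (rim i))) = z := by decide
    obtain ⟨e₁, e₂, e₃, e₄⟩ := hflip i hi
    have e₅ : rimFlip (rimFlip (rim i)) = rim i :=
      (hflip (rim i) fun e => hi (rim.injective e)).2.1
    obtain ⟨T', hT', hc', hw', h', σ, hσ⟩ :=
      ((h₁.transport rimFlip).reverse).exists_transport_dist
        ((card_arcsOf_reverse _).trans ((card_arcsOf_transport _ rimFlip).trans hc₁))
        (fun j hj => h₁.rot (h₁.rot (by
          have := hτ _ (hflip j hj).2.2.2
          rw [← (hflip j hj).2.2.1] at this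
          exact this))) e₄ (by
            rw [← e₃, e₂, e₅, hflip' z i hi hzi]
            exact hz)
    exact ⟨T', hT', hc', hw', h', (σ.trans rimFlip).trans τ,
      fun a b c hT => Or.inr (hσ a b c hT)⟩

end Ten

/-! ### Tables of closed surfaces -/

/-- The oriented triangles of a table. -/
def tableRel (W : ℕ) (a b c : Fin 10) : Prop := get W a b = c + 1

/-- Whether following the link of `x` from `z` leads to `y`. -/
def reach (W x y n : ℕ) : ℕ → Bool :=
  Nat.rec (fun _ => false) (fun _ ih z =>
    ifb (Nat.beq z y) true (Nat.rec false (fun w _ => ih w) (get W x z))) n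

/-- A table describes an oriented surface with ten vertices and `84` directed edges, in which
vertex `0` is adjacent to all others. -/
def IsSurfaceTable (W : ℕ) : Prop :=
  (∀ a b : Fin 10, get W a b = 0 ∨ (a ≠ b ∧ get W b a ≠ 0 ∧ get W b a ≠ get W a b ∧
    get W b (get W a b - 1) = a + 1 ∧ ∀ x : Fin 10, get W a x = 0 ∨ reach W a x 10 b = true)) ∧
  (∀ u : Fin 10, u ≠ 0 → get W 0 u ≠ 0) ∧
  (Finset.univ.filter fun p : Fin 10 × Fin 10 => get W p.1 p.2 ≠ 0).card = 84

instance (W : ℕ) : Decidable (IsSurfaceTable W) := inferInstanceAs (Decidable (_ ∧ _))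

theorem of_reach {W v y : ℕ} (C : ℕ → Prop) (hC : ∀ x y, C x → get W v x = y + 1 → C y) (n : ℕ)
    {z : ℕ} (hz : C z) (h : reach W v y n z = true) : C y := by
  induction n generalizing z with
  | zero => exact absurd h (by simp [reach])
  | succ n ih =>
    have e : reach W v y (n + 1) z = ifb (Nat.beq z y) true
      (Nat.rec false (fun w _ => reach W v y n w) (get W v z)) := rfl
    rw [e, ifb_eq] at h
    by_cases hzy : z = y
    · exact hzy ▸ hz
    · rw [if_neg (by simpa using hzy)] at h
      cases hg : get W v z with
      | zero => rw [hg] at h; exact absurd h (by simp)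
      | succ w => rw [hg] at h; exact ih (hC z w hz hg) h

theorem exists_tableRel_iff {W : ℕ} {a b : Fin 10} : (∃ c, tableRel W a b c) ↔ get W a b ≠ 0 := by
  constructor
  · rintro ⟨c, hc⟩
    rw [hc]
    exact Nat.succ_ne_zero _
  · intro h
    have := get_le W a b
    exact ⟨⟨get W a b - 1, by omega⟩, by rw [tableRel]; dsimp only; omega⟩

theorem IsSurfaceTable.isOriented {W : ℕ} (h : IsSurfaceTable W) : IsOriented (tableRel W) := by
  have key : ∀ {a b c : Fin 10}, tableRel W a b c → a ≠ b ∧ get W b a ≠ 0 ∧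
      get W b a ≠ get W a b ∧ get W b (get W a b - 1) = a + 1 ∧
        ∀ x : Fin 10, get W a x = 0 ∨ reach W a x 10 b = true := fun {a b c} hT =>
    (h.1 a b).resolve_left (by rw [hT]; exact Nat.succ_ne_zero _)
  refine ⟨fun {a b c} hT => ?_, fun hT => (key hT).1, fun {a b c d} h₁ h₂ => ?_, fun hT => ?_,
    fun h₁ h₂ => (key h₁).2.2.1 (h₂.trans h₁.symm), fun {v y z} C hT hy hC {x w} hx => ?_⟩
  · have := (key hT).2.2.2.1
    rwa [hT, Nat.add_sub_cancel] at this
  · exact Fin.ext (Nat.succ_injective (h₁.symm.trans h₂))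
  · exact exists_tableRel_iff.2 (key hT).2.1
  · have hr := ((key hT).2.2.2.2 x).resolve_left (by rw [hx]; exact Nat.succ_ne_zero _)
    obtain ⟨x', hx', hC'⟩ := of_reach (fun u => ∃ u' : Fin 10, (u' : ℕ) = u ∧ C u')
      (fun p q ⟨p', hp, hp'⟩ hpq => by
        subst hp
        have hq : q < 10 := by have := get_le W v p'; omega
        exact ⟨⟨q, hq⟩, rfl, hC p' _ hp' hpq⟩) 10 ⟨y, rfl, hy⟩ hr
    rwa [Fin.ext hx'] at hC'

theorem IsSurfaceTable.card_arcsOf {W : ℕ} (h : IsSurfaceTable W) :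
    (arcsOf (tableRel W)).card = 84 := by
  rw [← h.2.2]
  congr 1
  ext p
  rw [mem_arcsOf, exists_tableRel_iff]
  simp

theorem IsSurfaceTable.exists_triSurface {W : ℕ} (h : IsSurfaceTable W) :
    ∃ S : {S : TriSurface 10 // S.Orientable ∧ S.eulerChar = -4},
      S.1.faces = trianglesOf (tableRel W) := by
  obtain ⟨S, hS, hO⟩ := h.isOriented.exists_triSurface (v₀ := 0)
    (fun u hu => exists_tableRel_iff.2 (h.2.1 u hu)) ⟨1, by decide⟩
  have := h.isOriented.eulerChar_eq hS
  rw [h.card_arcsOf] at this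
  exact ⟨⟨S, hO, by push_cast at this; omega⟩, hS⟩

/-- One table for each isomorphism class of orientable surfaces of genus three with ten vertices. -/
def tables : List ℕ :=
  [5306037353057002716326828201454552693670835390819668405260380644018917984149177970824632139795927615823,
   5304092653955500951736712173392226295600207308755492424006922179002662327779206641712722738925126321054,
   5304092653954049398603976055994509037110210092533014798077777058125223269041620362669804634573511323472,
   5304092653955500951736717261147456206355500665639494226005287834805821369721062890400140191915385676982,
   5304092653956226742949149398010011252537813540206777774145228641957972339536370330000126538400819501609,
   7600676218332176431662562613528967775336792983501754134687430882120912420572749267971020361900599053609,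
   5304092653956226742949148094580043872471351520186392646300709435908167331284382562655384175943923913156,
   7600676218332176431662561310099000395270330963481369006842911676071107412320761500626277999443703465156,
   5304075296311419805004901248398086327267763324483910737743806377449677899802765255675428185638445840778,
   5304075296311353834637270351800464498748386783935282954853436723369760214680760070963548323590805584649,
   7167698767233064694424548096860206640794023886401806256769397401835463990964374637518731731218470442281,
   6457504298505244188135207922863387062603137234917222604128914003151903353523744765168351722147774702327,
   6109247583408308188673078878507758199949749468188792067348686789715146194417475828029780071848443531159,
   8239249829950942153592482131455996696189388317406420176912129732197147134515124001237405579656508289780,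
   3474870749422536712314082429695260082636010316234037425661164053560082828258461017204899457653458183968,
   7073498185641860134689878037929133049790324683720540342978097039125245392446869968508111222865706724705,
   6338601859628254303346253533461283647900587303245655277244207783192919959408577055266307927683524706740,
   5132039820715419222542332237184060656196254540921885990237551774966622827272348148415433499964254900256,
   4924971474767906841396623654214539814920104877375773451088841653060908992436871881116719448572133230389,
   5716217787671647621045478507801589298042454211272096150124747503515623663944414452052464673505231595709]

theorem isSurfaceTable_of_mem : ∀ W ∈ tables, IsSurfaceTable W := by decide +kernel

/-! ### An invariant distinguishing the surfaces -/

/-- The number of ordered pairs completing both `x` and `y` to a triangle. -/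
def TriSurface.common {n : ℕ} (S : TriSurface n) (x y : Fin n) : ℕ :=
  (Finset.univ.filter fun p : Fin n × Fin n =>
    ({x, p.1, p.2} : Finset (Fin n)) ∈ S.faces ∧ ({y, p.1, p.2} : Finset (Fin n)) ∈ S.faces).card

/-- An isomorphism invariant. -/
def TriSurface.commonSum {n : ℕ} (S : TriSurface n) : ℕ := ∑ x, (∑ y, S.common x y ^ 2) ^ 3

theorem TriSurface.Iso.commonSum_eq {n : ℕ} {S S' : TriSurface n} (h : S.Iso S') :
    S.commonSum = S'.commonSum := by
  obtain ⟨σ, hσ⟩ := h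
  have hc : ∀ x y, S.common x y = S'.common (σ x) (σ y) := fun x y =>
    Finset.card_equiv (σ.prodCongr σ) fun p => by
      simp [hσ, Finset.image_insert]
  rw [commonSum, commonSum, ← Equiv.sum_comp σ fun x => (∑ y, S'.common x y ^ 2) ^ 3]
  refine Finset.sum_congr rfl fun x _ => ?_
  rw [← Equiv.sum_comp σ fun y => S'.common (σ x) y ^ 2]
  simp_rw [hc]

/-- The sum of `f` over the natural numbers less than `n`. -/
def sumBelow (n : ℕ) (f : ℕ → ℕ) : ℕ := Nat.rec 0 (fun m ih => Nat.add ih (f m)) n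

theorem sumBelow_eq (n : ℕ) (f : ℕ → ℕ) : sumBelow n f = ∑ i : Fin n, f i := by
  induction n with
  | zero => rfl
  | succ n ih =>
    rw [Fin.sum_univ_castSucc]
    exact congrArg (· + f n) ih

/-- Whether `{x, a, b}` is a triangle of a table. -/
def isTriangle (W x a b : ℕ) : Bool :=
  ifb (Nat.beq (get W x a) (Nat.succ b)) true (Nat.beq (get W a x) (Nat.succ b))

/-- The invariant `TriSurface.commonSum` of the surface of a table. -/
def tableInvariant (W : ℕ) : ℕ :=
  sumBelow 10 fun x => Nat.pow (sumBelow 10 fun y => Nat.pow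
    (sumBelow 10 fun a => sumBelow 10 fun b =>
      ifb (isTriangle W x a b) (ifb (isTriangle W y a b) 1 0) 0) 2) 3

theorem isTriangle_iff {W : ℕ} (h : IsSurfaceTable W) {x a b : Fin 10} :
    isTriangle W x a b = true ↔ ({x, a, b} : Finset (Fin 10)) ∈ trianglesOf (tableRel W) := by
  rw [h.isOriented.mem_trianglesOf_iff, isTriangle, ifb_eq]
  simp [tableRel, Nat.beq_eq]

theorem IsSurfaceTable.commonSum_eq {W : ℕ} (h : IsSurfaceTable W) {S : TriSurface 10}
    (hS : S.faces = trianglesOf (tableRel W)) : S.commonSum = tableInvariant W := by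
  have hc : ∀ x y : Fin 10, S.common x y = sumBelow 10 fun a => sumBelow 10 fun b =>
      ifb (isTriangle W x a b) (ifb (isTriangle W y a b) 1 0) 0 := fun x y => by
    simp_rw [TriSurface.common, hS, ← isTriangle_iff h, Finset.card_filter, Fintype.sum_prod_type,
      sumBelow_eq, ifb_eq, ite_and]
  rw [TriSurface.commonSum, tableInvariant, sumBelow_eq]
  refine Finset.sum_congr rfl fun x _ => ?_
  rw [sumBelow_eq]
  simp_rw [hc]
  rfl

theorem nodup_tableInvariant : (tables.map tableInvariant).Nodup := by decide +kernel

/-! ### Identifying the results of the search -/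

/-- The table with a given index. -/
def table (i : ℕ) : ℕ := tables.getD i 0

theorem isSurfaceTable_table (i : Fin 20) : IsSurfaceTable (table i) := by
  have hi : (i : ℕ) < tables.length := i.2
  rw [table, List.getD_eq_getElem _ _ hi]
  exact isSurfaceTable_of_mem _ (List.getElem_mem hi)

theorem tableInvariant_injective :
    Function.Injective fun i : Fin 20 => tableInvariant (table i) := by
  intro i j hij
  have hi : (i : ℕ) < (tables.map tableInvariant).length := i.2
  have hj : (j : ℕ) < (tables.map tableInvariant).length := j.2
  refine Fin.ext ((nodup_tableInvariant.getElem_inj_iff (hi := hi) (hj := hj)).1 ?_)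
  have hi' : (i : ℕ) < tables.length := i.2
  have hj' : (j : ℕ) < tables.length := j.2
  dsimp only [table] at hij
  rw [List.getD_eq_getElem _ _ hi', List.getD_eq_getElem _ _ hj'] at hij
  rw [List.getElem_map, List.getElem_map, hij]

/-- Whether `p` holds for all natural numbers less than `n`. -/
def allBelow (n : ℕ) (p : ℕ → Bool) : Bool := Nat.rec true (fun m ih => ifb (p m) ih false) n

theorem allBelow_iff {n : ℕ} {p : ℕ → Bool} : allBelow n p = true ↔ ∀ i < n, p i = true := by
  induction n with
  | zero => simp [allBelow]
  | succ n ih =>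
    have e : allBelow (n + 1) p = ifb (p n) (allBelow n p) false := rfl
    rw [e, ifb_eq, Nat.forall_lt_succ_right, ← ih]
    cases p n <;> simp

/-- The `i`-th decimal digit of `h`. -/
def digit (h i : ℕ) : ℕ := Nat.mod (Nat.div h (Nat.pow 10 i)) 10

theorem digit_lt (h i : ℕ) : digit h i < 10 := Nat.mod_lt _ (by decide)

/-- Whether the digits of `h` map the triangles of the table `R` to triangles of `W`, up to
orientation. -/
def checkTriangles (R W h : ℕ) : Bool :=
  allBelow 10 fun a => force (digit h a) fun a' => allBelow 10 fun b =>
    force (digit h b) fun b' => Nat.rec true (fun c _ => force (Nat.succ (digit h c)) fun c' =>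
      ifb (Nat.beq (get W a' b') c') true (Nat.beq (get W b' a') c')) (get R a b)

/-- Whether the last ten digits of `h` give a bijection from the vertices of one of the tables
to the vertices of `W` preserving triangles, the index of the table being given by the other digits
of `h`. -/
def checkLeaf (W h : ℕ) : Bool :=
  ifb (allBelow 10 fun a => allBelow a fun b => ifb (Nat.beq (digit h a) (digit h b)) false true)
    (force (table (Nat.mod (Nat.div h (Nat.pow 10 10)) 20)) fun R => checkTriangles R W h) false

/-- Applies `checkLeaf` to the members of two lists. -/
def checkLeaves (l : List ℕ) : List ℕ → Bool :=
  List.rec (fun _ => true) (fun W _ ih hs =>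
    List.rec false (fun h hs _ => ifb (checkLeaf W h) (ih hs) false) hs) l

theorem exists_checkLeaf {l hs : List ℕ} (hl : checkLeaves l hs = true) {W : ℕ} (hW : W ∈ l) :
    ∃ h, checkLeaf W h = true := by
  induction l generalizing hs with
  | nil => exact absurd hW (by simp)
  | cons V l ih =>
    cases hs with
    | nil => exact absurd hl (by simp [checkLeaves])
    | cons h hs =>
      have e : checkLeaves (V :: l) (h :: hs) = ifb (checkLeaf V h) (checkLeaves l hs) false := rfl
      rw [e, ifb_eq] at hl
      split_ifs at hl with hV
      rcases List.mem_cons.1 hW with rfl | hW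
      · exact ⟨h, hV⟩
      · exact ih hl hW

theorem exists_perm_of_checkLeaf {W h : ℕ} (hh : checkLeaf W h = true) :
    ∃ (i : Fin 20) (φ : Equiv.Perm (Fin 10)), ∀ a b c, tableRel (table i) a b c →
      tableRel W (φ a) (φ b) (φ c) ∨ tableRel W (φ b) (φ a) (φ c) := by
  rw [checkLeaf, ifb_eq, force_eq] at hh
  split_ifs at hh with hinj
  have hne : ∀ a b : Fin 10, b < a → digit h a ≠ digit h b := fun a b hab e => by
    have := allBelow_iff.1 (allBelow_iff.1 hinj a a.2) b hab
    rw [e, Nat.beq_refl] at this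
    exact absurd this (by simp)
  have hφ : Function.Injective fun a : Fin 10 => (⟨digit h a, digit_lt h a⟩ : Fin 10) :=
    fun a b hab => by
      have e : digit h a = digit h b := congrArg Fin.val hab
      rcases lt_trichotomy a b with hlt | heq | hlt
      · exact absurd e.symm (hne _ _ hlt)
      · exact heq
      · exact absurd e (hne _ _ hlt)
  refine ⟨⟨Nat.mod (Nat.div h (Nat.pow 10 10)) 20, Nat.mod_lt _ (by decide)⟩,
    Equiv.ofBijective _ (Finite.injective_iff_bijective.1 hφ), fun a b c hT => ?_⟩
  have h₁ := allBelow_iff.1 hh a a.2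
  rw [force_eq] at h₁
  have h₂ := allBelow_iff.1 h₁ b b.2
  rw [force_eq] at h₂
  have hT' : get (table (Nat.mod (Nat.div h (Nat.pow 10 10)) 20)) a b = c + 1 := hT
  rw [hT'] at h₂
  dsimp only at h₂
  rw [force_eq, ifb_eq] at h₂
  split_ifs at h₂ with h₃
  · exact Or.inl (Nat.eq_of_beq_eq_true h₃)
  · exact Or.inr (Nat.eq_of_beq_eq_true h₂)

/-- For each result of the search, the index of an isomorphic table and an isomorphism. -/
def hints : List ℕ :=
  [9876543210, 8951720463, 19876543210, 29876543210, 39876543210, 49876543210, 59876543210,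
   52475683901, 69876543210, 79876543210, 8507913426, 89876543210, 99876543210, 109876543210,
   119876543210, 129876543210, 55316270948, 42630589714, 62630589714, 92630589714, 82630589714,
   6543219870, 90845239167, 25972046183, 109318274065, 139876543210, 134567891230, 104135269078,
   149876543210, 44103758962, 80845239167, 35972046183, 24103758962, 148420965731, 46315294807,
   26315294807, 133014697582, 142198765430, 122475683901, 116305971284, 46305971284, 56305971284,
   80167452389, 36305971284, 26305971284, 139685741032, 104317059286, 109136084257, 134758693012,
   57406182395, 71987654320, 56427380159, 113586794102, 53586794102, 121987654320, 47654321980,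
   67654321980, 8274069315, 87654321980, 97654321980, 95432198760, 65432198760, 45432198760,
   54295160837, 128974103562, 6952047183, 85432198760, 103907526418, 94768593012, 84768593012,
   1948270536, 159876543210, 106975841032, 136543219870, 132345678910, 102813947056, 90623917845,
   23759024861, 107186952043, 137654321980, 90512896734, 80512896734, 5841036972, 21709425638,
   94321987650, 22648013759, 31709425638, 84321987650, 26249075138, 90376982154, 94567891230,
   84567891230, 5806431927, 27108463259, 36249075138, 80376982154, 8690245371, 89410367582,
   108349152607, 96927138405, 22801536749, 42801536749, 147654321980, 66927138405, 80623917845,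
   32801536749, 107814062935, 132536471089, 137463528019, 102185037964, 18690245371, 169876543210,
   6827931405, 89675841032, 99675841032, 41709425638, 64321987650, 146543219870, 44321987650,
   38690245371, 24321987650, 82748016359, 44361590728, 133260498175, 24361590728, 147052941836,
   179876543210, 45204869173, 68765432190, 59751620483, 119751620483, 106902473581, 102806415397,
   95231496087, 117863902451, 85960823147, 129253461708, 54103758962, 85231496087, 167093461528,
   87394062815, 59253461708, 127863902451, 189876543210, 123586794102, 51987654320, 116427380159,
   57654321980, 77654321980, 119024786351, 53184950726, 65294183706, 103872169504, 95294183706,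
   45294183706, 55204869173, 78765432190, 115204869173, 51364572809, 158491352607, 63869024571,
   176892731405, 158140692735, 43259480617, 64183972605, 107654321980, 49410367582, 69410367582,
   99410367582, 146041839725, 44183972605, 131082475369, 24183972605, 23259480617, 94183972605,
   132150387964, 102761958403, 138950723146, 27851620493, 7654321980, 9251364708, 16738590241,
   32930578614, 47851620493, 27654321980, 25138064927, 131234567890, 90265871943, 101792836045,
   51709425638, 74321987650, 126829137405, 54321987650, 78742096531, 199876543210, 52610843579,
   75418063297, 177386902451, 68425079136, 103219876540, 95960823147, 65960823147, 45960823147,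
   55940276813, 72175039864, 112610843579, 58370519246]

set_option maxRecDepth 100000 in
theorem checkLeaves_search :
    checkLeaves (search (fun _ _ _ => true) 18 (addTri wheel 2 1 4) 1 0) hints = true := by
  decide +kernel

/-! ### The classification -/

theorem IsOriented.exists_table {T : Fin 10 → Fin 10 → Fin 10 → Prop} (h : IsOriented T)
    (hc : (arcsOf T).card = 84) : ∃ (i : Fin 20) (φ : Equiv.Perm (Fin 10)), ∀ a b c,
      tableRel (table i) a b c → T (φ a) (φ b) (φ c) ∨ T (φ b) (φ a) (φ c) := by
  obtain ⟨T', h', hc', hw, hT', σ, hσ⟩ := h.exists_normalForm hc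
  have hT : natRel T' 2 1 4 := ⟨2, 1, 4, rfl, rfl, rfl, hT'⟩
  obtain ⟨L, hL, hLT⟩ := exists_mem_search (ok := fun _ _ _ => true) (h'.searchHyp hc')
    (fun _ => rfl) 18 ((h'.compatible_wheel hw).addTri (h'.searchHyp hc') hT (by decide +kernel))
  obtain ⟨d, hd⟩ := exists_checkLeaf checkLeaves_search hL
  obtain ⟨i, φ, hφ⟩ := exists_perm_of_checkLeaf hd
  have key : ∀ {a b c : Fin 10}, tableRel L a b c → T' a b c := fun {a b c} hT =>
    natRel_iff.1 (hLT a.2 b.2 hT)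
  refine ⟨i, φ.trans σ, fun a b c hT => ?_⟩
  rcases hφ a b c hT with hT | hT
  · exact hσ _ _ _ (key hT)
  · exact (hσ _ _ _ (key hT)).symm

theorem TriSurface.iso_of_image_mem {n : ℕ} {S S' : TriSurface n} (σ : Equiv.Perm (Fin n))
    (h : ∀ f ∈ S.faces, f.image σ ∈ S'.faces) (hc : S'.faces.card ≤ S.faces.card) : S.Iso S' := by
  have hinj : Function.Injective fun f : Finset (Fin n) => f.image σ :=
    Finset.image_injective σ.injective
  have he : S.faces.image (fun f => f.image σ) = S'.faces :=
    Finset.eq_of_subset_of_card_le (Finset.image_subset_iff.2 h)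
      (hc.trans_eq (Finset.card_image_of_injective _ hinj).symm)
  refine ⟨σ, fun f => ?_⟩
  rw [← he, hinj.mem_finset_image]

theorem exists_iso_of_table {S : TriSurface 10} (hS : S.Orientable) (hχ : S.eulerChar = -4) :
    ∃ i : Fin 20, ∀ R : TriSurface 10, R.faces = trianglesOf (tableRel (table i)) → R.Iso S := by
  obtain ⟨T, hT, hST⟩ := hS.exists_isOriented
  have hχ' := hT.eulerChar_eq hST
  rw [hχ] at hχ'
  have hc : (arcsOf T).card = 84 := by push_cast at hχ'; omega
  obtain ⟨i, φ, hφ⟩ := hT.exists_table hc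
  refine ⟨i, fun R hR => TriSurface.iso_of_image_mem φ (fun f hf => ?_) ?_⟩
  · rw [hR] at hf
    obtain ⟨a, b, c, habc, rfl⟩ := mem_trianglesOf.1 hf
    simp only [Finset.image_insert, Finset.image_singleton]
    rw [hST, hT.mem_trianglesOf_iff]
    exact hφ a b c habc
  · have h₁ := hT.three_mul_card
    have h₂ := (isSurfaceTable_table i).isOriented.three_mul_card
    have h₃ := (isSurfaceTable_table i).card_arcsOf
    rw [hR, hST]
    omega

end

/-- There are exactly 20 combinatorial isomorphism classes of orientable triangulated
surfaces with 10 vertices and Euler characteristic -4 (vertex-minimal triangulations of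
the orientable surface of genus 3). -/
theorem num_genus_three_10_vertices :
    Nat.card (Quot (fun S T : {S : TriSurface 10 // S.Orientable ∧ S.eulerChar = -4} =>
      S.1.Iso T.1)) = 20 := by
  choose R hR using fun i : Fin 20 => (isSurfaceTable_table i).exists_triSurface
  have hinv : ∀ i, (R i).1.commonSum = tableInvariant (table i) := fun i =>
    (isSurfaceTable_table i).commonSum_eq (hR i)
  have hbij : Function.Bijective fun i => Quot.mk (fun S T : {S : TriSurface 10 //
      S.Orientable ∧ S.eulerChar = -4} => S.1.Iso T.1) (R i) := by
    refine ⟨fun i j hij => tableInvariant_injective ?_, fun q => ?_⟩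
    · have := congrArg (Quot.lift (fun S => S.1.commonSum) fun S T h => h.commonSum_eq) hij
      exact (hinv i).symm.trans (this.trans (hinv j))
    · obtain ⟨S, rfl⟩ := Quot.exists_rep q
      obtain ⟨i, hi⟩ := exists_iso_of_table S.2.1 S.2.2
      exact ⟨i, Quot.sound (hi _ (hR i))⟩
  rw [← Nat.card_eq_of_bijective _ hbij, Nat.card_eq_fintype_card, Fintype.card_fin]
end

section
/- The number of combinatorial isomorphism classes of non-orientable triangulated surfaces with exactly 10 vertices and Euler characteristic −5 (triangulations of the non-orientable surface of genus 7) is 14. -/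
open scoped Classical

/-- The relation `P a b c` says that `{a, b, c}` is a triangle of a neighborly triangulated
surface with ten vertices. -/
structure IsK10 (P : Fin 10 → Fin 10 → Fin 10 → Prop) : Prop where
  swap_left : ∀ {a b c}, P a b c → P b a c
  swap_right : ∀ {a b c}, P a b c → P a c b
  ne : ∀ {a b c}, P a b c → a ≠ b
  two : ∀ {a b}, a ≠ b → ∃ x y, x ≠ y ∧ ∀ z, P a b z ↔ z = x ∨ z = y
  link : ∀ {v a b}, a ≠ v → b ≠ v → Relation.ReflTransGen (P v) a b

/-- The sequence `w` runs around the link of `v`. -/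
structure IsLinkCycle (P : Fin 10 → Fin 10 → Fin 10 → Prop) (v : Fin 10) (w : ℕ → Fin 10) :
    Prop where
  rel : ∀ n, P v (w n) (w (n + 1))
  ne : ∀ n, w n ≠ w (n + 2)
  inj : ∀ i < 9, ∀ j < 9, w i = w j → i = j
  nine : w 9 = w 0
  surj : ∀ z, z ≠ v → ∃ j < 9, w j = z

namespace IsK10

variable {P Q : Fin 10 → Fin 10 → Fin 10 → Prop} {a b c d v x y z : Fin 10}

theorem rotate (h : IsK10 P) (hP : P a b c) : P b c a :=
  h.swap_right (h.swap_left hP)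

theorem ne_right (h : IsK10 P) (hP : P a b c) : b ≠ c :=
  h.ne (h.rotate hP)

theorem ne_outer (h : IsK10 P) (hP : P a b c) : a ≠ c :=
  h.ne (h.swap_right hP)

/-- A pair of vertices lies in at most two triangles. -/
theorem eq_or_eq (h : IsK10 P) (hx : P a b x) (hy : P a b y) (hxy : x ≠ y) (hz : P a b z) :
    z = x ∨ z = y := by
  obtain ⟨p, q, -, hpq⟩ := h.two (h.ne hx)
  rw [hpq] at hx hy hz
  grind

/-- A surface contained in another one is equal to it. -/
theorem eq_of_le (hP : IsK10 P) (hQ : IsK10 Q) (hPQ : ∀ a b c, P a b c → Q a b c) :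
    Q a b c ↔ P a b c := by
  refine ⟨fun hq => ?_, hPQ a b c⟩
  obtain ⟨p, q, hne, hpq⟩ := hP.two (hQ.ne hq)
  rw [hpq]
  exact hQ.eq_or_eq (hPQ _ _ _ ((hpq p).2 (Or.inl rfl))) (hPQ _ _ _ ((hpq q).2 (Or.inr rfl)))
    hne hq

theorem comp_perm (h : IsK10 P) (σ : Equiv.Perm (Fin 10)) :
    IsK10 fun a b c => P (σ a) (σ b) (σ c) where
  swap_left := h.swap_left
  swap_right := h.swap_right
  ne hP hab := h.ne hP (congrArg σ hab)
  two {a b} hab := by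
    obtain ⟨x, y, hxy, hz⟩ := h.two (σ.injective.ne hab)
    refine ⟨σ.symm x, σ.symm y, σ.symm.injective.ne hxy, fun z => ?_⟩
    rw [hz, Equiv.eq_symm_apply, Equiv.eq_symm_apply]
  link {v a b} ha hb := by
    have := (h.link (σ.injective.ne ha) (σ.injective.ne hb)).lift
      (p := fun x y => P (σ v) (σ x) (σ y)) σ.symm (fun x y hxy =>
        by simpa [Function.onFun] using hxy)
    simpa [Function.onFun] using this

/-- Every two consecutive vertices in the link of `v` start a cycle through the link. -/
theorem exists_isLinkCycle (h : IsK10 P) (hP : P v x y) :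
    ∃ w, w 0 = x ∧ w 1 = y ∧ IsLinkCycle P v w := by
  have hex : ∀ a b, ∃ c, P v a b → P v b c ∧ a ≠ c := by
    intro a b
    by_cases hab : P v a b
    · obtain ⟨p, q, hpq, hz⟩ := h.two (h.ne (h.swap_right hab))
      by_cases hap : a = p
      · exact ⟨q, fun _ => ⟨(hz q).2 (Or.inr rfl), hap ▸ hpq⟩⟩
      · exact ⟨p, fun _ => ⟨(hz p).2 (Or.inl rfl), hap⟩⟩
    · exact ⟨a, fun h => absurd h hab⟩
  choose f hf using hex
  let s : ℕ → Fin 10 × Fin 10 := fun n => (fun p => (p.2, f p.1 p.2))^[n] (x, y)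
  have hs : ∀ n, s (n + 1) = ((s n).2, f (s n).1 (s n).2) := fun n =>
    Function.iterate_succ_apply' _ _ _
  let w : ℕ → Fin 10 := fun n => (s n).1
  have hw2 : ∀ n, w (n + 2) = f (w n) (w (n + 1)) := by
    intro n
    simp only [w, hs]
  have hrel : ∀ n, P v (w n) (w (n + 1)) := by
    intro n
    induction n with
    | zero => exact hP
    | succ n ih => rw [hw2]; exact (hf _ _ ih).1
  have hne : ∀ n, w n ≠ w (n + 2) := fun n => by rw [hw2]; exact (hf _ _ (hrel n)).2
  have hnbr : ∀ n z, P v (w (n + 1)) z → z = w n ∨ z = w (n + 2) := fun n z hz =>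
    h.eq_or_eq (h.swap_right (hrel n)) (hrel (n + 1)) (hne n) hz
  have hrep : ∃ m, ∃ j < m, w j = w m := by
    obtain ⟨i, j, hij, hw⟩ := Finite.exists_ne_map_eq_of_infinite w
    rcases lt_or_gt_of_ne hij with hlt | hlt
    · exact ⟨j, i, hlt, hw⟩
    · exact ⟨i, j, hlt, hw.symm⟩
  classical
  obtain ⟨m, ⟨j, hjm, hj⟩, hmin⟩ : ∃ m, (∃ j < m, w j = w m) ∧
      ∀ k < m, ¬ ∃ j < k, w j = w k :=
    ⟨Nat.find hrep, Nat.find_spec hrep, fun k hk => Nat.find_min hrep hk⟩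
  have hinj : ∀ i < m, ∀ k < m, w i = w k → i = k := by
    intro i hi k hk hik
    by_contra hne
    rcases lt_or_gt_of_ne hne with hlt | hlt
    · exact hmin k hk ⟨i, hlt, hik⟩
    · exact hmin i hi ⟨k, hlt, hik.symm⟩
  obtain ⟨m, rfl⟩ : ∃ k, m = k + 1 := ⟨m - 1, by omega⟩
  have hadj : ∀ n, w n ≠ w (n + 1) := fun n => h.ne_right (hrel n)
  have hj0 : j = 0 := by
    by_contra hj0
    obtain ⟨j, rfl⟩ : ∃ k, j = k + 1 := ⟨j - 1, by omega⟩
    have hback : P v (w (j + 1)) (w m) := by rw [hj]; exact h.swap_right (hrel m)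
    rcases hnbr j _ hback with h1 | h1
    · have := hinj m (by omega) j (by omega) h1
      omega
    · by_cases h2 : j + 2 < m + 1
      · have := hinj m (by omega) _ h2 h1
        subst this
        exact hne _ hj
      · have : m = j + 1 := by omega
        subst this
        exact hadj _ h1
  subst hj0
  have hm2 : 2 ≤ m := by
    by_contra hlt
    have h01 : m = 0 ∨ m = 1 := by omega
    rcases h01 with rfl | rfl
    · exact hadj _ hj
    · exact hne _ hj
  have hback : P v (w 0) (w m) := by rw [hj]; exact h.swap_right (hrel m)
  have hm1 : w m ≠ w 1 := fun h1 => by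
    have := hinj m (by omega) 1 (by omega) h1
    omega
  have hreach : ∀ z, z ≠ v → ∃ i < m + 1, w i = z := by
    intro z hz
    have hgen := h.link (h.ne (hrel 0)).symm hz
    induction hgen with
    | refl => exact ⟨0, by omega, rfl⟩
    | @tail b c _ hbc ih =>
      obtain ⟨i, hi, rfl⟩ := ih (h.ne hbc).symm
      rcases Nat.eq_zero_or_pos i with rfl | hpos
      · rcases h.eq_or_eq hback (hrel 0) hm1 hbc with h1 | h1
        · exact ⟨m, by omega, h1.symm⟩
        · exact ⟨1, by omega, h1.symm⟩
      · obtain ⟨i, rfl⟩ : ∃ k, i = k + 1 := ⟨i - 1, by omega⟩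
        rcases hnbr i _ hbc with h1 | h1
        · exact ⟨i, by omega, h1.symm⟩
        · by_cases h2 : i + 2 < m + 1
          · exact ⟨i + 2, h2, h1.symm⟩
          · have : i + 2 = m + 1 := by omega
            exact ⟨0, by omega, by rw [hj, ← this, h1]⟩
  have hm : m = 8 := by
    have himg : (Finset.range (m + 1)).image w = Finset.univ.erase v := by
      ext z
      simp only [Finset.mem_image, Finset.mem_range, Finset.mem_erase, Finset.mem_univ, and_true]
      exact ⟨fun ⟨i, _, hi⟩ => hi ▸ (h.ne (hrel i)).symm, hreach z⟩
    have hcard := congrArg Finset.card himg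
    rw [Finset.card_image_of_injOn
      (fun i hi k hk => hinj i (by simpa using hi) k (by simpa using hk))] at hcard
    simp at hcard
    exact hcard
  subst hm
  exact ⟨w, rfl, rfl, hrel, hne, hinj, hj.symm, hreach⟩

end IsK10

namespace IsLinkCycle

variable {P : Fin 10 → Fin 10 → Fin 10 → Prop} {v z : Fin 10} {w : ℕ → Fin 10}

theorem eq_or_eq (hw : IsLinkCycle P v w) (h : IsK10 P) {n : ℕ} (hz : P v (w (n + 1)) z) :
    z = w n ∨ z = w (n + 2) :=
  h.eq_or_eq (h.swap_right (hw.rel n)) (hw.rel (n + 1)) (hw.ne n) hz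

end IsLinkCycle

namespace IsK10

variable {P : Fin 10 → Fin 10 → Fin 10 → Prop} {a b c v : Fin 10}

/-- The link of a vertex contains no cycle of length three. -/
theorem not_link_triangle (h : IsK10 P) (hab : P v a b) (hbc : P v b c) (hac : P v a c) :
    False := by
  obtain ⟨w, rfl, rfl, hw⟩ := h.exists_isLinkCycle hab
  rcases hw.eq_or_eq h hbc with rfl | rfl
  · exact h.ne_right hac rfl
  rcases hw.eq_or_eq h (h.swap_right hac) with h1 | h1
  · exact absurd (hw.inj _ (by norm_num) _ (by norm_num) h1) (by norm_num)
  · exact absurd (hw.inj _ (by norm_num) _ (by norm_num) h1) (by norm_num)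

/-- Renumber a surface such that `v` becomes `0` and its link becomes `1, ..., 9`. -/
theorem exists_perm_of_isLinkCycle {w : ℕ → Fin 10} (h : IsK10 P) (hw : IsLinkCycle P v w) :
    ∃ σ : Equiv.Perm (Fin 10), σ 0 = v ∧ ∀ i, i < 9 → ∀ j : Fin 10, j.val = i + 1 → σ j = w i := by
  let g : Fin 10 → Fin 10 := fun i => if i = 0 then v else w (i.val - 1)
  have hv : ∀ n, w n ≠ v := fun n => (h.ne (hw.rel n)).symm
  have hg : Function.Injective g := by
    intro i j hij
    simp only [g] at hij
    split_ifs at hij with hi hj hj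
    · rw [hi, hj]
    · exact absurd hij.symm (hv _)
    · exact absurd hij (hv _)
    · have := hw.inj _ (by omega) _ (by omega) hij
      omega
  refine ⟨Equiv.ofBijective g (Finite.injective_iff_bijective.1 hg), by simp [g], ?_⟩
  intro i hi j hj
  have : j ≠ 0 := fun h0 => by simp [h0] at hj
  simp [g, this, hj]

end IsK10

namespace TriSurface

/-- Every triangulated surface has `3 f₂ = 2 f₁`. -/
theorem three_mul_card_faces {n : ℕ} (S : TriSurface n) :
    S.faces.card * 3 = S.edges.card * 2 := by
  refine Finset.card_mul_eq_card_mul (fun f e : Finset (Fin n) => e ⊆ f) (fun f hf => ?_)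
    (fun e he => ?_)
  · have : S.edges.bipartiteAbove (fun f e : Finset (Fin n) => e ⊆ f) f = f.powersetCard 2 := by
      ext e
      simp only [Finset.mem_bipartiteAbove, edges, Finset.mem_filter, Finset.mem_univ, true_and,
        Finset.mem_powersetCard]
      exact ⟨fun h => ⟨h.2, h.1.1⟩, fun h => ⟨⟨h.2, f, hf, h.1⟩, h.1⟩⟩
    rw [this, Finset.card_powersetCard, S.card_eq f hf]
    rfl
  · simp only [edges, Finset.mem_filter, Finset.mem_univ, true_and] at he
    obtain ⟨hcard, f, hf, hef⟩ := he
    obtain ⟨u, v, huv, rfl⟩ := Finset.card_eq_two.1 hcard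
    have := S.edge_two u v huv ⟨f, hf, hef (by simp), hef (by simp)⟩
    rw [← this]
    congr 1
    ext g
    simp [Finset.mem_bipartiteBelow, Finset.insert_subset_iff]

theorem card_edges_eq_of_eulerChar (S : TriSurface 10) :
    S.eulerChar = -5 ↔ S.edges.card = 45 := by
  have := S.three_mul_card_faces
  simp only [eulerChar]
  omega

/-- A surface with ten vertices has `45` edges if and only if it is neighborly. -/
theorem edges_eq_iff (S : TriSurface 10) :
    S.edges.card = 45 ↔ ∀ u v, u ≠ v → ∃ f ∈ S.faces, u ∈ f ∧ v ∈ f := by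
  have hsub : S.edges ⊆ Finset.univ.powersetCard 2 := fun e he => by
    simp only [edges, Finset.mem_filter] at he
    simp [Finset.mem_powersetCard, he.2.1]
  have hcard : (Finset.univ.powersetCard 2 : Finset (Finset (Fin 10))).card = 45 := by
    rw [Finset.card_powersetCard]
    rfl
  rw [← hcard]
  constructor
  · intro h u v huv
    have hmem : ({u, v} : Finset (Fin 10)) ∈ S.edges := by
      rw [Finset.eq_of_subset_of_card_le hsub h.ge]
      simp [Finset.mem_powersetCard, Finset.card_pair huv]
    simp only [edges, Finset.mem_filter] at hmem
    obtain ⟨-, -, f, hf, hef⟩ := hmem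
    exact ⟨f, hf, hef (by simp), hef (by simp)⟩
  · intro h
    congr 1
    refine Finset.Subset.antisymm hsub fun e he => ?_
    have he2 := (Finset.mem_powersetCard.1 he).2
    obtain ⟨u, v, huv, rfl⟩ := Finset.card_eq_two.1 he2
    obtain ⟨f, hf, hu, hv⟩ := h u v huv
    simp only [edges, Finset.mem_filter, Finset.mem_univ, true_and]
    exact ⟨he2, f, hf, by simp [Finset.insert_subset_iff, hu, hv]⟩

/-- The relation on the vertices to form a triangle. -/
def Tri (S : TriSurface 10) (a b c : Fin 10) : Prop :=
  ({a, b, c} : Finset (Fin 10)) ∈ S.faces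

theorem Tri.ne {S : TriSurface 10} {a b c : Fin 10} (h : S.Tri a b c) : a ≠ b := by
  rintro rfl
  have := S.card_eq _ h
  have h2 : ({a, a, c} : Finset (Fin 10)).card ≤ 2 := by
    rw [Finset.insert_eq_of_mem (by simp)]
    exact Finset.card_le_two
  omega

/-- A triangle through two vertices has a third vertex. -/
theorem exists_eq_of_mem {S : TriSurface 10} {f : Finset (Fin 10)} {a b : Fin 10}
    (hf : f ∈ S.faces) (ha : a ∈ f) (hb : b ∈ f) (hab : a ≠ b) :
    ∃ c, a ≠ c ∧ b ≠ c ∧ f = {a, b, c} := by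
  have hsub : ({a, b} : Finset (Fin 10)) ⊆ f := by simp [Finset.insert_subset_iff, ha, hb]
  have h1 : (f \ {a, b}).card = 1 := by
    rw [Finset.card_sdiff_of_subset hsub, S.card_eq f hf, Finset.card_pair hab]
  obtain ⟨c, hc⟩ := Finset.card_eq_one.1 h1
  have hmem : c ∈ f \ {a, b} := by simp [hc]
  simp only [Finset.mem_sdiff, Finset.mem_insert, Finset.mem_singleton, not_or] at hmem
  refine ⟨c, Ne.symm hmem.2.1, Ne.symm hmem.2.2, ?_⟩
  rw [← Finset.union_sdiff_of_subset hsub, hc]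
  ext
  simp

theorem isK10_tri (S : TriSurface 10) (hS : S.eulerChar = -5) : IsK10 S.Tri := by
  have hS := S.edges_eq_iff.1 (S.card_edges_eq_of_eulerChar.1 hS)
  have hl : ∀ {a b c}, S.Tri a b c → S.Tri b a c := fun {a b c} h => by
    rwa [Tri, Finset.insert_comm]
  have hr : ∀ {a b c}, S.Tri a b c → S.Tri a c b := fun {a b c} h => by
    rwa [Tri, Finset.pair_comm]
  refine ⟨hl, hr, Tri.ne, fun {a b} hab => ?_, fun {v a b} ha hb => ?_⟩
  · obtain ⟨f, g, hfg, hset⟩ := Finset.card_eq_two.1 (S.edge_two a b hab (hS a b hab))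
    have hf := Finset.mem_filter.1 (show f ∈ S.faces.filter fun f => a ∈ f ∧ b ∈ f by
      rw [hset]; simp)
    have hg := Finset.mem_filter.1 (show g ∈ S.faces.filter fun f => a ∈ f ∧ b ∈ f by
      rw [hset]; simp)
    obtain ⟨x, hax, hbx, rfl⟩ := exists_eq_of_mem hf.1 hf.2.1 hf.2.2 hab
    obtain ⟨y, hay, hby, rfl⟩ := exists_eq_of_mem hg.1 hg.2.1 hg.2.2 hab
    refine ⟨x, y, fun h => hfg (by rw [h]), fun z => ⟨fun hz => ?_, ?_⟩⟩
    · have hmem : ({a, b, z} : Finset (Fin 10)) ∈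
          S.faces.filter fun f => a ∈ f ∧ b ∈ f := by
        simp only [Finset.mem_filter]
        exact ⟨hz, by simp, by simp⟩
      have hza : z ≠ a := fun h => (hl (hr hz)).ne h
      have hzb : z ≠ b := fun h => (hl (hr (hl hz))).ne h
      rw [hset] at hmem
      simp only [Finset.mem_insert, Finset.mem_singleton] at hmem
      rcases hmem with h | h
      · have : z ∈ ({a, b, x} : Finset (Fin 10)) := by rw [← h]; simp
        simpa [hza, hzb] using Or.inl (b := z = y) this
      · have : z ∈ ({a, b, y} : Finset (Fin 10)) := by rw [← h]; simp
        right
        simpa [hza, hzb] using this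
    · rintro (rfl | rfl)
      · exact hf.1
      · exact hg.1
  · obtain ⟨f, hf, hvf, haf⟩ := hS v a ha.symm
    obtain ⟨g, hg, hvg, hbg⟩ := hS v b hb.symm
    exact Relation.ReflTransGen.mono (fun x y h => h.2.2.2) _ _
      (S.link_cycle v a b ⟨f, hf, hvf, haf, ha⟩ ⟨g, hg, hvg, hbg, hb⟩)

end TriSurface

namespace IsK10

variable {P Q : Fin 10 → Fin 10 → Fin 10 → Prop} {a b c x y z : Fin 10}

theorem of_insert_eq (h : IsK10 P) (hP : P a b c)
    (heq : ({x, y, z} : Finset (Fin 10)) = {a, b, c}) : P x y z := by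
  have h1 : x ∈ ({a, b, c} : Finset (Fin 10)) := by rw [← heq]; simp
  have h2 : y ∈ ({a, b, c} : Finset (Fin 10)) := by rw [← heq]; simp
  have h3 : z ∈ ({a, b, c} : Finset (Fin 10)) := by rw [← heq]; simp
  have hcard : ({x, y, z} : Finset (Fin 10)).card = 3 := by
    rw [heq, Finset.card_eq_three]
    exact ⟨a, b, c, h.ne hP, h.ne_outer hP, h.ne_right hP, rfl⟩
  have hxy : x ≠ y := by
    rintro rfl
    rw [Finset.insert_eq_of_mem (by simp)] at hcard
    have := Finset.card_le_two (a := x) (b := z)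
    omega
  have hxz : x ≠ z := by
    rintro rfl
    rw [Finset.insert_eq_of_mem (by simp)] at hcard
    have := Finset.card_le_two (a := y) (b := x)
    omega
  have hyz : y ≠ z := by
    rintro rfl
    rw [Finset.insert_comm, Finset.insert_eq_of_mem (by simp)] at hcard
    have := Finset.card_le_two (a := x) (b := y)
    omega
  have p1 := h.swap_left hP
  have p2 := h.swap_right hP
  have p3 := h.rotate hP
  have p4 := h.rotate p3
  have p5 := h.swap_left p3
  simp only [Finset.mem_insert, Finset.mem_singleton] at h1 h2 h3
  grind

/-- The set of triangles of a relation. -/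
noncomputable def faces (P : Fin 10 → Fin 10 → Fin 10 → Prop) : Finset (Finset (Fin 10)) :=
  Finset.univ.filter fun f => ∃ a b c, f = {a, b, c} ∧ P a b c

theorem insert_mem_faces (h : IsK10 P) :
    ({a, b, c} : Finset (Fin 10)) ∈ faces P ↔ P a b c := by
  simp only [faces, Finset.mem_filter, Finset.mem_univ, true_and]
  exact ⟨fun ⟨x, y, z, heq, hP⟩ => h.of_insert_eq hP heq, fun hP => ⟨a, b, c, rfl, hP⟩⟩

theorem exists_eq_of_mem_faces (h : IsK10 P) {f : Finset (Fin 10)} (hf : f ∈ faces P)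
    (ha : a ∈ f) (hb : b ∈ f) (hab : a ≠ b) : ∃ c, f = {a, b, c} ∧ P a b c := by
  simp only [faces, Finset.mem_filter, Finset.mem_univ, true_and] at hf
  obtain ⟨x, y, z, rfl, hP⟩ := hf
  have p1 := h.swap_left hP
  have p2 := h.swap_right hP
  have p3 := h.rotate hP
  have p4 := h.rotate p3
  have p5 := h.swap_left p3
  simp only [Finset.mem_insert, Finset.mem_singleton] at ha hb
  rcases ha with ha | ha | ha <;> rcases hb with hb | hb | hb <;> rw [ha, hb] at hab ⊢
  all_goals first
    | exact absurd rfl hab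
    | exact ⟨x, by grind, by assumption⟩
    | exact ⟨y, by grind, by assumption⟩
    | exact ⟨z, by grind, by assumption⟩

theorem exists_rel (h : IsK10 P) (hab : a ≠ b) : ∃ c, P a b c := by
  obtain ⟨x, y, -, hz⟩ := h.two hab
  exact ⟨x, (hz x).2 (Or.inl rfl)⟩

theorem exists_mem_faces (h : IsK10 P) (hab : a ≠ b) : ∃ f ∈ faces P, a ∈ f ∧ b ∈ f := by
  obtain ⟨c, hc⟩ := h.exists_rel hab
  exact ⟨_, h.insert_mem_faces.2 hc, by simp, by simp⟩

/-- The triangulated surface of a relation. -/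
noncomputable def toTriSurface (h : IsK10 P) : TriSurface 10 where
  faces := faces P
  card_eq f hf := by
    simp only [faces, Finset.mem_filter, Finset.mem_univ, true_and] at hf
    obtain ⟨a, b, c, rfl, hP⟩ := hf
    exact Finset.card_eq_three.2 ⟨a, b, c, h.ne hP, h.ne_outer hP, h.ne_right hP, rfl⟩
  vertex_mem v := by
    obtain ⟨u, hu⟩ := exists_ne v
    obtain ⟨f, hf, -, hv⟩ := h.exists_mem_faces hu
    exact ⟨f, hf, hv⟩
  edge_two u v huv _ := by
    obtain ⟨x, y, hxy, hz⟩ := h.two huv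
    refine Finset.card_eq_two.2 ⟨{u, v, x}, {u, v, y}, fun heq => ?_, ?_⟩
    · have hy : y ∈ ({u, v, x} : Finset (Fin 10)) := by rw [heq]; simp
      have hP := (hz y).2 (Or.inr rfl)
      simp only [Finset.mem_insert, Finset.mem_singleton] at hy
      rcases hy with rfl | rfl | rfl
      · exact h.ne_outer hP rfl
      · exact h.ne_right hP rfl
      · exact hxy rfl
    · ext f
      simp only [Finset.mem_filter, Finset.mem_insert, Finset.mem_singleton]
      constructor
      · rintro ⟨hf, hu, hv⟩
        obtain ⟨c, rfl, hc⟩ := h.exists_eq_of_mem_faces hf hu hv huv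
        rcases (hz c).1 hc with rfl | rfl <;> simp
      · rintro (rfl | rfl)
        · exact ⟨h.insert_mem_faces.2 ((hz x).2 (Or.inl rfl)), by simp, by simp⟩
        · exact ⟨h.insert_mem_faces.2 ((hz y).2 (Or.inr rfl)), by simp, by simp⟩
  conn u v := by
    by_cases huv : u = v
    · rw [huv]
    · exact Relation.ReflTransGen.single (h.exists_mem_faces huv)
  link_cycle v a b ha hb := by
    obtain ⟨_, _, _, _, ha⟩ := ha
    obtain ⟨_, _, _, _, hb⟩ := hb
    exact Relation.ReflTransGen.mono (fun x y hxy =>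
      ⟨h.ne_right hxy, (h.ne hxy).symm, (h.ne_outer hxy).symm, h.insert_mem_faces.2 hxy⟩) _ _
      (h.link ha hb)

theorem tri_toTriSurface (h : IsK10 P) : h.toTriSurface.Tri a b c ↔ P a b c :=
  h.insert_mem_faces

theorem eulerChar_toTriSurface (h : IsK10 P) : h.toTriSurface.eulerChar = -5 := by
  rw [TriSurface.card_edges_eq_of_eulerChar, TriSurface.edges_eq_iff]
  exact fun u v huv => h.exists_mem_faces huv

end IsK10

namespace TriSurface

theorem iso_of_tri {S T : TriSurface 10} (σ : Equiv.Perm (Fin 10))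
    (h : ∀ a b c, S.Tri a b c ↔ T.Tri (σ a) (σ b) (σ c)) : S.Iso T := by
  refine ⟨σ, fun f => ?_⟩
  by_cases hf : f.card = 3
  · obtain ⟨a, b, c, -, -, -, rfl⟩ := Finset.card_eq_three.1 hf
    simpa [Tri, Finset.image_insert] using h a b c
  · refine iff_of_false (fun hS => hf (S.card_eq f hS)) fun hT => hf ?_
    rw [← T.card_eq _ hT, Finset.card_image_of_injective _ σ.injective]

theorem Iso.exists_perm {S T : TriSurface 10} (h : S.Iso T) :
    ∃ σ : Equiv.Perm (Fin 10), ∀ a b c, S.Tri a b c ↔ T.Tri (σ a) (σ b) (σ c) := by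
  obtain ⟨σ, hσ⟩ := h
  exact ⟨σ, fun a b c => by simpa [Tri, Finset.image_insert] using hσ {a, b, c}⟩

end TriSurface

namespace TriSurface

theorem sign_prodComm_fin_ten :
    Equiv.Perm.sign (Equiv.prodComm (Fin 10) (Fin 10)) = -1 := by
  decide +kernel

/-- The triangle `a, b, c` has the cyclic orientation `(a, b, c)`. -/
def Oriented (S : TriSurface 10) (ω : Finset (Fin 10) → Finset (Fin 10 × Fin 10))
    (a b c : Fin 10) : Prop :=
  S.Tri a b c ∧ ω {a, b, c} = {(a, b), (b, c), (c, a)}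

/-- In an orientation, the vertex following a directed edge is a function of this edge. -/
theorem Orientable.exists_next {S : TriSurface 10} (hS : S.eulerChar = -5)
    (hO : S.Orientable) : ∃ r : Fin 10 → Fin 10 → Fin 10,
      ∀ a b, a ≠ b → S.Tri a b (r a b) ∧ r b (r a b) = a ∧ r a (r a b) ≠ b := by
  obtain ⟨ω, hω, hdisj⟩ := hO
  have h := S.isK10_tri hS
  let O := S.Oriented ω
  have hrot : ∀ {a b c}, O a b c → O b c a := by
    rintro a b c ⟨h1, h2⟩
    have hset : ({b, c, a} : Finset (Fin 10)) = {a, b, c} := by grind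
    refine ⟨h.rotate h1, ?_⟩
    rw [hset, h2]
    grind
  have huniq : ∀ {a b c d}, O a b c → O a b d → c = d := by
    rintro a b c d ⟨h1, h2⟩ ⟨h3, h4⟩
    by_contra hcd
    refine hdisj _ h1 _ h3 (fun heq => ?_) (a, b) (by rw [h2]; simp) (by rw [h4]; simp)
    have hc : c ∈ ({a, b, d} : Finset (Fin 10)) := by rw [← heq]; simp
    simp only [Finset.mem_insert, Finset.mem_singleton] at hc
    rcases hc with rfl | rfl | rfl
    · exact h.ne_outer h1 rfl
    · exact h.ne_right h1 rfl
    · exact hcd rfl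
  have hasym : ∀ {a b c}, O a b c → ¬ O a c b := by
    rintro a b c ⟨h1, h2⟩ ⟨h3, h4⟩
    have hset : ({a, c, b} : Finset (Fin 10)) = {a, b, c} := by grind
    rw [hset, h2] at h4
    have hmem : (a, b) ∈ ({(a, c), (c, b), (b, a)} : Finset (Fin 10 × Fin 10)) := by
      rw [← h4]; simp
    have := h.ne h1
    have := h.ne_right h1
    have := h.ne_outer h1
    simp only [Finset.mem_insert, Finset.mem_singleton, Prod.mk.injEq] at hmem
    grind
  have hor : ∀ {a b c}, S.Tri a b c → O a b c ∨ O b a c := by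
    intro a b c hT
    obtain ⟨x, y, z, hxy, hxz, hyz, hset, hωf⟩ := hω _ hT
    have hO : O x y z := ⟨by rwa [Tri, ← hset], by rw [← hset, hωf]⟩
    have hO' := hrot hO
    have hO'' := hrot hO'
    have ha : a ∈ ({x, y, z} : Finset (Fin 10)) := by rw [← hset]; simp
    have hb : b ∈ ({x, y, z} : Finset (Fin 10)) := by rw [← hset]; simp
    have hc : c ∈ ({x, y, z} : Finset (Fin 10)) := by rw [← hset]; simp
    have := h.ne hT
    have := h.ne_right hT
    have := h.ne_outer hT
    simp only [Finset.mem_insert, Finset.mem_singleton] at ha hb hc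
    clear hset hωf hω hdisj
    rcases ha with rfl | rfl | rfl <;> rcases hb with rfl | rfl | rfl <;>
      rcases hc with rfl | rfl | rfl <;> first | contradiction | tauto
  have hex : ∀ a b, ∃ c, a ≠ b → O a b c := by
    intro a b
    by_cases hab : a = b
    · exact ⟨a, fun hne => absurd hab hne⟩
    · obtain ⟨x, y, hxy, hz⟩ := h.two hab
      rcases hor ((hz x).2 (Or.inl rfl)) with hx | hx
      · exact ⟨x, fun _ => hx⟩
      · rcases hor ((hz y).2 (Or.inr rfl)) with hy | hy
        · exact ⟨y, fun _ => hy⟩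
        · exact absurd (huniq hx hy) hxy
  choose r hr using hex
  refine ⟨r, fun a b hab => ?_⟩
  have hT := (hr a b hab).1
  refine ⟨hT, huniq (hr b _ (h.ne_right hT)) (hrot (hr a b hab)), fun heq => ?_⟩
  refine hasym (hr a b hab) ?_
  have := hr a _ (h.ne_outer hT)
  rwa [heq] at this

/-- Walking along an oriented link nine times is the identity. -/
theorem iterate_nine_eq {S : TriSurface 10} (hS : S.eulerChar = -5)
    {r : Fin 10 → Fin 10 → Fin 10}
    (hr : ∀ a b, a ≠ b → S.Tri a b (r a b) ∧ r b (r a b) = a ∧ r a (r a b) ≠ b)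
    {a b : Fin 10} (hab : a ≠ b) : (r a)^[9] b = b := by
  have h := S.isK10_tri hS
  obtain ⟨w, h0, h1, hw⟩ := h.exists_isLinkCycle (hr a b hab).1
  have hstep : ∀ n, w (n + 1) = r a (w n) := by
    intro n
    induction n with
    | zero => rw [h0, h1]
    | succ n ih =>
      have hne := h.ne (hw.rel n)
      have hT : S.Tri a (w (n + 1)) (r a (w (n + 1))) := (hr a _ (h.ne (hw.rel (n + 1)))).1
      rcases hw.eq_or_eq h hT with h2 | h2
      · rw [ih] at h2
        exact absurd h2 (hr a _ hne).2.2
      · exact h2.symm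
  have hiter : ∀ n, w n = (r a)^[n] b := by
    intro n
    induction n with
    | zero => exact h0
    | succ n ih => rw [hstep, ih, Function.iterate_succ_apply']
  rw [← hiter, hw.nine, h0]

/-- A triangulated surface with ten vertices and Euler characteristic `-5` is non-orientable. -/
theorem not_orientable (S : TriSurface 10) (hS : S.eulerChar = -5) : ¬ S.Orientable := by
  intro hO
  obtain ⟨r, hr⟩ := hO.exists_next hS
  have h := S.isK10_tri hS
  have hbr : ∀ a b, a ≠ b → b ≠ r a b := fun a b hab => h.ne_right (hr a b hab).1
  have har : ∀ a b, a ≠ b → a ≠ r a b := fun a b hab => h.ne_outer (hr a b hab).1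
  let f : Fin 10 × Fin 10 → Fin 10 × Fin 10 := fun p =>
    if p.1 = p.2 then p else (p.2, r p.1 p.2)
  have hfd : ∀ a, f (a, a) = (a, a) := fun a => by simp [f]
  have hf : ∀ a b, a ≠ b → f (a, b) = (b, r a b) := fun a b hab => by simp [f, hab]
  have hf3 : ∀ p, f (f (f p)) = p := by
    rintro ⟨a, b⟩
    by_cases hab : a = b
    · rw [hab, hfd, hfd, hfd]
    · have h1 := (hr a b hab).2.1
      have h2 := (hr b _ (hbr a b hab)).2.1
      rw [h1] at h2
      rw [hf a b hab, hf _ _ (hbr a b hab), h1, hf _ _ (har a b hab).symm, h2]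
  let φ : Equiv.Perm (Fin 10 × Fin 10) := ⟨f, fun p => f (f p), hf3, hf3⟩
  let ρ : Equiv.Perm (Fin 10 × Fin 10) := Equiv.prodComm (Fin 10) (Fin 10) * φ ^ 2
  have hρd : ∀ a, ρ (a, a) = (a, a) := fun a => by
    change (f (f (a, a))).swap = _
    rw [hfd, hfd]
    rfl
  have hρ : ∀ a b, a ≠ b → ρ (a, b) = (a, r a b) := fun a b hab => by
    change (f (f (a, b))).swap = _
    rw [hf a b hab, hf _ _ (hbr a b hab), (hr a b hab).2.1]
    rfl
  have hiter : ∀ n a b, a ≠ b → (ρ ^ n) (a, b) = (a, (r a)^[n] b) ∧ a ≠ (r a)^[n] b := by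
    intro n a b hab
    induction n with
    | zero => exact ⟨rfl, hab⟩
    | succ n ih =>
      rw [pow_succ', Equiv.Perm.mul_apply, ih.1, hρ _ _ ih.2, Function.iterate_succ_apply']
      exact ⟨rfl, har _ _ ih.2⟩
  have hρ9 : ρ ^ 9 = 1 := by
    ext1 ⟨a, b⟩
    by_cases hab : a = b
    · subst hab
      exact Function.IsFixedPt.perm_pow (hρd a) 9
    · rw [(hiter 9 a b hab).1, iterate_nine_eq hS hr hab]
      rfl
  have hs : Equiv.Perm.sign ρ = -1 := by
    rw [map_mul, map_pow, Int.units_sq, mul_one, sign_prodComm_fin_ten]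
  have hs9 : Equiv.Perm.sign ρ ^ 9 = 1 := by rw [← map_pow, hρ9, map_one]
  rw [hs] at hs9
  exact absurd hs9 (by decide)

end TriSurface

namespace TenVertex

/-- Position of the triple `(a, b, c)` of digits in a bit mask. -/
def idx (a b c : ℕ) : ℕ := Nat.add 64 (Nat.add (Nat.mul 10 (Nat.add (Nat.mul 10 a) b)) c)

/-- The `i`-th bit of `m`. -/
def bit (m i : ℕ) : Bool := Nat.beq (Nat.land (Nat.shiftRight m i) 1) 1

/-- The mask with the single bit `i`. -/
def one (i : ℕ) : ℕ := Nat.shiftLeft 1 i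

/-- The mask of all orderings of the triple `(a, b, c)`. -/
def triMask (a b c : ℕ) : ℕ :=
  Nat.lor (Nat.lor (Nat.lor (one (idx a b c)) (one (idx a c b)))
    (Nat.lor (one (idx b a c)) (one (idx b c a))))
    (Nat.lor (one (idx c a b)) (one (idx c b a)))

/-- The mask of all `c` such that the bit `(a, b, c)` of `N` is set. -/
def nb (N a b : ℕ) : ℕ := Nat.land (Nat.shiftRight N (idx a b 0)) 1023

/-- Remove the bit `i < 10` from a ten-bit mask. -/
def clear (m i : ℕ) : ℕ := Nat.land m (Nat.xor 1023 (one i))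

/-- `k n`, where the kernel evaluates `n` to a literal first. -/
def force {α : Type} (n : ℕ) (k : ℕ → α) : α := Nat.rec (k 0) (fun m _ => k (Nat.succ m)) n

/-- Replace the low 64 bits of `n` by a hash of the other bits. The kernel hashes literals by
their low bits, and this keeps them apart. -/
def mix (n : ℕ) : ℕ :=
  Nat.lor (Nat.shiftLeft (Nat.shiftRight n 64) 64)
    (Nat.mod (Nat.shiftRight n 64) 2305843009213693951)

/-- Conjunction of `f` over the ten vertices. -/
def all10 (f : ℕ → Bool) : Bool :=
  cond (f 0) (cond (f 1) (cond (f 2) (cond (f 3) (cond (f 4) (cond (f 5) (cond (f 6)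
    (cond (f 7) (cond (f 8) (f 9) false) false) false) false) false) false) false) false) false

/-- At most one bit of `m` is set. -/
def subsingle (m : ℕ) : Bool := Nat.beq (Nat.land m (Nat.sub m 1)) 0

/-- The triangle `v, c, y` can be added to the partial surface `N` without
giving one of the edges `vy`, `cy` a third triangle, creating a 3-cycle in the link of `y`,
or using a forbidden triangle. -/
def good (bad N v c y : ℕ) : Bool :=
  cond (subsingle (nb N v y)) (cond (subsingle (nb N c y))
    (cond (Nat.beq (Nat.land (nb N y v) (nb N y c)) 0) (not (bit bad (idx v c y))) false) false)
    false

/-- Pass to the first vertex of `todo`, whose entries `(v, p, s)` are a vertex together with its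
neighbours in the link of `0`. -/
def nextVertex (ok : ℕ → Bool)
    (ih : List (ℕ × ℕ × ℕ) → ℕ → ℕ → ℕ → ℕ → ℕ → ℕ → Bool)
    (todo : List (ℕ × ℕ × ℕ)) (N : ℕ) : Bool :=
  match todo with
  | [] => ok N
  | (v, p, s) :: l => force (clear (clear (clear 1022 v) p) s) fun r => ih l v p 0 s r N

/-- One step of `search`, where `ih` performs the remaining steps. -/
def searchStep (ok : ℕ → Bool) (bad : ℕ)
    (ih : List (ℕ × ℕ × ℕ) → ℕ → ℕ → ℕ → ℕ → ℕ → ℕ → Bool)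
    (todo : List (ℕ × ℕ × ℕ)) (v start prev cur rem N : ℕ) : Bool :=
  force (clear (nb N v cur) prev) fun o =>
  cond (Nat.beq o 0)
    (cond (Nat.beq rem 0)
      (cond (good bad N v cur start)
        (force (mix (Nat.lor N (triMask v cur start))) fun N' => nextVertex ok ih todo N') true)
      (force (Nat.land rem (Nat.xor 1023 (nb N cur prev))) fun cand =>
        all10 fun y => cond (bit cand y)
          (cond (good bad N v cur y)
            (force (mix (Nat.lor N (triMask v cur y))) fun N' =>
              force (clear rem y) fun r => ih todo v start cur y r N') true) true))
    (force (Nat.log2 o) fun y =>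
      cond (bit rem y) (force (clear rem y) fun r => ih todo v start cur y r N)
        (cond (Nat.beq rem 0) (nextVertex ok ih todo N) true))

/-- Search for all surfaces containing the triangles `N` and no triangle of `bad`, and check that
they satisfy `ok`. The link of `v` is completed along the path from `start` over `prev` to `cur`,
where `rem` is the set of vertices not on this path, then the links of the vertices in `todo`.
The search takes at most `n` steps. -/
def search (ok : ℕ → Bool) (bad : ℕ) (n : ℕ) :
    List (ℕ × ℕ × ℕ) → ℕ → ℕ → ℕ → ℕ → ℕ → ℕ → Bool :=
  Nat.rec (fun _ _ _ _ _ _ _ => false) (fun _ ih => searchStep ok bad ih) n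

/-- The mask of a list of triangles. -/
def code (l : List (ℕ × ℕ × ℕ)) : ℕ :=
  List.rec 0 (fun t _ m => Nat.lor (triMask t.1 t.2.1 t.2.2) m) l

/-- Membership in a list of masks. -/
def memb (l : List ℕ) (N : ℕ) : Bool :=
  List.rec false (fun a _ b => cond (Nat.beq a N) true b) l

/-- The `i`-th decimal digit of `c`. -/
def digit (c i : ℕ) : ℕ := Nat.mod (Nat.div c (Nat.pow 10 i)) 10

/-- Renumber triangles by the map whose values are the digits of `c`. -/
def renumber (c : ℕ) (l : List (ℕ × ℕ × ℕ)) : List (ℕ × ℕ × ℕ) :=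
  l.map fun t => (digit c t.1, digit c t.2.1, digit c t.2.2)

/-- Triangle lists of the fourteen surfaces. -/
def surfaces : List (List (ℕ × ℕ × ℕ)) :=
  [[(0, 1, 2), (0, 1, 9), (0, 2, 3), (0, 3, 4), (0, 4, 5), (0, 5, 6), (0, 6, 7), (0, 7, 8), (0, 8,
  9), (1, 2, 4), (1, 3, 4), (1, 3, 6), (1, 5, 6), (1, 5, 8), (1, 7, 8), (1, 7, 9), (2, 3, 7), (2,
  4, 8), (2, 5, 7), (2, 5, 9), (2, 6, 8), (2, 6, 9), (3, 5, 8), (3, 5, 9), (3, 6, 8), (3, 7, 9),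
  (4, 5, 7), (4, 6, 7), (4, 6, 9), (4, 8, 9)], [(0, 1, 2), (0, 1, 9), (0, 2, 3), (0, 3, 4), (0, 4,
  5), (0, 5, 6), (0, 6, 7), (0, 7, 8), (0, 8, 9), (1, 2, 4), (1, 3, 4), (1, 3, 6), (1, 5, 6), (1,
  5, 8), (1, 7, 8), (1, 7, 9), (2, 3, 7), (2, 4, 8), (2, 5, 8), (2, 5, 9), (2, 6, 7), (2, 6, 9),
  (3, 5, 7), (3, 5, 9), (3, 6, 8), (3, 8, 9), (4, 5, 7), (4, 6, 8), (4, 6, 9), (4, 7, 9)], [(0, 1,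
  2), (0, 1, 9), (0, 2, 3), (0, 3, 4), (0, 4, 5), (0, 5, 6), (0, 6, 7), (0, 7, 8), (0, 8, 9), (1,
  2, 4), (1, 3, 4), (1, 3, 6), (1, 5, 7), (1, 5, 8), (1, 6, 8), (1, 7, 9), (2, 3, 8), (2, 4, 7),
  (2, 5, 6), (2, 5, 9), (2, 6, 8), (2, 7, 9), (3, 5, 7), (3, 5, 9), (3, 6, 9), (3, 7, 8), (4, 5,
  8), (4, 6, 7), (4, 6, 9), (4, 8, 9)], [(0, 1, 2), (0, 1, 9), (0, 2, 3), (0, 3, 4), (0, 4, 5), (0,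
  5, 6), (0, 6, 7), (0, 7, 8), (0, 8, 9), (1, 2, 4), (1, 3, 4), (1, 3, 6), (1, 5, 7), (1, 5, 8),
  (1, 6, 8), (1, 7, 9), (2, 3, 8), (2, 4, 7), (2, 5, 7), (2, 5, 9), (2, 6, 8), (2, 6, 9), (3, 5,
  6), (3, 5, 9), (3, 7, 8), (3, 7, 9), (4, 5, 8), (4, 6, 7), (4, 6, 9), (4, 8, 9)], [(0, 1, 2), (0,
  1, 9), (0, 2, 3), (0, 3, 4), (0, 4, 5), (0, 5, 6), (0, 6, 7), (0, 7, 8), (0, 8, 9), (1, 2, 4),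
  (1, 3, 4), (1, 3, 6), (1, 5, 7), (1, 5, 8), (1, 6, 8), (1, 7, 9), (2, 3, 8), (2, 4, 7), (2, 5,
  6), (2, 5, 7), (2, 6, 9), (2, 8, 9), (3, 5, 8), (3, 5, 9), (3, 6, 7), (3, 7, 9), (4, 5, 9), (4,
  6, 8), (4, 6, 9), (4, 7, 8)], [(0, 1, 2), (0, 1, 9), (0, 2, 3), (0, 3, 4), (0, 4, 5), (0, 5, 6),
  (0, 6, 7), (0, 7, 8), (0, 8, 9), (1, 2, 4), (1, 3, 4), (1, 3, 6), (1, 5, 7), (1, 5, 8), (1, 6,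
  8), (1, 7, 9), (2, 3, 8), (2, 4, 7), (2, 5, 6), (2, 5, 8), (2, 6, 9), (2, 7, 9), (3, 5, 7), (3,
  5, 9), (3, 6, 7), (3, 8, 9), (4, 5, 9), (4, 6, 8), (4, 6, 9), (4, 7, 8)], [(0, 1, 2), (0, 1, 9),
  (0, 2, 3), (0, 3, 4), (0, 4, 5), (0, 5, 6), (0, 6, 7), (0, 7, 8), (0, 8, 9), (1, 2, 4), (1, 3,
  4), (1, 3, 6), (1, 5, 7), (1, 5, 9), (1, 6, 8), (1, 7, 8), (2, 3, 7), (2, 4, 8), (2, 5, 6), (2,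
  5, 8), (2, 6, 9), (2, 7, 9), (3, 5, 7), (3, 5, 8), (3, 6, 9), (3, 8, 9), (4, 5, 9), (4, 6, 7),
  (4, 6, 8), (4, 7, 9)], [(0, 1, 2), (0, 1, 9), (0, 2, 3), (0, 3, 4), (0, 4, 5), (0, 5, 6), (0, 6,
  7), (0, 7, 8), (0, 8, 9), (1, 2, 4), (1, 3, 4), (1, 3, 7), (1, 5, 8), (1, 5, 9), (1, 6, 7), (1,
  6, 8), (2, 3, 8), (2, 4, 6), (2, 5, 7), (2, 5, 9), (2, 6, 9), (2, 7, 8), (3, 5, 6), (3, 5, 8),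
  (3, 6, 9), (3, 7, 9), (4, 5, 7), (4, 6, 8), (4, 7, 9), (4, 8, 9)], [(0, 1, 2), (0, 1, 9), (0, 2,
  3), (0, 3, 4), (0, 4, 5), (0, 5, 6), (0, 6, 7), (0, 7, 8), (0, 8, 9), (1, 2, 4), (1, 3, 7), (1,
  3, 8), (1, 4, 5), (1, 5, 7), (1, 6, 8), (1, 6, 9), (2, 3, 9), (2, 4, 7), (2, 5, 6), (2, 5, 8),
  (2, 6, 9), (2, 7, 8), (3, 4, 6), (3, 5, 8), (3, 5, 9), (3, 6, 7), (4, 6, 8), (4, 7, 9), (4, 8,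
  9), (5, 7, 9)], [(0, 1, 2), (0, 1, 9), (0, 2, 3), (0, 3, 4), (0, 4, 5), (0, 5, 6), (0, 6, 7), (0,
  7, 8), (0, 8, 9), (1, 2, 4), (1, 3, 7), (1, 3, 8), (1, 4, 5), (1, 5, 7), (1, 6, 8), (1, 6, 9),
  (2, 3, 6), (2, 4, 9), (2, 5, 6), (2, 5, 8), (2, 7, 8), (2, 7, 9), (3, 4, 7), (3, 5, 8), (3, 5,
  9), (3, 6, 9), (4, 6, 7), (4, 6, 8), (4, 8, 9), (5, 7, 9)], [(0, 1, 2), (0, 1, 9), (0, 2, 3), (0,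
  3, 4), (0, 4, 5), (0, 5, 6), (0, 6, 7), (0, 7, 8), (0, 8, 9), (1, 2, 4), (1, 3, 8), (1, 3, 9),
  (1, 4, 5), (1, 5, 7), (1, 6, 7), (1, 6, 8), (2, 3, 6), (2, 4, 8), (2, 5, 6), (2, 5, 9), (2, 7,
  8), (2, 7, 9), (3, 4, 7), (3, 5, 7), (3, 5, 8), (3, 6, 9), (4, 6, 8), (4, 6, 9), (4, 7, 9), (5,
  8, 9)], [(0, 1, 2), (0, 1, 9), (0, 2, 3), (0, 3, 4), (0, 4, 5), (0, 5, 6), (0, 6, 7), (0, 7, 8),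
  (0, 8, 9), (1, 2, 4), (1, 3, 6), (1, 3, 8), (1, 4, 5), (1, 5, 7), (1, 6, 9), (1, 7, 8), (2, 3,
  7), (2, 4, 9), (2, 5, 7), (2, 5, 8), (2, 6, 8), (2, 6, 9), (3, 4, 8), (3, 5, 6), (3, 5, 9), (3,
  7, 9), (4, 6, 7), (4, 6, 8), (4, 7, 9), (5, 8, 9)], [(0, 1, 2), (0, 1, 9), (0, 2, 3), (0, 3, 4),
  (0, 4, 5), (0, 5, 6), (0, 6, 7), (0, 7, 8), (0, 8, 9), (1, 2, 4), (1, 3, 7), (1, 3, 8), (1, 4,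
  6), (1, 5, 6), (1, 5, 8), (1, 7, 9), (2, 3, 6), (2, 4, 7), (2, 5, 8), (2, 5, 9), (2, 6, 9), (2,
  7, 8), (3, 4, 9), (3, 5, 7), (3, 5, 9), (3, 6, 8), (4, 5, 7), (4, 6, 8), (4, 8, 9), (6, 7, 9)],
  [(0, 1, 2), (0, 1, 9), (0, 2, 3), (0, 3, 4), (0, 4, 5), (0, 5, 6), (0, 6, 7), (0, 7, 8), (0, 8,
  9), (1, 2, 4), (1, 3, 5), (1, 3, 9), (1, 4, 6), (1, 5, 7), (1, 6, 8), (1, 7, 8), (2, 3, 6), (2,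
  4, 7), (2, 5, 8), (2, 5, 9), (2, 6, 8), (2, 7, 9), (3, 4, 8), (3, 5, 8), (3, 6, 7), (3, 7, 9),
  (4, 5, 7), (4, 6, 9), (4, 8, 9), (5, 6, 9)]]

/-- For each surface, vertex permutations (the image of `i` is the `i`-th decimal digit)
leading to the triangulations found by the search. -/
def renumberings : List (List ℕ) :=
  [[2345678910], [9876543210, 2345678910, 5678912340, 7695830142, 7859620413, 3219876540,
  1305897624, 7598641032, 418695723, 4209657831, 6543219870, 2496081357, 9172840635, 4608231957,
  5739024681, 6841035792, 3517092468, 9278136045, 7503981264, 1938260475, 479283165, 4628013579],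
  [9876543210, 9685734201, 5678912340, 5869721304, 8569720413, 2817956403, 2345678910, 9406273815,
  8260479315, 3709516248, 8912345670, 4907261538, 8217950364, 4926083517, 4801627359, 5270964138,
  3950742816, 2794061385, 2608495137, 5830146972], [9876543210, 7698503124, 9685734201, 7569820413,
  5678912340, 7856902431, 7596814023, 5869721304, 7958641032, 7985630142, 4209683751, 148695732,
  2345678910, 8912345670, 2649071358, 9270584136, 6352491807, 5709316248, 1289305764, 7891234560,
  4028651973, 9728136045, 2794063185, 2907461538, 4926085317, 9217850364, 5730149682, 8160473925,
  2490716358, 7052984316, 749283156, 472938165, 694251387, 1932806457, 826473519, 3510827469,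
  5039762184, 3058126794, 4608295137, 5973014682], [9876543210, 7965830142, 9685734201, 8957641032,
  5678912340, 7589620413, 8657902431, 6897503124, 6597814023, 5869721304, 1279863054, 2198765430,
  2960417385, 1864029573, 4256380179, 2345678910, 9024637851, 962435178, 3564209781, 6204815973,
  5907316248, 395768412, 8642097351, 2470936158, 1823950746, 3057961284, 472918365, 1879204653,
  4068172395, 2709461538, 8729136045, 148675932, 8293154607, 3579024861, 9740285163, 826453719,
  5390741628, 7182943506, 6081394527, 3801572649], [9876543210, 8965730142, 6589720413, 8597614023,
  9685734201, 6957841032, 5678912340, 6897503124, 5869721304, 8657902431, 1729836045, 2960417385,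
  2817956403, 1684029573, 3256480179, 2345678910, 9024638751, 3564209781, 692435187, 1287950364,
  4927053816, 6820471593, 3907516248, 4709261538, 146879532, 1086472359, 713546298, 1879204653,
  6902483751, 2831947056, 8204615973, 5390741628, 7294068315, 3759024861, 3057962184, 8064259137,
  7182943506, 935768421, 9823150746, 5801372649], [9876543210, 5879621304, 8597641032, 9675834201,
  6957814023, 7192843506, 9426083517, 2795038614, 5264317098, 8240639715, 9350741826, 2831974065,
  1460852937, 7420936851, 6204958713, 2604839175, 8530147962, 3219876540, 2648015739, 8315072496],
  [9876543210, 5678912340, 6543219870, 7593014862, 4628017359, 9274063815, 7891234560, 6841039572],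
  [9876543210, 7654321980, 5319480627, 2463785901, 4567891230, 6812730594], [9876543210,
  2463785901, 7928341506], [9876543210, 4069382715, 7968305124, 4028596173, 6420957831, 2465783901,
  9782163054, 3576894102, 7569841032, 1987654320, 1354672809, 5798126304, 2439158067, 7093625148,
  7920486513, 4652371089, 9281507346, 1328947056], [9876543210, 2534806197, 9687305124, 1350748296,
  6538017429, 5683014792, 4680172539, 2709513468, 5427096318, 5896127304, 6420938571, 7891234560,
  1608492357, 714829356, 4685739021, 2971836045, 8406279135, 5796841032, 825931467, 3725480169,
  963857421, 693718245, 3182947056, 4952380617, 6274510839, 4061398275, 7094632518, 1037965842,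
  9402618753, 7530149682, 4293158067, 3219876540, 8912345670, 2871659403, 4785916203, 6917238405],
  [9876543210, 4321987650, 9315462708, 8294351607, 4928350716, 3817240695, 7462315908, 2345678910,
  5139460827, 3758420961, 6543219870, 8659741032], [9876543210, 1987654320, 6543219870, 3219876540,
  947683521, 274538691]]

/-- Evaluate the codes of the renumberings of `l` by `cs`, put them in front of `acc`. -/
def withCodes (l : List (ℕ × ℕ × ℕ)) (cs : List ℕ) (acc : List ℕ) (k : List ℕ → Bool) : Bool :=
  List.rec (fun acc => k acc)
    (fun c _ ih acc => force (mix (code (renumber c l))) fun N => ih (N :: acc)) cs acc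

/-- Evaluate the codes of all renumberings of a list of surfaces. -/
def withTable (ls : List (List (ℕ × ℕ × ℕ) × List ℕ)) (acc : List ℕ) (k : List ℕ → Bool) : Bool :=
  List.rec (fun acc => k acc)
    (fun t _ ih acc => withCodes t.1 t.2 acc ih) ls acc

/-- The vertices in the order of the search, with their neighbours in the link of `0`. -/
def order : List (ℕ × ℕ × ℕ) :=
  [(1, 9, 2), (7, 6, 8), (4, 3, 5), (3, 2, 4), (2, 1, 3), (5, 4, 6), (6, 5, 7), (8, 7, 9),
    (9, 8, 1)]

/-- The triangles around `0`. -/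
def wheel : List (ℕ × ℕ × ℕ) :=
  [(0, 1, 2), (0, 2, 3), (0, 3, 4), (0, 4, 5), (0, 5, 6), (0, 6, 7), (0, 7, 8), (0, 8, 9),
    (0, 9, 1)]

/-- The triangles `{i, i + 1, i + 3}` and `{i, i + 1, i - 2}` on the cycle `1, ..., 9`. -/
def skew : List (ℕ × ℕ × ℕ) :=
  [(1, 2, 4), (2, 3, 5), (3, 4, 6), (4, 5, 7), (5, 6, 8), (6, 7, 9), (7, 8, 1), (8, 9, 2),
    (9, 1, 3), (2, 1, 8), (3, 2, 9), (4, 3, 1), (5, 4, 2), (6, 5, 3), (7, 6, 4), (8, 7, 5),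
    (9, 8, 6), (1, 9, 7)]

/-- Search for all surfaces containing the triangles `l` and check that they belong to `tbl`. -/
def searchFrom (tbl : List ℕ) (bad : ℕ) (l : List (ℕ × ℕ × ℕ)) : Bool :=
  force bad fun bad => force (mix (code l)) fun N =>
    nextVertex (memb tbl) (search (memb tbl) bad 90) order N

/-- Exactly two bits of `m` are set. -/
def pair (m : ℕ) : Bool :=
  force (Nat.log2 m) fun x => force (Nat.log2 (Nat.xor m (one x))) fun y =>
    cond (Nat.beq x y) false (Nat.beq m (Nat.xor (one x) (one y)))

/-- Add to the set `R` the neighbours of its elements in the link of `v`. -/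
def grow (N v R : ℕ) : ℕ :=
  Nat.rec R (fun i S => cond (bit R i) (Nat.lor S (nb N v i)) S) 10

/-- The link of `v` is connected. -/
def linkConnected (N v : ℕ) : Bool :=
  force (grow N v (grow N v (grow N v (grow N v (one (cond (Nat.beq v 0) 1 0))))))
    fun R => all10 fun a => cond (Nat.beq a v) true (bit R a)

/-- The mask `N` is a neighborly triangulated surface with ten vertices. -/
def isSurface (N : ℕ) : Bool :=
  all10 fun a => cond (linkConnected N a) (all10 fun b =>
    cond (Nat.beq a b) (Nat.beq (nb N a b) 0) (cond (pair (nb N a b))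
      (all10 fun c => cond (bit N (idx a b c)) (cond (bit N (idx b a c)) (bit N (idx a c b)) false)
        true) false)) false

theorem isSurface_surfaces :
    surfaces.all (fun l => force (mix (code l)) isSurface) = true := by
  decide +kernel

theorem digit_renumberings :
    renumberings.all (fun cs => cs.all fun c =>
      (List.range 10).all fun b => (List.range 10).any fun a => Nat.beq (digit c a) b) = true := by
  decide +kernel

theorem digits_surfaces :
    surfaces.all (fun l => l.all fun t =>
      t.1.blt 10 && t.2.1.blt 10 && t.2.2.blt 10) = true := by
  decide +kernel

end TenVertex

namespace TenVertex

theorem idx_eq (a b c : ℕ) : idx a b c = 64 + (10 * (10 * a + b) + c) := rfl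

theorem idx_inj (a b c x y z : Fin 10) : idx a b c = idx x y z ↔ a = x ∧ b = y ∧ c = z := by
  simp only [idx_eq]
  omega

theorem beq_iff {m n : ℕ} : Nat.beq m n = true ↔ m = n :=
  ⟨Nat.eq_of_beq_eq_true, fun h => h ▸ Nat.beq_refl m⟩

theorem bit_eq (m i : ℕ) : bit m i = m.testBit i := by
  change Nat.beq ((m >>> i) &&& 1) 1 = ((1 &&& (m >>> i)) != 0)
  rw [Nat.and_comm, Nat.one_and_eq_mod_two]
  rcases Nat.mod_two_eq_zero_or_one (m >>> i) with h | h <;> rw [h] <;> rfl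

theorem testBit_one (i j : ℕ) : (one i).testBit j = decide (i = j) := by
  change (1 <<< i).testBit j = _
  rw [Nat.one_shiftLeft, Nat.testBit_two_pow]

theorem testBit_lt {m j : ℕ} (hm : m < 1024) (h : m.testBit j = true) : j < 10 := by
  by_contra hj
  have : m < 2 ^ j := hm.trans_le (Nat.pow_le_pow_right (n := 2) (by norm_num) (not_lt.1 hj))
  rw [Nat.testBit_lt_two_pow this] at h
  exact absurd h (by decide)

theorem testBit_1023 (j : ℕ) : (1023).testBit j = decide (j < 10) :=
  Nat.testBit_two_pow_sub_one 10 j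

theorem testBit_nb (N a b c : ℕ) :
    (nb N a b).testBit c = (decide (c < 10) && N.testBit (idx a b c)) := by
  change ((N >>> idx a b 0) &&& 1023).testBit c = _
  rw [Nat.testBit_and, Nat.testBit_shiftRight, testBit_1023, Bool.and_comm]
  simp [idx_eq, add_assoc]

theorem nb_lt (N a b : ℕ) : nb N a b < 1024 :=
  Nat.lt_succ_of_le Nat.and_le_right

theorem testBit_clear (m : ℕ) (i : Fin 10) (j : ℕ) :
    (clear m i).testBit j = true ↔ m.testBit j = true ∧ j < 10 ∧ j ≠ i := by
  change (m &&& (1023 ^^^ one i)).testBit j = true ↔ _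
  rw [Nat.testBit_and, Nat.testBit_xor, testBit_1023, testBit_one]
  have hi := i.isLt
  by_cases hji : j = i
  · simp [hji]
  · simp [hji, Ne.symm hji]

theorem testBit_mix (n i : ℕ) (hi : 64 ≤ i) : (mix n).testBit i = n.testBit i := by
  change (((n >>> 64) <<< 64) ||| ((n >>> 64) % 2305843009213693951)).testBit i = _
  have h : (n >>> 64) % 2305843009213693951 < 2 ^ i :=
    (Nat.mod_lt _ (by norm_num)).trans_le
      ((show 2305843009213693951 ≤ 2 ^ 64 by norm_num).trans
        (Nat.pow_le_pow_right (by norm_num) hi))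
  rw [Nat.testBit_or, Nat.testBit_lt_two_pow h, Nat.testBit_shiftLeft, Nat.testBit_shiftRight,
    Nat.add_sub_cancel' hi]
  simp [hi]

theorem force_eq {α : Type} (n : ℕ) (k : ℕ → α) : force n k = k n := by
  cases n <;> rfl

theorem all10_eq (f : ℕ → Bool) : all10 f = true ↔ ∀ i : Fin 10, f i = true := by
  simp only [Fin.forall_fin_succ, all10, cond_eq_ite]
  simp

theorem subsingle_eq_false {m : ℕ} (hm : m < 1024) (h : subsingle m = false) :
    ∃ p q : Fin 10, p ≠ q ∧ m.testBit p = true ∧ m.testBit q = true := by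
  have h0 : m &&& (m - 1) ≠ 0 := Nat.ne_of_beq_eq_false h
  obtain ⟨q, hq⟩ := Nat.exists_testBit_of_ne_zero h0
  rw [Nat.testBit_and, Bool.and_eq_true] at hq
  by_contra hne
  have hm2 : m = 2 ^ q := by
    refine Nat.eq_of_testBit_eq fun p => ?_
    rw [Nat.testBit_two_pow, Bool.eq_iff_iff, decide_eq_true_eq]
    refine ⟨fun hp => ?_, fun hp => hp ▸ hq.1⟩
    by_contra hqp
    exact hne ⟨⟨p, testBit_lt hm hp⟩, ⟨q, testBit_lt hm hq.1⟩,
      fun he => hqp (Fin.mk.inj_iff.1 he).symm, hp, hq.1⟩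
  have := hq.2
  rw [hm2, Nat.testBit_two_pow_sub_one] at this
  simp at this

theorem pair_eq_true {m : ℕ} (hm : m < 1024) (h : pair m = true) :
    ∃ x y : Fin 10, x ≠ y ∧ ∀ z : Fin 10, m.testBit z = true ↔ z = x ∨ z = y := by
  simp only [pair, force_eq] at h
  generalize Nat.log2 m = x at h
  generalize Nat.log2 _ = y at h
  have hxy : x ≠ y := fun he => by simp [he] at h
  have hbit : ∀ z, m.testBit z = true ↔ z = x ∨ z = y := by
    intro z
    have heq : m = one x ^^^ one y := Nat.eq_of_beq_eq_true (by
      rcases hb : Nat.beq x y <;> rw [hb] at h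
      · exact h
      · exact absurd h Bool.false_ne_true)
    rw [heq, Nat.testBit_xor, testBit_one, testBit_one]
    by_cases h1 : z = x
    · simp [h1, hxy.symm]
    · simp [h1, Ne.symm h1, eq_comm (a := y)]
  exact ⟨⟨x, testBit_lt hm ((hbit x).2 (Or.inl rfl))⟩, ⟨y, testBit_lt hm ((hbit y).2 (Or.inr rfl))⟩,
    fun he => hxy (Fin.mk.inj_iff.1 he), fun z => by simp [hbit, Fin.ext_iff]⟩

/-- The triple `(a, b, c)` belongs to the mask `N`. -/
def Has (N : ℕ) (a b c : Fin 10) : Prop := N.testBit (idx a b c) = true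

theorem has_mix {N : ℕ} {a b c : Fin 10} : Has (mix N) a b c ↔ Has N a b c := by
  rw [Has, testBit_mix _ _ (by rw [idx_eq]; omega), Has]

theorem has_lor {N M : ℕ} {a b c : Fin 10} :
    Has (Nat.lor N M) a b c ↔ Has N a b c ∨ Has M a b c := by
  change (N ||| M).testBit _ = true ↔ _
  rw [Nat.testBit_or, Bool.or_eq_true]
  rfl

theorem has_one {x y z a b c : Fin 10} :
    Has (one (idx x y z)) a b c ↔ a = x ∧ b = y ∧ c = z := by
  rw [Has, testBit_one, decide_eq_true_eq, idx_inj]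
  grind

theorem has_triMask {x y z a b c : Fin 10} : Has (triMask x y z) a b c ↔
    (a = x ∧ b = y ∧ c = z) ∨ (a = x ∧ b = z ∧ c = y) ∨ (a = y ∧ b = x ∧ c = z) ∨
    (a = y ∧ b = z ∧ c = x) ∨ (a = z ∧ b = x ∧ c = y) ∨ (a = z ∧ b = y ∧ c = x) := by
  simp only [triMask, has_lor, has_one, or_assoc]

theorem testBit_nb_fin {N : ℕ} {a b c : Fin 10} :
    (nb N a b).testBit c = true ↔ Has N a b c := by
  simp [testBit_nb, Has]

/-- The mask `N` is symmetric and contained in the surface `Q`. -/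
structure Sub (N : ℕ) (Q : Fin 10 → Fin 10 → Fin 10 → Prop) : Prop where
  le : ∀ {a b c}, Has N a b c → Q a b c
  swap_left : ∀ {a b c}, Has N a b c → Has N b a c
  swap_right : ∀ {a b c}, Has N a b c → Has N a c b

variable {Q : Fin 10 → Fin 10 → Fin 10 → Prop}

theorem Sub.mix {N : ℕ} (h : Sub N Q) : Sub (mix N) Q := by
  constructor <;> intro a b c <;> simp only [has_mix]
  exacts [h.le, h.swap_left, h.swap_right]

theorem Sub.lor {N M : ℕ} (h : Sub N Q) (h' : Sub M Q) : Sub (Nat.lor N M) Q := by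
  constructor <;> intro a b c <;> simp only [has_lor]
  exacts [Or.rec h.le h'.le, Or.imp h.swap_left h'.swap_left, Or.imp h.swap_right h'.swap_right]

theorem sub_triMask {x y z : Fin 10} (hQ : IsK10 Q) (h : Q x y z) : Sub (triMask x y z) Q := by
  constructor <;> intro a b c <;> simp only [has_triMask]
  · have h1 := hQ.swap_left h
    have h2 := hQ.swap_right h
    have h3 := hQ.rotate h
    have h4 := hQ.rotate h3
    have h5 := hQ.swap_left h3
    grind
  all_goals grind

theorem sub_code (hQ : IsK10 Q) : ∀ (l : List (ℕ × ℕ × ℕ)),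
    (∀ t ∈ l, ∃ x y z : Fin 10, t = (x.val, y.val, z.val) ∧ Q x y z) → Sub (code l) Q
  | [], _ => by
    constructor <;> intro a b c h <;> exact absurd h (by simp [code, Has])
  | t :: l, h => by
    obtain ⟨x, y, z, rfl, hxyz⟩ := h t (by simp)
    exact (sub_triMask hQ hxyz).lor (sub_code hQ l fun t ht => h t (by simp [ht]))

theorem has_code {x y z : Fin 10} {l : List (ℕ × ℕ × ℕ)} (h : (x.val, y.val, z.val) ∈ l) :
    Has (code l) x y z := by
  induction l with
  | nil => exact absurd h (by simp)
  | cons t l ih =>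
    change Has (Nat.lor (triMask t.1 t.2.1 t.2.2) (code l)) x y z
    rw [has_lor]
    rcases List.mem_cons.1 h with h | h
    · rw [← h]
      exact Or.inl (has_triMask.2 (Or.inl ⟨rfl, rfl, rfl⟩))
    · exact Or.inr (ih h)

theorem exists_of_has_code {a b c : Fin 10} {l : List (ℕ × ℕ × ℕ)}
    (hl : ∀ t ∈ l, t.1 < 10 ∧ t.2.1 < 10 ∧ t.2.2 < 10) (h : Has (code l) a b c) :
    ∃ x y z : Fin 10, (x.val, y.val, z.val) ∈ l ∧ Has (triMask x y z) a b c := by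
  induction l with
  | nil => exact absurd h (by simp [code, Has])
  | cons t l ih =>
    change Has (Nat.lor (triMask t.1 t.2.1 t.2.2) (code l)) a b c at h
    rw [has_lor] at h
    rcases h with h | h
    · obtain ⟨h1, h2, h3⟩ := hl t (by simp)
      exact ⟨⟨_, h1⟩, ⟨_, h2⟩, ⟨_, h3⟩, by simp, h⟩
    · obtain ⟨x, y, z, hm, hh⟩ := ih (fun t ht => hl t (by simp [ht])) h
      exact ⟨x, y, z, by simp [hm], hh⟩

end TenVertex

namespace TenVertex

variable {Q : Fin 10 → Fin 10 → Fin 10 → Prop} {ok : ℕ → Bool} {bad N : ℕ}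

/-- Every `(v, p, s)` in the list consists of a vertex and its neighbours in the link of `0`. -/
def IsTodo (Q : Fin 10 → Fin 10 → Fin 10 → Prop) (todo : List (ℕ × ℕ × ℕ)) : Prop :=
  ∀ t ∈ todo, ∃ v p s : Fin 10, t = (v.val, p.val, s.val) ∧ Q v p 0 ∧ Q v 0 s ∧ p ≠ s

/-- The mask `rem` consists of the vertices of the link cycle `w` after the vertex `w n`. -/
def IsRest (w : ℕ → Fin 10) (n rem : ℕ) : Prop :=
  ∀ z, rem.testBit z = true ↔ ∃ j, n < j ∧ j < 9 ∧ (w j : ℕ) = z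

/-- If the search procedure `f` succeeds on a partial surface contained in `Q`, then `Q` contains
a mask satisfying `ok`. -/
def IsSound (Q : Fin 10 → Fin 10 → Fin 10 → Prop) (ok : ℕ → Bool)
    (f : List (ℕ × ℕ × ℕ) → ℕ → ℕ → ℕ → ℕ → ℕ → ℕ → Bool) : Prop :=
  ∀ todo v w m rem N, IsLinkCycle Q v w → 1 ≤ m → m ≤ 7 → IsRest w (m + 1) rem →
    IsTodo Q todo → Sub N Q → f todo v (w 0) (w m) (w (m + 1)) rem N = true →
    ∃ N', ok N' = true ∧ Sub N' Q

theorem nextVertex_sound {f : List (ℕ × ℕ × ℕ) → ℕ → ℕ → ℕ → ℕ → ℕ → ℕ → Bool}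
    (hQ : IsK10 Q) (hf : IsSound Q ok f) {todo : List (ℕ × ℕ × ℕ)} (htodo : IsTodo Q todo)
    (hN : Sub N Q) (h : nextVertex ok f todo N = true) : ∃ N', ok N' = true ∧ Sub N' Q := by
  match todo, htodo, h with
  | [], _, h => exact ⟨N, h, hN⟩
  | t :: l, htodo, h =>
    obtain ⟨v, p, s, rfl, hp, hs, hps⟩ := htodo t (by simp)
    obtain ⟨w, h0, h1, hw⟩ := hQ.exists_isLinkCycle hp
    have h2 : s = w 2 := by
      rw [← h1] at hs
      rcases hw.eq_or_eq hQ hs with hh | hh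
      · exact absurd (hh.trans h0).symm hps
      · exact hh
    simp only [nextVertex, force_eq] at h
    refine hf l v w 1 _ N hw le_rfl (by norm_num) ?_ (fun t ht => htodo t (by simp [ht])) hN
      (by rw [h0, h1, ← h2]; exact h)
    have hv : ∀ j, w j ≠ v := fun j => (hQ.ne (hw.rel j)).symm
    have h1022 : 1022 = clear 1023 (0 : Fin 10) := rfl
    intro z
    rw [h1022]
    simp only [testBit_clear, testBit_1023, decide_eq_true_eq]
    constructor
    · rintro ⟨⟨⟨⟨hz, -, hz0⟩, -, hzv⟩, -, hzp⟩, -, hzs⟩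
      obtain ⟨j, hj, hjz⟩ := hw.surj ⟨z, hz⟩ (fun he => hzv (congrArg Fin.val he))
      have hjz' : (w j : ℕ) = z := congrArg Fin.val hjz
      refine ⟨j, ?_, hj, hjz'⟩
      by_contra hlt
      have : j = 0 ∨ j = 1 ∨ j = 2 := by omega
      rcases this with rfl | rfl | rfl
      · exact hzp (by rw [← hjz', h0])
      · exact hz0 (by rw [← hjz', h1])
      · exact hzs (by rw [← hjz', h2])
    · rintro ⟨j, hj, hj9, rfl⟩
      have hne : ∀ i < 3, (w j : ℕ) ≠ w i := fun i hi he => by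
        have := hw.inj j hj9 i (by omega) (Fin.ext he)
        omega
      have e0 := hne 0 (by norm_num)
      have e1 := hne 1 (by norm_num)
      have e2 := hne 2 (by norm_num)
      rw [h0] at e0
      rw [h1] at e1
      rw [← h2] at e2
      have ev := fun he => hv j (Fin.ext he)
      have := (w j).isLt
      exact ⟨⟨⟨⟨this, this, e1⟩, this, ev⟩, this, e0⟩, this, e2⟩

theorem good_eq_true (hQ : IsK10 Q) (hbad : ∀ a b c, Has bad a b c → ¬ Q a b c) (hN : Sub N Q)
    {v c y : Fin 10} (hy : Q v c y) (hNy : ¬ Has N v c y) : good bad N v c y = true := by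
  have h1 : subsingle (nb N v y) = true := by
    by_contra hs
    obtain ⟨p, q, hpq, hp, hq⟩ := subsingle_eq_false (nb_lt _ _ _) (Bool.eq_false_of_not_eq_true hs)
    rw [testBit_nb_fin] at hp hq
    rcases hQ.eq_or_eq (hN.le hp) (hN.le hq) hpq (hQ.swap_right hy) with rfl | rfl
    · exact hNy (hN.swap_right hp)
    · exact hNy (hN.swap_right hq)
  have h2 : subsingle (nb N c y) = true := by
    by_contra hs
    obtain ⟨p, q, hpq, hp, hq⟩ := subsingle_eq_false (nb_lt _ _ _) (Bool.eq_false_of_not_eq_true hs)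
    rw [testBit_nb_fin] at hp hq
    rcases hQ.eq_or_eq (hN.le hp) (hN.le hq) hpq (hQ.rotate hy) with rfl | rfl
    · exact hNy (hN.swap_left (hN.swap_right hp))
    · exact hNy (hN.swap_left (hN.swap_right hq))
  have h3 : Nat.beq (Nat.land (nb N y v) (nb N y c)) 0 = true := by
    rw [beq_iff]
    by_contra hne
    obtain ⟨z, hz⟩ := Nat.exists_testBit_of_ne_zero hne
    rw [show Nat.land (nb N y v) (nb N y c) = nb N y v &&& nb N y c from rfl, Nat.testBit_and,
      Bool.and_eq_true] at hz
    have hz10 := testBit_lt (nb_lt _ _ _) hz.1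
    lift z to Fin 10 using hz10
    rw [testBit_nb_fin, testBit_nb_fin] at hz
    exact hQ.not_link_triangle (hQ.rotate (hQ.rotate hy)) (hN.le hz.2) (hN.le hz.1)
  have h4 : bit bad (idx v c y) = false := by
    rw [bit_eq, Bool.eq_false_iff]
    exact fun hh => hbad v c y hh hy
  rw [good, h1, h2, h3, h4]
  rfl

theorem searchStep_sound {f : List (ℕ × ℕ × ℕ) → ℕ → ℕ → ℕ → ℕ → ℕ → ℕ → Bool} (hQ : IsK10 Q)
    (hbad : ∀ a b c, Has bad a b c → ¬ Q a b c) (hf : IsSound Q ok f) :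
    IsSound Q ok (searchStep ok bad f) := by
  intro todo v w m rem N hw hm1 hm7 hrem htodo hN h
  simp only [searchStep, force_eq] at h
  have hstep : Q v (w (m + 1)) (w (m + 2)) := hw.rel (m + 1)
  have hrem0 : Nat.beq rem 0 = true ↔ m = 7 := by
    rw [beq_iff]
    refine ⟨fun h0 => ?_, ?_⟩
    · by_contra hne
      have := (hrem (w (m + 2))).2 ⟨m + 2, by omega, by omega, rfl⟩
      rw [h0, Nat.zero_testBit] at this
      exact absurd this (by decide)
    · rintro rfl
      by_contra hne
      obtain ⟨z, hz⟩ := Nat.exists_testBit_of_ne_zero hne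
      obtain ⟨j, hj, hj9, -⟩ := (hrem z).1 hz
      omega
  have hrest : IsRest w (m + 2) (clear rem (w (m + 2))) := by
    intro z
    rw [testBit_clear, hrem]
    constructor
    · rintro ⟨⟨j, hj, hj9, rfl⟩, -, hne⟩
      refine ⟨j, ?_, hj9, rfl⟩
      by_contra hlt
      have : j = m + 2 := by omega
      exact hne (by rw [this])
    · rintro ⟨j, hj, hj9, rfl⟩
      refine ⟨⟨j, by omega, hj9, rfl⟩, (w j).isLt, fun he => ?_⟩
      have := hw.inj j hj9 (m + 2) (by omega) (Fin.ext he)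
      omega
  rcases hbo : Nat.beq (clear (nb N v (w (m + 1))) (w m)) 0
  · rw [hbo, cond_false] at h
    have hne := Nat.ne_of_beq_eq_false hbo
    set o := clear (nb N v (w (m + 1))) (w m) with ho
    have hbit : o.testBit (Nat.log2 o) = true := Nat.testBit_log2 hne
    rw [ho, testBit_clear, ← ho] at hbit
    have hy : Nat.log2 o = w (m + 2) := by
      obtain ⟨hb, hlt, hn⟩ := hbit
      generalize Nat.log2 o = y at hb hlt hn
      lift y to Fin 10 using hlt
      rw [testBit_nb_fin] at hb
      rcases hw.eq_or_eq hQ (hN.le hb) with hh | hh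
      · exact absurd (congrArg Fin.val hh) hn
      · exact congrArg Fin.val hh
    rw [hy] at h
    by_cases hm : m = 7
    · have hb : bit rem (w (m + 2)) = false := by
        rw [bit_eq, Nat.eq_of_beq_eq_true (hrem0.2 hm), Nat.zero_testBit]
      rw [hb, hrem0.2 hm] at h
      exact nextVertex_sound hQ hf htodo hN h
    · have hb : bit rem (w (m + 2)) = true := by
        rw [bit_eq, hrem]
        exact ⟨m + 2, by omega, by omega, rfl⟩
      rw [hb] at h
      exact hf todo v w (m + 1) _ N hw (by omega) (by omega) hrest htodo hN h
  · rw [hbo, cond_true] at h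
    have hnot : ¬ Has N v (w (m + 1)) (w (m + 2)) := by
      intro hh
      have : (clear (nb N v (w (m + 1))) (w m)).testBit (w (m + 2)) = true := by
        rw [testBit_clear, testBit_nb_fin]
        exact ⟨hh, (w (m + 2)).isLt, fun he => hw.ne m (Fin.ext he).symm⟩
      rw [Nat.eq_of_beq_eq_true hbo, Nat.zero_testBit] at this
      exact absurd this (by decide)
    have hgood := good_eq_true hQ hbad hN hstep hnot
    have hN' := (hN.lor (sub_triMask hQ hstep)).mix
    by_cases hm : m = 7
    · rw [hrem0.2 hm, cond_true] at h
      have h9 : w (m + 2) = w 0 := by rw [hm, hw.nine]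
      rw [h9] at hgood hN'
      rw [hgood, cond_true] at h
      exact nextVertex_sound hQ hf htodo hN' h
    · rw [Bool.eq_false_of_not_eq_true (fun hh => hm (hrem0.1 hh)), cond_false, all10_eq] at h
      have hy := h (w (m + 2))
      have hcand : bit (Nat.land rem (Nat.xor 1023 (nb N (w (m + 1)) (w m)))) (w (m + 2))
          = true := by
        change bit (rem &&& (1023 ^^^ nb N (w (m + 1)) (w m))) _ = true
        rw [bit_eq, Nat.testBit_and, Nat.testBit_xor, testBit_1023,
          (hrem _).2 ⟨m + 2, by omega, by omega, rfl⟩]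
        have : (nb N (w (m + 1)) (w m)).testBit (w (m + 2)) = false := by
          rw [Bool.eq_false_iff, Ne, testBit_nb_fin]
          intro hh
          exact hQ.not_link_triangle (hQ.swap_left hstep)
            (hQ.swap_right (hN.le hh)) (hQ.rotate (hQ.rotate (hw.rel m)))
        rw [this]
        simp
      rw [hcand, hgood, cond_true, cond_true] at hy
      exact hf todo v w (m + 1) _ _ hw (by omega) (by omega) hrest htodo hN' hy

theorem search_sound (hQ : IsK10 Q) (hbad : ∀ a b c, Has bad a b c → ¬ Q a b c) (n : ℕ) :
    IsSound Q ok (search ok bad n) := by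
  induction n with
  | zero => exact fun _ _ _ _ _ _ _ _ _ _ _ _ h => absurd h (by simp [search])
  | succ n ih => exact searchStep_sound hQ hbad ih

end TenVertex

namespace TenVertex

theorem grow_sound {N : ℕ} {v a : Fin 10} {R : ℕ}
    (hR : ∀ j, R.testBit j = true → ∃ x : Fin 10, j = x ∧ Relation.ReflTransGen (Has N v) a x) :
    ∀ j, (grow N v R).testBit j = true →
      ∃ x : Fin 10, j = x ∧ Relation.ReflTransGen (Has N v) a x := by
  suffices ∀ n : ℕ, ∀ j,
      (Nat.rec R (fun i S => cond (bit R i) (Nat.lor S (nb N v i)) S) n : ℕ).testBit j = true →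
        ∃ x : Fin 10, j = x ∧ Relation.ReflTransGen (Has N v) a x from this 10
  intro n
  induction n with
  | zero => exact hR
  | succ n ih =>
    intro j hj
    dsimp only at hj
    rcases hb : bit R n
    · rw [hb] at hj
      exact ih j hj
    · rw [hb, cond_true] at hj
      change (_ ||| _ : ℕ).testBit j = true at hj
      rw [Nat.testBit_or, Bool.or_eq_true] at hj
      rcases hj with hj | hj
      · exact ih j hj
      · rw [bit_eq] at hb
        obtain ⟨x, rfl, hx⟩ := hR n hb
        have hj10 := testBit_lt (nb_lt _ _ _) hj
        lift j to Fin 10 using hj10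
        rw [testBit_nb_fin] at hj
        exact ⟨j, rfl, hx.tail hj⟩

theorem isK10_of_isSurface {N : ℕ} (h : isSurface N = true) : IsK10 (Has N) := by
  simp only [isSurface, all10_eq, cond_eq_ite, Bool.if_false_right, Bool.and_eq_true,
    decide_eq_true_eq] at h
  have hne : ∀ {a b c}, Has N a b c → a ≠ b := by
    rintro a b c hh rfl
    have := (h a).2 a
    rw [if_pos (Nat.beq_refl _)] at this
    rw [← testBit_nb_fin, beq_iff.1 this, Nat.zero_testBit] at hh
    exact absurd hh (by decide)
  have hbeq : ∀ {a b : Fin 10}, a ≠ b → ¬ Nat.beq a b = true :=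
    fun hab he => hab (Fin.ext (beq_iff.1 he))
  have hsymm : ∀ {a b c}, Has N a b c → Has N b a c ∧ Has N a c b := by
    intro a b c hh
    have := (h a).2 b
    rw [if_neg (hbeq (hne hh)), Bool.and_eq_true, decide_eq_true_eq, all10_eq] at this
    have := this.2 c
    simp only [bit_eq] at this
    rw [if_pos (show N.testBit (idx a b c) = true from hh)] at this
    simpa [Has] using this
  refine ⟨fun hh => (hsymm hh).1, fun hh => (hsymm hh).2, hne, fun {a b} hab => ?_,
    fun {v a b} ha hb => ?_⟩
  · have := (h a).2 b
    rw [if_neg (hbeq hab), Bool.and_eq_true, decide_eq_true_eq] at this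
    simpa only [testBit_nb_fin] using pair_eq_true (nb_lt _ _ _) this.1
  · obtain ⟨s, hs⟩ : ∃ s : Fin 10, cond (Nat.beq v 0) 1 0 = (s : ℕ) := by
      cases Nat.beq v 0
      · exact ⟨0, rfl⟩
      · exact ⟨1, rfl⟩
    have hcon := (h v).1
    simp only [linkConnected, force_eq, all10_eq, hs] at hcon
    have hreach : ∀ c : Fin 10, c ≠ v → Relation.ReflTransGen (Has N v) s c := by
      intro c hc
      have := hcon c
      rw [Bool.eq_false_of_not_eq_true (hbeq hc), cond_false, bit_eq] at this
      have hone : ∀ j, (one s).testBit j = true →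
          ∃ x : Fin 10, j = x ∧ Relation.ReflTransGen (Has N v) s x := by
        intro j hj
        rw [testBit_one, decide_eq_true_eq] at hj
        exact ⟨s, hj.symm, Relation.ReflTransGen.refl⟩
      obtain ⟨x, hx, hr⟩ :=
        grow_sound (grow_sound (grow_sound (grow_sound hone))) _ this
      rwa [Fin.ext hx]
    have : Std.Symm (Has N v) := ⟨fun _ _ hh => (hsymm hh).2⟩
    exact ((Relation.ReflTransGen.stdSymm (r := Has N v)).symm _ _ (hreach a ha)).trans
      (hreach b hb)

/-- The sum of `f` over the ten vertices. -/
def sum10 (f : Fin 10 → ℕ) : ℕ :=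
  f ⟨0, by decide⟩ + f ⟨1, by decide⟩ + f ⟨2, by decide⟩ + f ⟨3, by decide⟩ + f ⟨4, by decide⟩ +
  f ⟨5, by decide⟩ + f ⟨6, by decide⟩ + f ⟨7, by decide⟩ + f ⟨8, by decide⟩ + f ⟨9, by decide⟩

/-- A weighted count of subconfigurations of a surface. -/
noncomputable def invariant (P : Fin 10 → Fin 10 → Fin 10 → Prop) : ℕ :=
  ∑ a, ∑ b, ∑ x, if P a b x then ∑ y, if P a b y then ∑ c, if P x y c then ∑ d,
    if P x y d then (if P a c d then 1 else 0) + (if P a x c then if P b c d then 200 else 0 else 0)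
    else 0 else 0 else 0 else 0

/-- Computable version of `invariant`. -/
def maskInvariant (N : ℕ) : ℕ :=
  sum10 fun a => sum10 fun b => sum10 fun x => cond (bit N (idx a b x)) (
  sum10 fun y => cond (bit N (idx a b y)) (
  sum10 fun c => cond (bit N (idx x y c)) (
  sum10 fun d => cond (bit N (idx x y d)) (
    cond (bit N (idx a c d)) 1 0 + cond (bit N (idx a x c)) (cond (bit N (idx b c d)) 200 0) 0)
    0) 0) 0) 0

theorem invariant_comp_perm (P : Fin 10 → Fin 10 → Fin 10 → Prop) (σ : Equiv.Perm (Fin 10)) :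
    invariant (fun a b c => P (σ a) (σ b) (σ c)) = invariant P := by
  refine Fintype.sum_equiv σ _ _ fun a => Fintype.sum_equiv σ _ _ fun b =>
    Fintype.sum_equiv σ _ _ fun x => if_congr Iff.rfl ?_ rfl
  refine Fintype.sum_equiv σ _ _ fun y => if_congr Iff.rfl ?_ rfl
  refine Fintype.sum_equiv σ _ _ fun c => if_congr Iff.rfl ?_ rfl
  exact Fintype.sum_equiv σ _ _ fun d => rfl

theorem sum10_eq (f : Fin 10 → ℕ) : sum10 f = ∑ i, f i := by
  simp only [Fin.sum_univ_succ, sum10]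
  simp [add_assoc]

theorem cond_bit (N : ℕ) (a b c : Fin 10) (m n : ℕ) :
    cond (bit N (idx a b c)) m n = if Has N a b c then m else n := by
  rw [bit_eq, cond_eq_ite]
  exact if_congr Iff.rfl rfl rfl

theorem invariant_has (N : ℕ) : invariant (Has N) = maskInvariant N := by
  simp only [invariant, maskInvariant, sum10_eq, cond_bit]

theorem maskInvariant_surfaces :
    surfaces.map (fun l => force (mix (code l)) maskInvariant) =
      [120, 2128, 2512, 2120, 3524, 2924, 1712, 5120, 2568, 168, 2544, 1536, 1368, 3744] := by
  decide +kernel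

end TenVertex

namespace TenVertex

theorem searchFrom_skew :
    withTable (List.zip surfaces renumberings) []
      (fun tbl => searchFrom tbl (code skew) wheel) = true := by
  decide +kernel

theorem searchFrom_one_two_four :
    withTable (List.zip surfaces renumberings) []
      (fun tbl => searchFrom tbl 0 ((1, 2, 4) :: wheel)) = true := by
  decide +kernel

theorem order_wheel :
    order.all (fun t => t.1.blt 10 && t.2.1.blt 10 && t.2.2.blt 10 &&
      bit (code wheel) (idx t.1 t.2.1 0) && bit (code wheel) (idx t.1 0 t.2.2) &&
      !Nat.beq t.2.1 t.2.2) = true := by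
  decide +kernel

theorem skew_wheel :
    skew.all (fun t => t.1.blt 10 && t.2.1.blt 10 && t.2.2.blt 10 &&
      (List.range 10).any fun c => bit (code wheel) (idx 0 t.1 t.2.1) &&
        bit (code wheel) (idx 0 t.2.1 c) && bit (code wheel) (idx 0 c t.2.2) &&
        !Nat.beq t.1 c) = true := by
  decide +kernel

theorem memb_eq_true {l : List ℕ} {N : ℕ} (h : memb l N = true) : N ∈ l := by
  induction l with
  | nil => exact absurd h Bool.false_ne_true
  | cons a l ih =>
    change cond (Nat.beq a N) true (memb l N) = true at h
    rcases hb : Nat.beq a N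
    · rw [hb] at h
      exact List.mem_cons_of_mem _ (ih h)
    · exact List.mem_cons.2 (Or.inl (beq_iff.1 hb).symm)

theorem withCodes_eq (l : List (ℕ × ℕ × ℕ)) (cs acc : List ℕ) (k : List ℕ → Bool) :
    ∃ tbl, withCodes l cs acc k = k tbl ∧
      ∀ N ∈ tbl, N ∈ acc ∨ ∃ c ∈ cs, N = mix (code (renumber c l)) := by
  induction cs generalizing acc with
  | nil => exact ⟨acc, rfl, fun N hN => Or.inl hN⟩
  | cons c cs ih =>
    obtain ⟨tbl, htbl, hmem⟩ := ih (mix (code (renumber c l)) :: acc)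
    refine ⟨tbl, (force_eq (mix (code (renumber c l))) fun N =>
      withCodes l cs (N :: acc) k).trans htbl, fun N hN => ?_⟩
    rcases hmem N hN with h | ⟨c', hc', rfl⟩
    · rcases List.mem_cons.1 h with rfl | h
      · exact Or.inr ⟨c, by simp, rfl⟩
      · exact Or.inl h
    · exact Or.inr ⟨c', by simp [hc'], rfl⟩

theorem withTable_eq (ls : List (List (ℕ × ℕ × ℕ) × List ℕ)) (acc : List ℕ)
    (k : List ℕ → Bool) :
    ∃ tbl, withTable ls acc k = k tbl ∧
      ∀ N ∈ tbl, N ∈ acc ∨ ∃ t ∈ ls, ∃ c ∈ t.2, N = mix (code (renumber c t.1)) := by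
  induction ls generalizing acc with
  | nil => exact ⟨acc, rfl, fun N hN => Or.inl hN⟩
  | cons t ls ih =>
    obtain ⟨tbl, htbl, hmem⟩ := withCodes_eq t.1 t.2 acc fun acc => withTable ls acc k
    obtain ⟨tbl', htbl', hmem'⟩ := ih tbl
    refine ⟨tbl', htbl.trans htbl', fun N hN => ?_⟩
    rcases hmem' N hN with h | ⟨t', ht', hc⟩
    · rcases hmem N h with h | hc
      · exact Or.inl h
      · exact Or.inr ⟨t, by simp, hc⟩
    · exact Or.inr ⟨t', by simp [ht'], hc⟩

theorem lt_ten_of_mem_surfaces {l : List (ℕ × ℕ × ℕ)} (hl : l ∈ surfaces) :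
    ∀ t ∈ l, t.1 < 10 ∧ t.2.1 < 10 ∧ t.2.2 < 10 := by
  intro t ht
  have h := List.all_eq_true.1 (List.all_eq_true.1 digits_surfaces l hl) t ht
  simpa [Nat.blt_eq, and_assoc] using h

theorem has_mix_eq (N : ℕ) : Has (mix N) = Has N :=
  funext fun _ => funext fun _ => funext fun _ => propext has_mix

theorem isK10_has_code {l : List (ℕ × ℕ × ℕ)} (hl : l ∈ surfaces) : IsK10 (Has (code l)) := by
  have h := List.all_eq_true.1 isSurface_surfaces l hl
  rw [force_eq] at h
  exact has_mix_eq (code l) ▸ isK10_of_isSurface h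

/-- The digits of a renumbering define a permutation of the vertices. -/
theorem exists_perm_digit {cs : List ℕ} (hcs : cs ∈ renumberings) {c : ℕ} (hc : c ∈ cs) :
    ∃ τ : Equiv.Perm (Fin 10), ∀ a, (τ a : ℕ) = digit c a := by
  have h := List.all_eq_true.1 (List.all_eq_true.1 digit_renumberings cs hcs) c hc
  rw [List.all_eq_true] at h
  let f : Fin 10 → Fin 10 := fun a => ⟨digit c a, Nat.mod_lt _ (by norm_num)⟩
  have hf : Function.Surjective f := by
    intro b
    obtain ⟨a, ha, hab⟩ := List.any_eq_true.1 (h b (List.mem_range.2 b.isLt))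
    exact ⟨⟨a, List.mem_range.1 ha⟩, Fin.ext (beq_iff.1 hab)⟩
  exact ⟨Equiv.ofBijective f (Finite.surjective_iff_bijective.1 hf), fun a => rfl⟩

variable {P Q : Fin 10 → Fin 10 → Fin 10 → Prop}

/-- The surface of a triangle list embeds into every surface containing a renumbering of the
list. -/
theorem exists_perm_of_sub_renumber (hQ : IsK10 Q) {l : List (ℕ × ℕ × ℕ)} (hl : l ∈ surfaces)
    {cs : List ℕ} (hcs : cs ∈ renumberings) {c : ℕ} (hc : c ∈ cs)
    (h : Sub (code (renumber c l)) Q) :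
    ∃ τ : Equiv.Perm (Fin 10), ∀ x y z, Q (τ x) (τ y) (τ z) ↔ Has (code l) x y z := by
  obtain ⟨τ, hτ⟩ := exists_perm_digit hcs hc
  refine ⟨τ, fun x y z =>
    (isK10_has_code hl).eq_of_le (hQ.comp_perm τ) fun x y z hxyz => ?_⟩
  obtain ⟨a, b, d, hmem, htri⟩ := exists_of_has_code (lt_ten_of_mem_surfaces hl) hxyz
  have hQ' : Q (τ a) (τ b) (τ d) := h.le (has_code (by
    rw [hτ, hτ, hτ]
    exact List.mem_map_of_mem (f := fun t => (digit c t.1, digit c t.2.1, digit c t.2.2)) hmem))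
  exact (sub_triMask (hQ.comp_perm τ) hQ').le htri

theorem isTodo_order (h : Sub (code wheel) Q) : IsTodo Q order := by
  intro t ht
  have hc := List.all_eq_true.1 order_wheel t ht
  obtain ⟨v, p, s⟩ := t
  simp only [Bool.and_eq_true, Nat.blt_eq, Bool.not_eq_true', bit_eq] at hc
  obtain ⟨⟨⟨⟨⟨hv, hp⟩, hs⟩, h1⟩, h2⟩, h3⟩ := hc
  lift v to Fin 10 using hv
  lift p to Fin 10 using hp
  lift s to Fin 10 using hs
  exact ⟨v, p, s, rfl, h.le (b := p) (c := 0) h1, h.le (b := 0) h2,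
    fun he => Nat.ne_of_beq_eq_false h3 (congrArg Fin.val he)⟩

theorem exists_perm_of_searchFrom (hQ : IsK10 Q) {bad : ℕ} {l : List (ℕ × ℕ × ℕ)}
    (hwheel : Sub (code wheel) Q) (hl : Sub (code l) Q)
    (hbad : ∀ a b c, Has bad a b c → ¬ Q a b c)
    (h : withTable (List.zip surfaces renumberings) [] (fun tbl => searchFrom tbl bad l) = true) :
    ∃ T ∈ surfaces, ∃ τ : Equiv.Perm (Fin 10),
      ∀ x y z, Q (τ x) (τ y) (τ z) ↔ Has (code T) x y z := by
  obtain ⟨tbl, heq, hmem⟩ := withTable_eq (List.zip surfaces renumberings) []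
    fun tbl => searchFrom tbl bad l
  rw [heq] at h
  simp only [searchFrom, force_eq] at h
  obtain ⟨N', hN', hsub⟩ := nextVertex_sound hQ (search_sound hQ hbad 90)
    (isTodo_order hwheel) hl.mix h
  rcases hmem N' (memb_eq_true hN') with h' | ⟨⟨T, cs⟩, ht, c, hc, rfl⟩
  · exact absurd h' (by simp)
  · obtain ⟨hT, hcs⟩ := List.of_mem_zip ht
    refine ⟨T, hT, exists_perm_of_sub_renumber hQ hT hcs hc ⟨?_, ?_, ?_⟩⟩ <;> intro x y z hh
    · exact hsub.le (has_mix.2 hh)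
    · exact has_mix.1 (hsub.swap_left (has_mix.2 hh))
    · exact has_mix.1 (hsub.swap_right (has_mix.2 hh))

/-- A link cycle can be moved to the cycle `1, ..., 9` around the vertex `0`. -/
theorem exists_perm_wheel (hP : IsK10 P) {v : Fin 10} {w : ℕ → Fin 10} (hw : IsLinkCycle P v w) :
    ∃ σ : Equiv.Perm (Fin 10), Sub (code wheel) (fun a b c => P (σ a) (σ b) (σ c)) ∧
      σ 0 = v ∧ σ 1 = w 0 ∧ σ 2 = w 1 ∧ σ 4 = w 3 := by
  obtain ⟨σ, h0, hσ⟩ := hP.exists_perm_of_isLinkCycle hw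
  have h1 := hσ 0 (by norm_num) 1 rfl
  have h2 := hσ 1 (by norm_num) 2 rfl
  have h3 := hσ 2 (by norm_num) 3 rfl
  have h4 := hσ 3 (by norm_num) 4 rfl
  have h5 := hσ 4 (by norm_num) 5 rfl
  have h6 := hσ 5 (by norm_num) 6 rfl
  have h7 := hσ 6 (by norm_num) 7 rfl
  have h8 := hσ 7 (by norm_num) 8 rfl
  have h9 := hσ 8 (by norm_num) 9 rfl
  refine ⟨σ, sub_code (hP.comp_perm σ) _ ?_, h0, h1, h2, h4⟩
  simp only [wheel, List.forall_mem_cons]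
  refine ⟨⟨0, 1, 2, rfl, ?_⟩, ⟨0, 2, 3, rfl, ?_⟩, ⟨0, 3, 4, rfl, ?_⟩, ⟨0, 4, 5, rfl, ?_⟩,
    ⟨0, 5, 6, rfl, ?_⟩, ⟨0, 6, 7, rfl, ?_⟩, ⟨0, 7, 8, rfl, ?_⟩, ⟨0, 8, 9, rfl, ?_⟩,
    ⟨0, 9, 1, rfl, ?_⟩, by simp⟩
  · rw [h0, h1, h2]; exact hw.rel 0
  · rw [h0, h2, h3]; exact hw.rel 1
  · rw [h0, h3, h4]; exact hw.rel 2
  · rw [h0, h4, h5]; exact hw.rel 3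
  · rw [h0, h5, h6]; exact hw.rel 4
  · rw [h0, h6, h7]; exact hw.rel 5
  · rw [h0, h7, h8]; exact hw.rel 6
  · rw [h0, h8, h9]; exact hw.rel 7
  · rw [h0, h9, h1, ← hw.nine]; exact hw.rel 8

theorem not_of_has_skew (hQ : IsK10 Q) (hwheel : Sub (code wheel) Q)
    (h : ∀ a b c d, Q 0 a b → Q 0 b c → Q 0 c d → a ≠ c → ¬ Q a b d) (a b c : Fin 10)
    (hs : Has (code skew) a b c) : ¬ Q a b c := by
  have hall := List.all_eq_true.1 skew_wheel
  simp only [Bool.and_eq_true, Nat.blt_eq, Bool.not_eq_true', bit_eq, List.any_eq_true] at hall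
  obtain ⟨x, y, z, hmem, htri⟩ := exists_of_has_code
    (fun t ht => ⟨(hall t ht).1.1.1, (hall t ht).1.1.2, (hall t ht).1.2⟩) hs
  obtain ⟨-, u, hu, ⟨⟨h1, h2⟩, h3⟩, h4⟩ := hall _ hmem
  rw [List.mem_range] at hu
  lift u to Fin 10 using hu
  have hne := h x y u z (hwheel.le (a := 0) h1) (hwheel.le (a := 0) h2) (hwheel.le (a := 0) h3)
    (fun he => Nat.ne_of_beq_eq_false h4 (congrArg Fin.val he))
  intro habc
  rw [has_triMask] at htri
  have q1 := hQ.swap_left habc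
  have q2 := hQ.swap_right habc
  have q3 := hQ.rotate habc
  have q4 := hQ.rotate q3
  have q5 := hQ.swap_left q3
  grind

/-- Every surface is a renumbering of one of the listed surfaces. -/
theorem exists_perm_surfaces (hP : IsK10 P) : ∃ T ∈ surfaces, ∃ τ : Equiv.Perm (Fin 10),
    ∀ x y z, P (τ x) (τ y) (τ z) ↔ Has (code T) x y z := by
  suffices ∃ σ : Equiv.Perm (Fin 10), ∃ T ∈ surfaces, ∃ τ : Equiv.Perm (Fin 10),
      ∀ x y z, P (σ (τ x)) (σ (τ y)) (σ (τ z)) ↔ Has (code T) x y z by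
    obtain ⟨σ, T, hT, τ, h⟩ := this
    exact ⟨T, hT, τ.trans σ, h⟩
  by_cases hex : ∃ v a b c d, P v a b ∧ P v b c ∧ P v c d ∧ a ≠ c ∧ P a b d
  · obtain ⟨v, a, b, c, d, hab, hbc, hcd, hac, hd⟩ := hex
    obtain ⟨w, rfl, rfl, hw⟩ := hP.exists_isLinkCycle hab
    obtain rfl := (hw.eq_or_eq hP hbc).resolve_left hac.symm
    obtain rfl := (hw.eq_or_eq hP hcd).resolve_left (hP.ne_right hd).symm
    obtain ⟨σ, hwheel, -, h1, h2, h4⟩ := exists_perm_wheel hP hw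
    have h124 : P (σ 1) (σ 2) (σ 4) := by rwa [h1, h2, h4]
    exact ⟨σ, exists_perm_of_searchFrom (l := (1, 2, 4) :: wheel) (hP.comp_perm σ) hwheel
      ((sub_triMask (x := 1) (y := 2) (z := 4) (hP.comp_perm σ) h124).lor hwheel)
      (fun x y z h => absurd h (by simp [Has])) searchFrom_one_two_four⟩
  · obtain ⟨x, y, -, hxy⟩ := hP.two (show (0 : Fin 10) ≠ 1 by decide)
    obtain ⟨w, -, -, hw⟩ := hP.exists_isLinkCycle ((hxy x).2 (Or.inl rfl))
    obtain ⟨σ, hwheel, -⟩ := exists_perm_wheel hP hw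
    refine ⟨σ, exists_perm_of_searchFrom (hP.comp_perm σ) hwheel hwheel
      (not_of_has_skew (hP.comp_perm σ) hwheel fun a b c d hab hbc hcd hac hd =>
        hex ⟨_, _, _, _, _, hab, hbc, hcd, σ.injective.ne hac, hd⟩) searchFrom_skew⟩

/-- The surface with a listed set of triangles. -/
noncomputable def listed (i : Fin surfaces.length) : TriSurface 10 :=
  (isK10_has_code (List.get_mem surfaces i)).toTriSurface

theorem eulerChar_listed (i : Fin surfaces.length) : (listed i).eulerChar = -5 :=
  IsK10.eulerChar_toTriSurface _

theorem tri_listed (i : Fin surfaces.length) : (listed i).Tri = Has (code (surfaces.get i)) :=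
  funext fun _ => funext fun _ => funext fun _ => propext (IsK10.tri_toTriSurface _)

theorem invariant_eq_of_iso {S T : TriSurface 10} (h : S.Iso T) :
    invariant S.Tri = invariant T.Tri := by
  obtain ⟨σ, hσ⟩ := h.exists_perm
  rw [← invariant_comp_perm T.Tri σ]
  exact congrArg invariant (funext fun a => funext fun b => funext fun c => propext (hσ a b c))

theorem invariant_listed_injective : Function.Injective fun i => invariant (listed i).Tri := by
  have hnodup : (surfaces.map fun l => invariant (Has (code l))).Nodup := by
    have heq : (surfaces.map fun l => invariant (Has (code l))) =
        surfaces.map (fun l => force (mix (code l)) maskInvariant) := by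
      refine List.map_congr_left fun l _ => ?_
      rw [force_eq, ← invariant_has, has_mix_eq]
    rw [heq, maskInvariant_surfaces]
    simp
  intro i j hij
  simp only [tri_listed] at hij
  exact List.nodup_iff_injective_get.1 (hnodup.of_map _)
    (List.inj_on_of_nodup_map hnodup (List.get_mem _ i) (List.get_mem _ j) hij)

end TenVertex

open TenVertex

/-- There are exactly 14 combinatorial isomorphism classes of non-orientable triangulated
surfaces with 10 vertices and Euler characteristic -5 (triangulations of the
non-orientable surface of genus 7). -/
theorem num_nonorientable_genus_seven_10_vertices :
    Nat.card (Quot (fun S T : {S : TriSurface 10 // ¬ S.Orientable ∧ S.eulerChar = -5} =>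
      S.1.Iso T.1)) = 14 := by
  let R := fun S T : {S : TriSurface 10 // ¬ S.Orientable ∧ S.eulerChar = -5} => S.1.Iso T.1
  let f : Fin surfaces.length → Quot R := fun i =>
    Quot.mk R ⟨listed i, (listed i).not_orientable (eulerChar_listed i), eulerChar_listed i⟩
  have hf : Function.Bijective f := by
    constructor
    · intro i j hij
      let g : Quot R → ℕ :=
        Quot.lift (fun S => invariant S.1.Tri) fun S T h => invariant_eq_of_iso h
      have hg : ∀ i, g (f i) = invariant (listed i).Tri := fun i => rfl
      apply invariant_listed_injective
      beta_reduce
      rw [← hg, ← hg, hij]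
    · rintro ⟨S, hS⟩
      obtain ⟨T, hT, τ, h⟩ := exists_perm_surfaces (S.isK10_tri hS.2)
      obtain ⟨i, rfl⟩ := List.get_of_mem hT
      refine ⟨i, Quot.sound (TriSurface.iso_of_tri τ fun a b c => ?_)⟩
      rw [tri_listed, h]
  rw [← Nat.card_eq_of_bijective f hf, Nat.card_eq_fintype_card, Fintype.card_fin]
  rfl
end
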